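/- arXiv:2507.07594 — 4 statements merged into one kernel-verified Lean document; each statement's English description precedes it below -/
import Mathlib

section
/- For every integer k ≥ 1 there is a constant c_k > 0 depending only on k with the following property: for every integer n ≥ k there exist δ > 0 and q_0 such that for every prime power q ≥ q_0 there exists a (k, r)-evasive set S ⊆ 𝔽_q^n with |S| ≥ δ·q^{n−k}, where r = ⌈c_k · n^{H_k}⌉; that is, |S| ≥ δ·q^{n−k} and every k-dimensional affine subspace of 𝔽_q^n contains fewer than c_k·n^{H_k} points of S. -/
open Polynomial in
theorem Polynomial.height_le_height_map_C {R : Type*} [CommRing R] [IsNoetherianRing R]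
    (p : Ideal R) [p.IsPrime] : p.height ≤ (p.map (C : R →+* R[X])).height := by
  have hP : (p.map (C : R →+* R[X])).IsPrime := Ideal.isPrime_map_C_of_isPrime
  have : (p.map (C : R →+* R[X])).LiesOver p := ⟨by
    ext x
    simp only [Ideal.under_def, Ideal.mem_comap, Polynomial.algebraMap_eq, Ideal.mem_map_C_iff,
      Polynomial.coeff_C]
    constructor
    · intro h n; split_ifs <;> simp [h]
    · intro h; simpa using h 0⟩
  rw [Ideal.height_eq_height_add_of_liesOver_of_hasGoingDown p (p.map C)]
  exact le_self_add

open MvPolynomial in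
/-- Some of the images of the variables under `ψ` are algebraically independent, and there are at
least as many of them as the number of variables minus the height of the kernel. -/
theorem MvPolynomial.exists_algebraicIndependent_card_le_height_ker_add {ι : Type*} [Finite ι]
    {F B : Type*} [Field F] [CommRing B] [IsDomain B] [Algebra F B] (ψ : MvPolynomial ι F →ₐ[F] B) :
    ∃ (σ : Type) (_ : Fintype σ) (e : σ → ι), AlgebraicIndependent F (fun j => ψ (X (e j))) ∧
      (Nat.card ι : ℕ∞) ≤ (RingHom.ker ψ).height + Fintype.card σ := by
  induction ι using Finite.induction_empty_option with
  | of_equiv eq ih =>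
    obtain ⟨σ, _, e, he, hc⟩ := ih (ψ.comp (rename eq))
    refine ⟨σ, inferInstance, fun j => eq (e j), by simpa using he, ?_⟩
    rw [← Nat.card_congr eq]
    refine hc.trans (le_of_eq ?_)
    congr 1
    rw [← (renameEquiv F eq).toRingEquiv.height_comap (RingHom.ker ψ)]
    rfl
  | h_empty =>
    refine ⟨PEmpty, inferInstance, PEmpty.elim, ?_, by simp⟩
    rw [algebraicIndependent_empty_type_iff]
    exact FaithfulSMul.algebraMap_injective F B
  | @h_option ι _ ih =>
    set ψ' : MvPolynomial ι F →ₐ[F] B := ψ.comp (rename some) with hψ'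
    obtain ⟨σ, _, e, he, hc⟩ := ih ψ'
    let E := optionEquivLeft F ι
    let χ : Polynomial (MvPolynomial ι F) →ₐ[F] B := ψ.comp E.symm.toAlgHom
    have hht : (RingHom.ker ψ).height = (RingHom.ker χ).height := by
      rw [← E.symm.toRingEquiv.height_comap (RingHom.ker ψ)]
      rfl
    have hχC : ∀ a, χ (Polynomial.C a) = ψ' a := by
      intro a
      have : χ.comp Polynomial.CAlgHom = ψ' := by
        ext i
        simp [χ, E, hψ']
      exact DFunLike.congr_fun this a
    have hχX : χ Polynomial.X = ψ (X none) := by simp [χ, E]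
    set p := RingHom.ker ψ' with hp
    have : p.IsPrime := RingHom.ker_isPrime _
    have hPp : (RingHom.ker χ).IsPrime := RingHom.ker_isPrime _
    have hle : p.map Polynomial.C ≤ RingHom.ker χ := by
      rw [Ideal.map_le_iff_le_comap]
      intro a ha
      rw [Ideal.mem_comap, RingHom.mem_ker, hχC]
      exact ha
    have hpC : (p.map (Polynomial.C)).IsPrime := Ideal.isPrime_map_C_of_isPrime
    have h1 := Polynomial.height_le_height_map_C p
    rw [Nat.card_eq_fintype_card] at hc ⊢
    rw [hht, Fintype.card_option]
    by_cases heq : RingHom.ker χ = p.map Polynomial.C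
    · refine ⟨Option σ, inferInstance, fun o => o.map e, ?_, ?_⟩
      · have := (he.option_iff_transcendental (ψ (X none))).2 ?_
        · convert this using 2 with o
          cases o <;> simp [hψ']
        · rw [transcendental_iff]
          intro q hq
          have hsurj : ∀ z : Algebra.adjoin F (Set.range fun j => ψ' (X (e j))),
              ∃ a : MvPolynomial ι F, ψ' a = z := by
            intro z
            have : Algebra.adjoin F (Set.range fun j => ψ' (X (e j))) ≤ ψ'.range := by
              rw [Algebra.adjoin_le_iff]
              rintro _ ⟨j, rfl⟩
              exact ⟨_, rfl⟩
            exact this z.2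
          choose g hg using hsurj
          let Q : Polynomial (MvPolynomial ι F) :=
            ∑ n ∈ Finset.range (q.natDegree + 1), Polynomial.monomial n (g (q.coeff n))
          have hQ : Q ∈ RingHom.ker χ := by
            rw [RingHom.mem_ker, ← hq, Polynomial.aeval_eq_sum_range]
            simp only [Q, map_sum, ← Polynomial.C_mul_X_pow_eq_monomial, map_mul, map_pow, hχC, hg,
              hχX]
            rfl
          rw [heq, Ideal.mem_map_C_iff] at hQ
          ext n
          have h3 := hQ n
          by_cases hn : n < q.natDegree + 1
          · simp only [Q, Polynomial.finsetSum_coeff, Polynomial.coeff_monomial] at h3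
            rw [Finset.sum_ite_eq' , if_pos (Finset.mem_range.2 hn), hp, RingHom.mem_ker, hg] at h3
            simpa using h3
          · rw [Polynomial.coeff_eq_zero_of_natDegree_lt (by omega)]; simp
      · rw [heq, Fintype.card_option]
        push_cast
        rw [← add_assoc]
        gcongr
        exact hc.trans (by gcongr)
    · refine ⟨σ, inferInstance, fun j => some (e j), by simpa [hψ'] using he, ?_⟩
      have h2 := Ideal.height_add_one_le_of_lt_of_isPrime (lt_of_le_of_ne hle (Ne.symm heq))
      push_cast
      calc (Fintype.card ι : ℕ∞) + 1 ≤ (p.height + Fintype.card σ) + 1 := by gcongr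
        _ = (p.height + 1) + Fintype.card σ := by ring
        _ ≤ _ := by gcongr; exact le_trans (by gcongr) h2

open MvPolynomial in
/-- Among any algebra generators of a polynomial ring, a prime of height at most `r` leaves at
least `dim - r` of them algebraically independent modulo it. -/
theorem MvPolynomial.exists_algebraicIndependent_mk {k n r m : ℕ} {F : Type} [Field F]
    (P : Ideal (MvPolynomial (Fin k) F)) [P.IsPrime] (hP : P.height ≤ r) (hm : m + r ≤ k)
    (l : Fin n → MvPolynomial (Fin k) F) (hl : Algebra.adjoin F (Set.range l) = ⊤) :
    ∃ e : Fin m → Fin n, AlgebraicIndependent F (fun j => Ideal.Quotient.mkₐ F P (l (e j))) := by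
  obtain ⟨σ, _, e, he, hc⟩ :=
    exists_algebraicIndependent_card_le_height_ker_add (Ideal.Quotient.mkₐ F P)
  have hker : RingHom.ker (Ideal.Quotient.mkₐ F P) = P := Ideal.Quotient.mkₐ_ker F P
  rw [hker] at hc
  have hσ : m ≤ Fintype.card σ := by
    have : ((m + r : ℕ) : ℕ∞) ≤ ((r + Fintype.card σ : ℕ) : ℕ∞) := by
      calc ((m + r : ℕ) : ℕ∞) ≤ (k : ℕ∞) := by exact_mod_cast hm
        _ ≤ _ := by simpa using hc
        _ ≤ _ := by push_cast; gcongr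
    have := Nat.cast_le.1 this
    omega
  have hadj : Algebra.adjoin F (Set.range (fun j => Ideal.Quotient.mkₐ F P (l j))) = ⊤ := by
    have : Set.range (fun j => Ideal.Quotient.mkₐ F P (l j)) =
      (Ideal.Quotient.mkₐ F P) '' Set.range l := by rw [← Set.range_comp]; rfl
    rw [this, ← AlgHom.map_adjoin, hl, Algebra.map_top, AlgHom.range_eq_top]
    exact Ideal.Quotient.mkₐ_surjective F P
  have halg : Algebra.IsAlgebraic
      (Algebra.adjoin F (Set.range (fun j => Ideal.Quotient.mkₐ F P (l j))))
      (MvPolynomial (Fin k) F ⧸ P) := by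
    rw [hadj]
    exact ⟨fun x => isAlgebraic_algebraMap (⟨x, trivial⟩ : (⊤ : Subalgebra F _))⟩
  have : FaithfulSMul F (MvPolynomial (Fin k) F ⧸ P) := (faithfulSMul_iff_algebraMap_injective _ _).2
    (algebraMap F (MvPolynomial (Fin k) F ⧸ P)).injective
  obtain ⟨t, hts, ht⟩ := exists_isTranscendenceBasis_subset (R := F)
    (Set.range (fun j => Ideal.Quotient.mkₐ F P (l j)))
  have htf : t.Finite := (Set.finite_range _).subset hts
  have h1 := he.lift_cardinalMk_le_trdeg
  have h2 := ht.lift_cardinalMk_eq_trdeg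
  have := htf.fintype
  have hcard : m ≤ Fintype.card t := by
    refine hσ.trans ?_
    rw [Cardinal.lift_id, Cardinal.lift_id] at h1 h2
    rw [← h2, Cardinal.mk_fintype, Cardinal.mk_fintype] at h1
    exact_mod_cast h1
  obtain ⟨φ⟩ : Nonempty (Fin m ↪ t) := by
    rw [Function.Embedding.nonempty_iff_card_le]; simpa using hcard
  choose g hg using fun x : t => hts x.2
  refine ⟨fun j => g (φ j), ?_⟩
  have := ht.1.comp φ φ.injective
  convert this using 2 with j
  exact hg _

namespace MvPolynomial

variable {F : Type} [Field F] {k : ℕ}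

/-- The image in `F[X] ⧸ J` of the polynomials of total degree at most `D`. -/
noncomputable def quotientTotalDegreeLE (J : Ideal (MvPolynomial (Fin k) F)) (D : ℕ) :
    Submodule F (MvPolynomial (Fin k) F ⧸ J) :=
  (restrictTotalDegree (Fin k) F D).map (Ideal.Quotient.mkₐ F J).toLinearMap

/-- The affine Hilbert function of the ideal `J`. -/
noncomputable def hilbertFn (J : Ideal (MvPolynomial (Fin k) F)) (D : ℕ) : ℕ :=
  Module.finrank F (quotientTotalDegreeLE J D)

instance (J : Ideal (MvPolynomial (Fin k) F)) (D : ℕ) :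
    Module.Finite F (quotientTotalDegreeLE J D) := by
  unfold quotientTotalDegreeLE; infer_instance

theorem mk_mem_quotientTotalDegreeLE {J : Ideal (MvPolynomial (Fin k) F)} {D : ℕ}
    {p : MvPolynomial (Fin k) F} (hp : p.totalDegree ≤ D) :
    Ideal.Quotient.mkₐ F J p ∈ quotientTotalDegreeLE J D :=
  ⟨p, (mem_restrictTotalDegree _ _ _).2 hp, rfl⟩

theorem hilbertFn_mono (J : Ideal (MvPolynomial (Fin k) F)) : Monotone (hilbertFn J) := by
  intro D E h
  apply Submodule.finrank_mono
  apply Submodule.map_mono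
  intro p hp
  rw [mem_restrictTotalDegree] at *
  omega

theorem hilbertFn_le (J : Ideal (MvPolynomial (Fin k) F)) (D : ℕ) :
    hilbertFn J D ≤ (D + 1) ^ k := by
  refine (Submodule.finrank_map_le _ _).trans ?_
  let c : restrictTotalDegree (Fin k) F D →ₗ[F] ((Fin k → Fin (D + 1)) → F) :=
    LinearMap.pi fun a => (lcoeff F (Finsupp.equivFunOnFinite.symm fun i => (a i : ℕ))).comp
      (Submodule.subtype _)
  have hc : Function.Injective c := by
    rw [← LinearMap.ker_eq_bot, LinearMap.ker_eq_bot']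
    rintro ⟨p, hp⟩ h
    rw [mem_restrictTotalDegree] at hp
    ext s
    by_contra hs
    have hs' : s ∈ p.support := by simpa using hs
    have hle : ∀ i, s i < D + 1 := by
      intro i
      have h1 := le_totalDegree hs'
      have h2 : s i ≤ s.sum fun _ e => e := by
        rw [Finsupp.sum_fintype _ _ (fun _ => rfl)]
        exact Finset.single_le_sum (f := fun i => s i) (fun _ _ => Nat.zero_le _) (Finset.mem_univ i)
      omega
    have := congr_fun h fun i => ⟨s i, hle i⟩
    apply hs
    simp only [c, LinearMap.pi_apply, LinearMap.comp_apply, Submodule.subtype_apply, lcoeff_apply,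
      Pi.zero_apply] at this
    change coeff s p = 0
    convert this
    ext
    simp
  refine (LinearMap.finrank_le_finrank_of_injective hc).trans (le_of_eq ?_)
  simp

theorem hilbertFn_add_le {J J' : Ideal (MvPolynomial (Fin k) F)} (hJ : J ≤ J')
    {f : MvPolynomial (Fin k) F} {d : ℕ} (hd : f.totalDegree ≤ d) (hf : f ∈ J')
    (hreg : ∀ a, f * a ∈ J → a ∈ J) (D : ℕ) :
    hilbertFn J' (D + d) + hilbertFn J D ≤ hilbertFn J (D + d) := by
  let π : (MvPolynomial (Fin k) F ⧸ J) →ₗ[F] (MvPolynomial (Fin k) F ⧸ J') :=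
    (Ideal.Quotient.factorₐ F hJ).toLinearMap
  let μ : (MvPolynomial (Fin k) F ⧸ J) →ₗ[F] (MvPolynomial (Fin k) F ⧸ J) :=
    LinearMap.mulLeft F (Ideal.Quotient.mkₐ F J f)
  have hμ : Function.Injective μ := by
    rw [← LinearMap.ker_eq_bot, LinearMap.ker_eq_bot']
    intro a
    obtain ⟨a, rfl⟩ := Ideal.Quotient.mkₐ_surjective F J a
    intro h
    have h' : Ideal.Quotient.mkₐ F J (f * a) = 0 := by rw [map_mul]; exact h
    exact Ideal.Quotient.eq_zero_iff_mem.2 (hreg a (Ideal.Quotient.eq_zero_iff_mem.1 h'))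
  have hle : (quotientTotalDegreeLE J D).map μ ≤ quotientTotalDegreeLE J (D + d) := by
    rintro _ ⟨_, ⟨a, ha, rfl⟩, rfl⟩
    refine ⟨f * a, ?_, by simp [μ]⟩
    simp only [SetLike.mem_coe, mem_restrictTotalDegree] at ha ⊢
    exact (totalDegree_mul _ _).trans (by omega)
  have hmap : (quotientTotalDegreeLE J (D + d)).map π = quotientTotalDegreeLE J' (D + d) := by
    unfold quotientTotalDegreeLE
    rw [← Submodule.map_comp]
    rfl
  have h1 := LinearMap.finrank_range_add_finrank_ker (π.domRestrict (quotientTotalDegreeLE J (D + d)))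
  rw [LinearMap.range_domRestrict, hmap] at h1
  unfold hilbertFn
  rw [← h1]
  gcongr
  have hx : ∀ x : quotientTotalDegreeLE J D, μ x ∈ quotientTotalDegreeLE J (D + d) :=
    fun x => hle ⟨x, x.2, rfl⟩
  let ν : quotientTotalDegreeLE J D →ₗ[F]
      LinearMap.ker (π.domRestrict (quotientTotalDegreeLE J (D + d))) :=
    LinearMap.codRestrict _ (LinearMap.codRestrict _ (μ.comp (Submodule.subtype _)) hx) (by
      intro x
      rw [LinearMap.mem_ker]
      change π (Ideal.Quotient.mkₐ F J f * x) = 0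
      have : π (Ideal.Quotient.mkₐ F J f * x) =
        Ideal.Quotient.factorₐ F hJ (Ideal.Quotient.mkₐ F J f) * Ideal.Quotient.factorₐ F hJ x :=
        map_mul (Ideal.Quotient.factorₐ F hJ) _ _
      rw [this]
      have h0 : Ideal.Quotient.factorₐ F hJ (Ideal.Quotient.mkₐ F J f) = 0 :=
        Ideal.Quotient.eq_zero_iff_mem.2 hf
      rw [h0, zero_mul])
  apply LinearMap.finrank_le_finrank_of_injective (f := ν)
  intro x y hxy
  apply Subtype.ext
  apply hμ
  exact congr_arg Subtype.val (congr_arg Subtype.val hxy)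

theorem linearIndependent_prod_pow {B : Type*} [CommRing B] [Algebra F B] {m : ℕ} {x : Fin m → B}
    (hx : AlgebraicIndependent F x) (D : ℕ) :
    LinearIndependent F fun a : Fin m → Fin D => ∏ j, x j ^ (a j : ℕ) := by
  have h1 := (basisMonomials (Fin m) F).linearIndependent.map' (aeval x).toLinearMap
    (LinearMap.ker_eq_bot.2 hx)
  let ι : (Fin m → Fin D) → (Fin m →₀ ℕ) := fun a => Finsupp.equivFunOnFinite.symm fun i => (a i : ℕ)
  have hι : Function.Injective ι := by
    intro a b h
    ext i
    exact DFunLike.congr_fun h i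
  have h2 : (fun a : Fin m → Fin D => ∏ j, x j ^ (a j : ℕ)) =
      ((aeval x).toLinearMap ∘ basisMonomials (Fin m) F) ∘ ι := by
    ext a
    simp [aeval_monomial, ι, Finsupp.prod_fintype]
  rw [h2]
  exact h1.comp ι hι

theorem totalDegree_prod_pow_le {m : ℕ} {x : Fin m → MvPolynomial (Fin k) F}
    (hx : ∀ j, (x j).totalDegree ≤ 1) {D : ℕ} (a : Fin m → Fin (D + 1)) :
    (∏ j, x j ^ (a j : ℕ)).totalDegree ≤ m * D := by
  refine (totalDegree_finsetProd _ _).trans ?_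
  refine (Finset.sum_le_card_nsmul _ _ D fun j _ => ?_).trans (by simp)
  refine (totalDegree_pow _ _).trans ?_
  have := (a j).2
  calc (a j : ℕ) * (x j).totalDegree ≤ D * 1 := Nat.mul_le_mul (by omega) (hx j)
    _ = D := mul_one D

/-- The Hilbert function of an ideal contained in several incomparable primes of dimension `m`. -/
theorem exists_card_mul_le_hilbertFn (J : Ideal (MvPolynomial (Fin k) F))
    (s : Finset (Ideal (MvPolynomial (Fin k) F))) (hs : ∀ P ∈ s, P.IsPrime) (hJ : ∀ P ∈ s, J ≤ P)
    (hanti : ∀ P ∈ s, ∀ Q ∈ s, P ≤ Q → P = Q) (m : ℕ)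
    (hm : ∀ P ∈ s, ∃ x : Fin m → MvPolynomial (Fin k) F, (∀ j, (x j).totalDegree ≤ 1) ∧
      AlgebraicIndependent F fun j => Ideal.Quotient.mkₐ F P (x j)) :
    ∃ D₀, ∀ D, s.card * (D + 1) ^ m ≤ hilbertFn J (D₀ + m * D) := by
  classical
  have hsep : ∀ P : s, ∃ a, a ∉ (P : Ideal _) ∧ ∀ Q ∈ s, Q ≠ P → a ∈ Q := by
    rintro ⟨P, hP⟩
    have hn : ¬ (s.erase P).inf id ≤ P := by
      rw [(hs P hP).inf_le']
      rintro ⟨Q, hQ, hQP⟩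
      rw [Finset.mem_erase] at hQ
      exact hQ.1 (hanti Q hQ.2 P hP hQP)
    obtain ⟨a, ha, haP⟩ := SetLike.not_le_iff_exists.1 hn
    refine ⟨a, haP, fun Q hQ hQP => ?_⟩
    exact (Finset.inf_le (f := id) (Finset.mem_erase.2 ⟨hQP, hQ⟩)) ha
  choose a ha haQ using hsep
  choose! x hx hind using hm
  refine ⟨Finset.univ.sup fun P => (a P).totalDegree, fun D => ?_⟩
  set D₀ := Finset.univ.sup fun P => (a P).totalDegree
  let v : s × (Fin m → Fin (D + 1)) → quotientTotalDegreeLE J (D₀ + m * D) := fun i =>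
    ⟨Ideal.Quotient.mkₐ F J (a i.1 * ∏ j, x i.1 j ^ (i.2 j : ℕ)), mk_mem_quotientTotalDegreeLE <|
      (totalDegree_mul _ _).trans <| add_le_add
        (Finset.le_sup (f := fun P => (a P).totalDegree) (Finset.mem_univ i.1))
        (totalDegree_prod_pow_le (hx i.1 i.1.2) i.2)⟩
  have hv : LinearIndependent F v := by
    apply LinearIndependent.of_comp (Submodule.subtype _)
    rw [Fintype.linearIndependent_iff]
    rintro g hg ⟨⟨Q, hQ⟩, b⟩
    have := hs Q hQ
    have h1 := congr_arg (Ideal.Quotient.factorₐ F (hJ Q hQ)) hg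
    rw [map_sum, map_zero, Fintype.sum_prod_type, Fintype.sum_eq_single ⟨Q, hQ⟩] at h1
    · have h2 : Ideal.Quotient.mkₐ F Q (a ⟨Q, hQ⟩) *
          ∑ b, g (⟨Q, hQ⟩, b) • ∏ j, (Ideal.Quotient.mkₐ F Q (x Q j)) ^ (b j : ℕ) = 0 := by
        rw [← h1, Finset.mul_sum]
        refine Finset.sum_congr rfl fun b _ => ?_
        rw [map_smul, mul_smul_comm]
        congr 1
        change _ = Ideal.Quotient.mkₐ F Q (a ⟨Q, hQ⟩ * ∏ j, x Q j ^ (b j : ℕ))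
        simp only [map_mul, map_prod, map_pow]
      rcases mul_eq_zero.1 h2 with h | h
      · exact absurd (Ideal.Quotient.eq_zero_iff_mem.1 h) (ha ⟨Q, hQ⟩)
      · exact Fintype.linearIndependent_iff.1 (linearIndependent_prod_pow (hind Q hQ) (D + 1)) _ h b
    · rintro ⟨P, hP⟩ hPQ
      refine Finset.sum_eq_zero fun b _ => ?_
      rw [map_smul]
      have : Ideal.Quotient.factorₐ F (hJ Q hQ) ((⇑(Submodule.subtype _) ∘ v) (⟨P, hP⟩, b)) = 0 :=
        Ideal.Quotient.eq_zero_iff_mem.2 (Ideal.mul_mem_right _ _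
          (haQ ⟨P, hP⟩ Q hQ fun h => hPQ (Subtype.ext h.symm)))
      rw [this, smul_zero]
  simpa [hilbertFn] using hv.fintype_card_le_finrank

theorem mul_hilbertFn_radical_le {I I' : Ideal (MvPolynomial (Fin k) F)} (hI : I ≤ I')
    {f : MvPolynomial (Fin k) F} {d : ℕ} (hd : f.totalDegree ≤ d) (hf : f ∈ I')
    (hmin : ∀ P ∈ I.minimalPrimes, f ∉ P) (T D : ℕ) :
    T * hilbertFn I'.radical D ≤ hilbertFn I.radical (D + T * d) := by
  have hreg : ∀ a, f * a ∈ I.radical → a ∈ I.radical := by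
    intro a ha
    rw [← Ideal.sInf_minimalPrimes, Ideal.mem_sInf] at ha ⊢
    intro P hP
    exact (hP.1.1.mem_or_mem (ha hP)).resolve_left (hmin P hP)
  induction T with
  | zero => simp
  | succ T ih =>
    have h := hilbertFn_add_le (Ideal.radical_mono hI) hd (Ideal.le_radical hf) hreg (D + T * d)
    have h2 := hilbertFn_mono I'.radical (show D ≤ D + T * d + d by omega)
    have h3 : D + (T + 1) * d = D + T * d + d := by ring
    rw [h3, add_mul, one_mul]
    omega

theorem prod_mul_hilbertFn_radical_le (g : ℕ → MvPolynomial (Fin k) F) (d T : ℕ → ℕ) (r D : ℕ)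
    (hd : ∀ l < r, (g l).totalDegree ≤ d l)
    (hmin : ∀ l < r, ∀ P ∈ (Ideal.span (g '' Set.Iio l)).minimalPrimes, g l ∉ P) :
    (∏ l ∈ Finset.range r, T l) * hilbertFn (Ideal.span (g '' Set.Iio r)).radical D ≤
      hilbertFn (Ideal.span (g '' Set.Iio 0)).radical (D + ∑ l ∈ Finset.range r, T l * d l) := by
  induction r generalizing D with
  | zero => simp
  | succ r ih =>
    have h1 := mul_hilbertFn_radical_le (I := Ideal.span (g '' Set.Iio r))
      (I' := Ideal.span (g '' Set.Iio (r + 1)))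
      (Ideal.span_mono (Set.image_mono (Set.Iio_subset_Iio (Nat.le_succ r))))
      (hd r (Nat.lt_succ_self r)) (Ideal.subset_span ⟨r, Nat.lt_succ_self r, rfl⟩)
      (hmin r (Nat.lt_succ_self r)) (T r) D
    have h2 := ih (D + T r * d r) (fun l hl => hd l (by omega)) (fun l hl => hmin l (by omega))
    rw [Finset.prod_range_succ, Finset.sum_range_succ, mul_assoc]
    refine (Nat.mul_le_mul_left _ h1).trans (h2.trans (le_of_eq ?_))
    congr 1
    ring

/-- A Bézout-type bound for the number of incomparable `m`-dimensional primes containing a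
sequence of `k - m` polynomials each of which avoids the minimal primes of the previous ones. -/
theorem card_le_of_span_le_of_antichain (g : ℕ → MvPolynomial (Fin k) F) (d : ℕ → ℕ) {m r : ℕ}
    (hmr : m + r = k) (hd0 : ∀ l, 1 ≤ d l) (hd : ∀ l < r, (g l).totalDegree ≤ d l)
    (hmin : ∀ l < r, ∀ P ∈ (Ideal.span (g '' Set.Iio l)).minimalPrimes, g l ∉ P)
    (s : Finset (Ideal (MvPolynomial (Fin k) F))) (hs : ∀ P ∈ s, P.IsPrime)
    (hJ : ∀ P ∈ s, Ideal.span (g '' Set.Iio r) ≤ P)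
    (hanti : ∀ P ∈ s, ∀ Q ∈ s, P ≤ Q → P = Q)
    (hm : ∀ P ∈ s, ∃ x : Fin m → MvPolynomial (Fin k) F, (∀ j, (x j).totalDegree ≤ 1) ∧
      AlgebraicIndependent F fun j => Ideal.Quotient.mkₐ F P (x j)) :
    s.card ≤ (k + 1) ^ k * ∏ l ∈ Finset.range r, d l := by
  obtain ⟨D₀, hD₀⟩ := exists_card_mul_le_hilbertFn (Ideal.span (g '' Set.Iio r)).radical s hs
    (fun P hP => (hs P hP).radical_le_iff.2 (hJ P hP)) hanti m hm
  set B := ∏ l ∈ Finset.range r, d l with hB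
  have hBpos : 0 < B := Finset.prod_pos fun l _ => hd0 l
  set N := (D₀ + 1) * B with hN
  have hNpos : 0 < N := by positivity
  have hND : D₀ + 1 ≤ N := Nat.le_mul_of_pos_right _ hBpos
  let T : ℕ → ℕ := fun l => N / d l
  have hT : ∀ l ∈ Finset.range r, T l * d l = N := fun l hl =>
    Nat.div_mul_cancel (Dvd.dvd.mul_left (Finset.dvd_prod_of_mem d hl) _)
  have hTprod : (∏ l ∈ Finset.range r, T l) * B = N ^ r := by
    rw [hB, ← Finset.prod_mul_distrib, Finset.prod_congr rfl hT]
    simp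
  have h1 := prod_mul_hilbertFn_radical_le g d T r (D₀ + m * N) hd hmin
  rw [Finset.sum_congr rfl hT, Finset.sum_const, Finset.card_range, smul_eq_mul] at h1
  have h2 := h1.trans (hilbertFn_le _ _)
  have h3 : D₀ + m * N + r * N + 1 ≤ (k + 1) * N := by
    rw [← hmr]; nlinarith
  have h4 : s.card * N ^ m ≤ s.card * (N + 1) ^ m := by gcongr; omega
  have h5 : s.card * N ^ k ≤ ((k + 1) ^ k * B) * N ^ k := by
    calc s.card * N ^ k = (∏ l ∈ Finset.range r, T l) * (s.card * N ^ m) * B := by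
          rw [show N ^ k = N ^ m * N ^ r by rw [← pow_add, hmr], ← hTprod]; ring
      _ ≤ ((k + 1) * N) ^ k * B := by
          gcongr
          exact (Nat.mul_le_mul_left _ (h4.trans (hD₀ N))).trans
            (h2.trans (Nat.pow_le_pow_left h3 k))
      _ = _ := by rw [mul_pow]; ring
  exact Nat.le_of_mul_le_mul_right h5 (by positivity)

variable {n : ℕ}

theorem totalDegree_aeval_le_of_le_one {l : Fin n → MvPolynomial (Fin k) F}
    (hl : ∀ j, (l j).totalDegree ≤ 1) (f : MvPolynomial (Fin n) F) :
    (aeval l f).totalDegree ≤ f.totalDegree := by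
  rw [aeval_def, eval₂_eq']
  refine totalDegree_finsetSum_le fun s hs => ?_
  refine (totalDegree_mul _ _).trans ?_
  rw [algebraMap_eq, totalDegree_C, zero_add]
  refine (totalDegree_finsetProd _ _).trans ((Finset.sum_le_sum fun i _ => ?_).trans
    (le_of_eq_of_le (Finsupp.sum_fintype s _ fun _ => rfl).symm (le_totalDegree hs)))
  exact (totalDegree_pow _ _).trans (by simpa using Nat.mul_le_mul_left (s i) (hl i))

/-- A polynomial of bounded degree is unlikely to lie in a prescribed coset of a large-dimensional
prime. -/
theorem natCard_aeval_sub_mem_mul_pow_le [Finite F] {m d D : ℕ}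
    (l : Fin n → MvPolynomial (Fin k) F) (P : Ideal (MvPolynomial (Fin k) F)) (e : Fin m → Fin n)
    (he : AlgebraicIndependent F fun j => Ideal.Quotient.mkₐ F P (l (e j))) (hd : m * D ≤ d)
    (a : MvPolynomial (Fin k) F) :
    Nat.card {f : restrictTotalDegree (Fin n) F d // aeval l f.1 - a ∈ P} *
      Nat.card F ^ (D + 1) ^ m ≤ Nat.card (restrictTotalDegree (Fin n) F d) := by
  have : Finite (restrictTotalDegree (Fin n) F d) := Module.finite_of_finite F
  let v : (Fin m → Fin (D + 1)) → restrictTotalDegree (Fin n) F d := fun b =>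
    ⟨∏ j, X (e j) ^ (b j : ℕ), (mem_restrictTotalDegree _ _ _).2
      ((totalDegree_prod_pow_le (fun j => (totalDegree_X _).le) b).trans hd)⟩
  let Φ : {f : restrictTotalDegree (Fin n) F d // aeval l f.1 - a ∈ P} ×
      ((Fin m → Fin (D + 1)) → F) → restrictTotalDegree (Fin n) F d :=
    fun x => x.1.1 + ∑ b, x.2 b • v b
  have key : ∀ x, Ideal.Quotient.mkₐ F P (aeval l (Φ x).1) = Ideal.Quotient.mkₐ F P a +
      ∑ b, x.2 b • ∏ j, Ideal.Quotient.mkₐ F P (l (e j)) ^ (b j : ℕ) := by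
    rintro ⟨⟨f, hf⟩, u⟩
    have : Ideal.Quotient.mkₐ F P (aeval l f.1) = Ideal.Quotient.mkₐ F P a :=
      Ideal.Quotient.eq.2 hf
    simp only [Φ, v, Submodule.coe_add, map_add, this, Submodule.coe_sum, Submodule.coe_smul,
      map_sum, map_smul, map_prod, map_pow, aeval_X]
  have hΦ : Function.Injective Φ := by
    rintro x y hxy
    have h := key x
    rw [hxy, key y] at h
    have h2 : x.2 = y.2 := by
      funext b
      exact Fintype.linearIndependent_iffₛ.1 (linearIndependent_prod_pow he (D + 1)) x.2 y.2
        (add_left_cancel h).symm b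
    refine Prod.ext (Subtype.ext ?_) h2
    simpa [Φ, h2] using hxy
  have := Nat.card_le_card_of_injective Φ hΦ
  rw [Nat.card_prod] at this
  simpa [Nat.card_fun] using this

end MvPolynomial

/-- The union bound. -/
theorem Finset.exists_forall_notMem_of_card_mul_lt {V I J : Type*} [Finite V] [Nonempty V]
    (s : Finset I) (t : I → Finset J) (B : I → J → Set V) {N C : ℕ}
    (hB : ∀ i ∈ s, ∀ j ∈ t i, (B i j).ncard * N ≤ Nat.card V) (ht : ∀ i ∈ s, (t i).card ≤ C)
    (hs : s.card * C < N) : ∃ v, ∀ i ∈ s, ∀ j ∈ t i, v ∉ B i j := by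
  classical
  have := Fintype.ofFinite V
  by_contra! h
  have h1 : (Finset.univ : Finset V) ⊆ (s.sigma t).biUnion fun x => (B x.1 x.2).toFinset := by
    intro v _
    obtain ⟨i, hi, j, hj, hv⟩ := h v
    simp only [Finset.mem_biUnion, Finset.mem_sigma, Set.mem_toFinset]
    exact ⟨⟨i, j⟩, ⟨hi, hj⟩, hv⟩
  have h2 : Nat.card V * N ≤ (s.sigma t).card * Nat.card V := by
    rw [Nat.card_eq_fintype_card]
    refine (Nat.mul_le_mul_right N ((Finset.card_le_card h1).trans Finset.card_biUnion_le)).trans ?_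
    rw [Finset.sum_mul, ← smul_eq_mul (a := (s.sigma t).card)]
    refine Finset.sum_le_card_nsmul _ _ _ fun x hx => ?_
    rw [Finset.mem_sigma] at hx
    have := hB x.1 hx.1 x.2 hx.2
    rwa [Set.ncard_eq_toFinset_card', Nat.card_eq_fintype_card] at this
  have h3 : (s.sigma t).card ≤ s.card * C := by
    rw [Finset.card_sigma, ← smul_eq_mul]
    exact Finset.sum_le_card_nsmul _ _ _ ht
  have := Nat.card_pos (α := V)
  nlinarith

namespace MvPolynomial

variable {F : Type} [Field F] {k n : ℕ}

/-- The coordinates of the affine map `t ↦ b + t A` from `F ^ k` to `F ^ n`, with `φ = (b, A)`. -/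
noncomputable def affineCoord (φ : (Fin n → F) × (Fin n → Fin k → F)) (j : Fin n) :
    MvPolynomial (Fin k) F :=
  C (φ.1 j) + ∑ i, C (φ.2 j i) * X i

theorem totalDegree_affineCoord_le (φ : (Fin n → F) × (Fin n → Fin k → F)) (j : Fin n) :
    (affineCoord φ j).totalDegree ≤ 1 := by
  refine (totalDegree_add _ _).trans (max_le (by simp) ?_)
  refine totalDegree_finsetSum_le fun i _ => (totalDegree_mul _ _).trans ?_
  rw [totalDegree_C, totalDegree_X]

/-- The equations `f l = c l` pulled back along an affine map. -/
noncomputable def affinePullback (φ : (Fin n → F) × (Fin n → Fin k → F))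
    (f : ℕ → MvPolynomial (Fin n) F) (c : Fin k → F) (l : ℕ) : MvPolynomial (Fin k) F :=
  aeval (affineCoord φ) (f l) - C (if h : l < k then c ⟨l, h⟩ else 0)

theorem totalDegree_affinePullback_le (φ : (Fin n → F) × (Fin n → Fin k → F))
    (f : ℕ → MvPolynomial (Fin n) F) (c : Fin k → F) (l : ℕ) :
    (affinePullback φ f c l).totalDegree ≤ (f l).totalDegree := by
  refine (totalDegree_sub_C_le _ _).trans ?_
  exact totalDegree_aeval_le_of_le_one (totalDegree_affineCoord_le φ) _

/-- On every embedded affine space, the level sets of `f l` contain no component of an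
intersection of level sets of `f 0, …, f (l - 1)`. -/
def AvoidsMinimalPrimes (k : ℕ) (f : ℕ → MvPolynomial (Fin n) F) (l : ℕ) : Prop :=
  ∀ φ : (Fin n → F) × (Fin n → Fin k → F), Algebra.adjoin F (Set.range (affineCoord φ)) = ⊤ →
    ∀ c : Fin k → F, ∀ P ∈ (Ideal.span (affinePullback φ f c '' Set.Iio l)).minimalPrimes,
      affinePullback φ f c l ∉ P

theorem AvoidsMinimalPrimes.congr {f f' : ℕ → MvPolynomial (Fin n) F} {l : ℕ}
    (h : AvoidsMinimalPrimes k f l) (hf : ∀ i ≤ l, f' i = f i) : AvoidsMinimalPrimes k f' l := by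
  intro φ hφ c
  have h1 : ∀ i ≤ l, affinePullback φ f' c i = affinePullback φ f c i := fun i hi => by
    simp only [affinePullback, hf i hi]
  rw [h1 l le_rfl,
    Set.image_congr (g := affinePullback φ f c) fun i hi => h1 i (Set.mem_Iio.1 hi).le]
  exact h φ hφ c

theorem exists_algebraicIndependent_affineCoord {m r : ℕ} (hmr : m + r = k)
    {φ : (Fin n → F) × (Fin n → Fin k → F)}
    (hφ : Algebra.adjoin F (Set.range (affineCoord φ)) = ⊤) (g : ℕ → MvPolynomial (Fin k) F)
    {P : Ideal (MvPolynomial (Fin k) F)}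
    (hP : P ∈ (Ideal.span (g '' Set.Iio r)).minimalPrimes) :
    ∃ e : Fin m → Fin n,
      AlgebraicIndependent F fun j => Ideal.Quotient.mkₐ F P (affineCoord φ (e j)) := by
  have : P.IsPrime := hP.1.1
  have hfin : (Set.Iio r).Finite := Set.finite_Iio r
  refine exists_algebraicIndependent_mk P ?_ hmr.le _ hφ
  refine (Ideal.height_le_card_of_mem_minimalPrimes_span (hfin.image g) hP).trans ?_
  have := Set.ncard_image_le (f := g) hfin
  simp only [Set.ncard_Iio_nat] at this
  exact_mod_cast this

theorem ncard_minimalPrimes_affinePullback_le {f : ℕ → MvPolynomial (Fin n) F} {d : ℕ → ℕ}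
    (hd0 : ∀ l, 1 ≤ d l) {r : ℕ} (hr : r ≤ k) (hd : ∀ l < r, (f l).totalDegree ≤ d l)
    (hf : ∀ l < r, AvoidsMinimalPrimes k f l) {φ : (Fin n → F) × (Fin n → Fin k → F)}
    (hφ : Algebra.adjoin F (Set.range (affineCoord φ)) = ⊤) (c : Fin k → F) :
    (Ideal.span (affinePullback φ f c '' Set.Iio r)).minimalPrimes.ncard ≤
      (k + 1) ^ k * ∏ l ∈ Finset.range r, d l := by
  have hfin := Ideal.finite_minimalPrimes_of_isNoetherianRing _
    (Ideal.span (affinePullback φ f c '' Set.Iio r))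
  rw [Set.ncard_eq_toFinset_card _ hfin]
  refine card_le_of_span_le_of_antichain (affinePullback φ f c) d (Nat.sub_add_cancel hr) hd0
    (fun l hl => (totalDegree_affinePullback_le φ f c l).trans (hd l hl))
    (fun l hl => hf l hl φ hφ c) _ ?_ ?_ ?_ ?_
  · simp only [Set.Finite.mem_toFinset]
    exact fun P hP => hP.1.1
  · simp only [Set.Finite.mem_toFinset]
    exact fun P hP => hP.1.2
  · simp only [Set.Finite.mem_toFinset]
    exact fun P hP Q hQ hPQ => le_antisymm hPQ (hQ.2 hP.1 hPQ)
  · simp only [Set.Finite.mem_toFinset]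
    intro P hP
    obtain ⟨e, he⟩ :=
      exists_algebraicIndependent_affineCoord (Nat.sub_add_cancel hr) hφ (affinePullback φ f c) hP
    exact ⟨fun j => affineCoord φ (e j), fun j => totalDegree_affineCoord_le φ _, he⟩

theorem exists_avoidsMinimalPrimes_update [Finite F] {f : ℕ → MvPolynomial (Fin n) F} {d : ℕ → ℕ}
    (hd0 : ∀ l, 1 ≤ d l) {m r : ℕ} (hmr : m + r = k) (hd : ∀ l < r, (f l).totalDegree ≤ d l)
    (hf : ∀ l < r, AvoidsMinimalPrimes k f l) {D : ℕ} (hD : m * D ≤ d r)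
    (hDE : (n + 1) * (k + 1) ≤ (D + 1) ^ m)
    (hq : (k + 1) ^ k * ∏ l ∈ Finset.range r, d l < Nat.card F) :
    ∃ p : MvPolynomial (Fin n) F, p.totalDegree ≤ d r ∧
      AvoidsMinimalPrimes k (Function.update f r p) r := by
  classical
  have := Fintype.ofFinite F
  have : Finite (restrictTotalDegree (Fin n) F (d r)) := Module.finite_of_finite F
  let I := ((Fin n → F) × (Fin n → Fin k → F)) × (Fin k → F)
  let s : Finset I := {i | Algebra.adjoin F (Set.range (affineCoord i.1)) = ⊤}
  have hfin : ∀ i : I, (Ideal.span (affinePullback i.1 f i.2 '' Set.Iio r)).minimalPrimes.Finite :=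
    fun i => Ideal.finite_minimalPrimes_of_isNoetherianRing _ _
  let t : I → Finset (Ideal (MvPolynomial (Fin k) F)) := fun i => (hfin i).toFinset
  let B : I → Ideal (MvPolynomial (Fin k) F) → Set (restrictTotalDegree (Fin n) F (d r)) :=
    fun i P => {p | aeval (affineCoord i.1) p.1 - C (if h : r < k then i.2 ⟨r, h⟩ else 0) ∈ P}
  have hex : ∃ p, ∀ i ∈ s, ∀ P ∈ t i, p ∉ B i P := by
    refine Finset.exists_forall_notMem_of_card_mul_lt s t B (N := Nat.card F ^ (D + 1) ^ m)
      (C := (k + 1) ^ k * ∏ l ∈ Finset.range r, d l) ?_ ?_ ?_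
    · intro i hi P hP
      obtain ⟨e, he⟩ := exists_algebraicIndependent_affineCoord hmr
        (by simpa [s] using hi : Algebra.adjoin F (Set.range (affineCoord i.1)) = ⊤)
        (affinePullback i.1 f i.2) (by simpa [t] using hP)
      exact natCard_aeval_sub_mem_mul_pow_le (affineCoord i.1) P e he hD _
    · intro i hi
      have := ncard_minimalPrimes_affinePullback_le hd0 (by omega) hd hf
        (by simpa [s] using hi : Algebra.adjoin F (Set.range (affineCoord i.1)) = ⊤) i.2
      rwa [Set.ncard_eq_toFinset_card _ (hfin i)] at this
    · have hI : s.card ≤ Nat.card F ^ (n + n * k + k) := by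
        refine (Finset.card_le_univ s).trans (le_of_eq ?_)
        simp only [I, Fintype.card_prod, Fintype.card_fun, Fintype.card_fin, Nat.card_eq_fintype_card]
        ring
      have hq0 : 0 < Nat.card F := Nat.card_pos
      calc _ ≤ Nat.card F ^ (n + n * k + k) * ((k + 1) ^ k * ∏ l ∈ Finset.range r, d l) := by gcongr
        _ < Nat.card F ^ (n + n * k + k) * Nat.card F := by gcongr
        _ = Nat.card F ^ ((n + 1) * (k + 1)) := by ring
        _ ≤ _ := Nat.pow_le_pow_right hq0 hDE
  obtain ⟨p, hp⟩ := hex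
  refine ⟨p.1, (mem_restrictTotalDegree _ _ _).1 p.2, fun φ hφ c P hP => ?_⟩
  have h1 : ∀ l < r, affinePullback φ (Function.update f r p.1) c l = affinePullback φ f c l :=
    fun l hl => by simp only [affinePullback, Function.update_of_ne hl.ne]
  rw [Set.image_congr (s := Set.Iio r) h1] at hP
  have := hp (φ, c) (by simpa [s] using hφ) P (by simpa [t] using hP)
  simpa [B, affinePullback] using this

theorem exists_forall_avoidsMinimalPrimes [Finite F] {d D : ℕ → ℕ} (hd0 : ∀ l, 1 ≤ d l)
    (hD : ∀ r < k, (k - r) * D r ≤ d r) (hDE : ∀ r < k, (n + 1) * (k + 1) ≤ (D r + 1) ^ (k - r))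
    (hq : (k + 1) ^ k * ∏ l ∈ Finset.range k, d l < Nat.card F) :
    ∃ f : ℕ → MvPolynomial (Fin n) F, ∀ l < k,
      (f l).totalDegree ≤ d l ∧ AvoidsMinimalPrimes k f l := by
  suffices ∀ r ≤ k, ∃ f : ℕ → MvPolynomial (Fin n) F, ∀ l < r,
      (f l).totalDegree ≤ d l ∧ AvoidsMinimalPrimes k f l from this k le_rfl
  intro r hr
  induction r with
  | zero => exact ⟨0, by simp⟩
  | succ r ih =>
    obtain ⟨f, hf⟩ := ih (by omega)
    obtain ⟨p, hp, hpr⟩ := exists_avoidsMinimalPrimes_update hd0 (Nat.sub_add_cancel (by omega))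
      (fun l hl => (hf l hl).1) (fun l hl => (hf l hl).2) (hD r hr) (hDE r hr)
      (lt_of_le_of_lt (Nat.mul_le_mul_left _
        (Finset.prod_le_prod_of_subset_of_one_le' (Finset.range_mono (by omega))
          fun l _ _ => hd0 l)) hq)
    refine ⟨Function.update f r p, fun l hl => ?_⟩
    rcases (Nat.lt_succ_iff_lt_or_eq.1 hl) with h | rfl
    · refine ⟨by simpa [Function.update_of_ne h.ne] using (hf l h).1, (hf l h).2.congr fun i hi => ?_⟩
      rw [Function.update_of_ne (by omega)]
    · exact ⟨by simpa using hp, hpr⟩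

end MvPolynomial

namespace MvPolynomial

variable {F : Type} [Field F] {k n : ℕ}

theorem eval_affineCoord (φ : (Fin n → F) × (Fin n → Fin k → F)) (t : Fin k → F) (j : Fin n) :
    eval t (affineCoord φ j) = φ.1 j + ∑ i, φ.2 j i * t i := by
  simp [affineCoord]

theorem eval_affinePullback (φ : (Fin n → F) × (Fin n → Fin k → F))
    (f : ℕ → MvPolynomial (Fin n) F) (c : Fin k → F) (t : Fin k → F) (l : Fin k) :
    eval t (affinePullback φ f c l) = eval (fun j => eval t (affineCoord φ j)) (f l) - c l := by
  have : eval t (aeval (affineCoord φ) (f l)) = eval (fun j => eval t (affineCoord φ j)) (f l) := by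
    simp only [← coe_aeval_eq_eval, RingHom.coe_coe]
    exact comp_aeval_apply _ _ _
  rw [affinePullback, map_sub, this, eval_C, dif_pos l.2]

theorem adjoin_range_affineCoord {φ : (Fin n → F) × (Fin n → Fin k → F)}
    (hφ : LinearIndependent F fun i : Fin k => fun j => φ.2 j i) :
    Algebra.adjoin F (Set.range (affineCoord φ)) = ⊤ := by
  obtain ⟨M, hM⟩ := LinearMap.exists_leftInverse_of_injective
    (Fintype.linearCombination F fun i : Fin k => fun j => φ.2 j i)
    (LinearMap.ker_eq_bot.2 hφ.fintypeLinearCombination_injective)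
  obtain ⟨w, hw⟩ : ∃ w : Fin n → Fin k → F, ∀ i i',
      ∑ j, φ.2 j i * w j i' = Pi.single (M := fun _ => F) i 1 i' := by
    refine ⟨fun j => M fun j' => if j = j' then 1 else 0, fun i i' => ?_⟩
    have := congr_fun (LinearMap.congr_fun hM (Pi.single i 1)) i'
    rw [LinearMap.comp_apply, Fintype.linearCombination_apply_single, one_smul,
      LinearMap.pi_apply_eq_sum_univ M] at this
    simpa using this
  rw [eq_top_iff, ← adjoin_range_X, Algebra.adjoin_le_iff]
  rintro _ ⟨i, rfl⟩
  have h : (X i : MvPolynomial (Fin k) F) =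
      ∑ j, w j i • (affineCoord φ j - algebraMap F _ (φ.1 j)) := by
    simp only [affineCoord, algebraMap_eq, add_sub_cancel_left, Finset.smul_sum]
    rw [Finset.sum_comm]
    have : ∀ i', ∑ j, w j i • (C (φ.2 j i') * X i' : MvPolynomial (Fin k) F) =
        C (Pi.single (M := fun _ => F) i' 1 i) * X i' := by
      intro i'
      rw [← hw, map_sum, Finset.sum_mul]
      refine Finset.sum_congr rfl fun j _ => ?_
      rw [smul_eq_C_mul, C_mul]; ring
    rw [Finset.sum_congr rfl fun i' _ => this i', Finset.sum_eq_single i]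
    · simp
    · intro i' _ hi
      simp [Pi.single_eq_of_ne hi.symm]
    · simp
  rw [h]
  refine Subalgebra.sum_mem _ fun j _ => Subalgebra.smul_mem _ (Subalgebra.sub_mem _
    (Algebra.subset_adjoin (Set.mem_range_self j)) (Subalgebra.algebraMap_mem _ _)) _

theorem exists_affineCoord_of_finrank_direction (W : AffineSubspace F (Fin n → F))
    (hW : Module.finrank F W.direction = k) {p : Fin n → F} (hp : p ∈ W) :
    ∃ φ : (Fin n → F) × (Fin n → Fin k → F), Algebra.adjoin F (Set.range (affineCoord φ)) = ⊤ ∧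
      ∀ x ∈ W, ∃ t, (fun j => eval t (affineCoord φ j)) = x := by
  let b := Module.finBasisOfFinrankEq F W.direction hW
  refine ⟨(p, fun j i => (b i : Fin n → F) j), adjoin_range_affineCoord ?_, fun x hx => ?_⟩
  · exact b.linearIndependent.map' W.direction.subtype W.direction.ker_subtype
  · let v : W.direction := ⟨x -ᵥ p, AffineSubspace.vsub_mem_direction hx hp⟩
    refine ⟨b.repr v, ?_⟩
    funext j
    have := congr_arg (fun w : W.direction => (w : Fin n → F) j) (b.sum_repr v)
    simp only [Submodule.coe_sum, Submodule.coe_smul, Finset.sum_apply, Pi.smul_apply, v,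
      smul_eq_mul, vsub_eq_sub, Pi.sub_apply] at this
    rw [eval_affineCoord, ← add_sub_cancel (p j) (x j), ← this]
    exact congr_arg _ (Finset.sum_congr rfl fun i _ => mul_comm _ _)

theorem eq_of_ker_eval_le {t t' : Fin k → F}
    (h : RingHom.ker (eval t) ≤ RingHom.ker (eval t')) : t = t' := by
  funext i
  have : X i - C (t i) ∈ RingHom.ker (eval t') := h (by simp [RingHom.mem_ker])
  simpa [RingHom.mem_ker, sub_eq_zero, eq_comm] using this

theorem ncard_fiber_inter_affineSubspace_le [Finite F] {d : ℕ → ℕ} (hd0 : ∀ l, 1 ≤ d l)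
    {f : ℕ → MvPolynomial (Fin n) F}
    (hf : ∀ l < k, (f l).totalDegree ≤ d l ∧ AvoidsMinimalPrimes k f l) (c : Fin k → F)
    (W : AffineSubspace F (Fin n → F)) (hW : Module.finrank F W.direction = k) :
    ({x | ∀ l : Fin k, eval x (f l) = c l} ∩ (W : Set (Fin n → F))).ncard ≤
      (k + 1) ^ k * ∏ l ∈ Finset.range k, d l := by
  classical
  rcases (W : Set (Fin n → F)).eq_empty_or_nonempty with hemp | ⟨p, hp⟩
  · simp [hemp]
  obtain ⟨φ, hφ, hsurj⟩ := exists_affineCoord_of_finrank_direction W hW hp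
  have := Fintype.ofFinite F
  let T : Finset (Fin k → F) := {t | ∀ l : Fin k, eval t (affinePullback φ f c l) = 0}
  have hsub : {x | ∀ l : Fin k, eval x (f l) = c l} ∩ (W : Set (Fin n → F)) ⊆
      ↑(T.image fun t j => eval t (affineCoord φ j)) := by
    rintro x ⟨hx, hxW⟩
    obtain ⟨t, ht⟩ := hsurj x hxW
    simp only [Finset.coe_image, Set.mem_image, Finset.mem_coe]
    refine ⟨t, ?_, ht⟩
    simp only [T, Finset.mem_filter, Finset.mem_univ, true_and]
    intro l
    rw [eval_affinePullback, ht, hx l, sub_self]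
  refine (Set.ncard_le_ncard hsub (Finset.finite_toSet _)).trans ?_
  rw [Set.ncard_coe_finset]
  refine Finset.card_image_le.trans ?_
  rw [← Finset.card_image_of_injective T (f := fun t => RingHom.ker (eval t))
    fun t t' h => eq_of_ker_eval_le (le_of_eq h)]
  refine card_le_of_span_le_of_antichain (m := 0) (affinePullback φ f c) d (zero_add k) hd0
    (fun l hl => (totalDegree_affinePullback_le φ f c l).trans (hf l hl).1)
    (fun l hl => (hf l hl).2 φ hφ c) _ ?_ ?_ ?_ ?_
  · simp only [Finset.forall_mem_image]
    exact fun t _ => RingHom.ker_isPrime _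
  · simp only [Finset.forall_mem_image]
    intro t ht
    rw [Ideal.span_le]
    rintro _ ⟨l, hl, rfl⟩
    simp only [T, Finset.mem_filter, Finset.mem_univ, true_and] at ht
    exact ht ⟨l, hl⟩
  · simp only [Finset.forall_mem_image]
    exact fun t _ t' _ h => by rw [eq_of_ker_eval_le h]
  · simp only [Finset.forall_mem_image]
    intro t _
    have : (RingHom.ker (eval t)).IsPrime := RingHom.ker_isPrime _
    exact ⟨Fin.elim0, fun j => j.elim0, algebraicIndependent_empty_type⟩

end MvPolynomial

theorem exists_pow_sub_le_ncard_fiber {F : Type} [Fintype F] [Nonempty F] {k n : ℕ} (hkn : k ≤ n)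
    (f : (Fin n → F) → Fin k → F) :
    ∃ c, Fintype.card F ^ (n - k) ≤ {x | f x = c}.ncard := by
  classical
  obtain ⟨c, hc⟩ := Fintype.exists_le_card_fiber_of_mul_le_card (n := Fintype.card F ^ (n - k)) f (by
    simp [← pow_add, Nat.add_sub_cancel' hkn])
  refine ⟨c, ?_⟩
  rwa [Set.ncard_eq_toFinset_card', Set.toFinset_ofPred]

theorem natCast_mul_ceil_rpow_le {k n m : ℕ} (hk : 1 ≤ k) (hn : 1 ≤ n) (hm : 1 ≤ m) :
    ((k * ⌈((4 * k * n : ℕ) : ℝ) ^ (1 / m : ℝ)⌉₊ : ℕ) : ℝ) ≤ 8 * k ^ 2 * (n : ℝ) ^ (1 / m : ℝ) := by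
  have hk' : (1 : ℝ) ≤ k := by exact_mod_cast hk
  have hm' : (1 : ℝ) ≤ m := by exact_mod_cast hm
  have hE : (1 : ℝ) ≤ ((4 * k * n : ℕ) : ℝ) := by
    exact_mod_cast Nat.one_le_iff_ne_zero.2 (by positivity)
  have h1 : (1 : ℝ) ≤ ((4 * k * n : ℕ) : ℝ) ^ (1 / m : ℝ) := Real.one_le_rpow hE (by positivity)
  have h2 := (Nat.ceil_lt_add_one (zero_le_one.trans h1)).le
  have h3 : ((4 * k * n : ℕ) : ℝ) ^ (1 / m : ℝ) ≤ (4 * k) * (n : ℝ) ^ (1 / m : ℝ) := by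
    push_cast
    rw [Real.mul_rpow (by positivity) (by positivity)]
    gcongr
    refine (Real.rpow_le_rpow_of_exponent_le (by linarith) ?_).trans_eq (Real.rpow_one _)
    exact (div_le_one (by linarith)).2 hm'
  push_cast at *
  nlinarith

theorem mul_succ_le_ceil_rpow_add_one_pow {k n m : ℕ} (hk : 1 ≤ k) (hn : 1 ≤ n) (hm : 1 ≤ m) :
    (n + 1) * (k + 1) ≤ (⌈((4 * k * n : ℕ) : ℝ) ^ (1 / m : ℝ)⌉₊ + 1) ^ m := by
  have h1 : (n + 1) * (k + 1) ≤ 4 * k * n := by nlinarith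
  refine h1.trans ?_
  have h2 := Nat.le_ceil (((4 * k * n : ℕ) : ℝ) ^ (1 / m : ℝ))
  rw [← Nat.cast_le (α := ℝ)]
  calc ((4 * k * n : ℕ) : ℝ) = (((4 * k * n : ℕ) : ℝ) ^ (1 / m : ℝ)) ^ m := by
        rw [one_div, Real.rpow_inv_natCast_pow (by positivity) (by omega)]
    _ ≤ ((⌈((4 * k * n : ℕ) : ℝ) ^ (1 / m : ℝ)⌉₊ + 1 : ℕ) : ℝ) ^ m := by
        gcongr
        push_cast at *
        linarith
    _ = _ := by push_cast; rfl

theorem prod_range_rpow_one_div_sub {n : ℕ} (hn : 1 ≤ n) (k : ℕ) :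
    ∏ r ∈ Finset.range k, (n : ℝ) ^ (1 / (k - r : ℕ) : ℝ) =
      (n : ℝ) ^ (∑ i ∈ Finset.range k, (1 : ℝ) / (i + 1)) := by
  rw [← Finset.sum_range_reflect, ← Real.rpow_sum_of_pos (by exact_mod_cast hn)]
  refine congr_arg _ (Finset.sum_congr rfl fun r hr => ?_)
  rw [Finset.mem_range] at hr
  rw [show k - r = k - 1 - r + 1 by omega]
  push_cast
  rfl

/-- For every integer `k ≥ 1` there is a constant `c > 0` depending only on
`k` such that for every `n ≥ k` there exist `δ > 0` and `q₀` such that for every prime power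
`q ≥ q₀` (i.e. every finite field `F` of cardinality `q`) there is a `(k, r)`-evasive set
`S ⊆ F^n` of size at least `δ·q^(n-k)`, with `r = ⌈c · n^(H_k)⌉`, where
`H_k = 1 + 1/2 + ⋯ + 1/k`: every `k`-dimensional affine subspace of `F^n` contains fewer than
`c · n^(H_k)` points of `S`. -/
theorem statement0 (k : ℕ) (hk : 1 ≤ k) :
    ∃ c : ℝ, 0 < c ∧
      ∀ n : ℕ, k ≤ n →
        ∃ δ : ℝ, 0 < δ ∧
          ∃ q0 : ℕ, ∀ q : ℕ, q0 ≤ q → IsPrimePow q →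
            ∀ (F : Type) [Field F] [Fintype F], Fintype.card F = q →
              ∃ S : Set (Fin n → F),
                δ * (q : ℝ) ^ (n - k) ≤ (S.ncard : ℝ) ∧
                ∀ W : AffineSubspace F (Fin n → F),
                  Module.finrank F W.direction = k →
                    ((S ∩ (W : Set (Fin n → F))).ncard : ℝ) <
                      c * (n : ℝ) ^ (∑ i ∈ Finset.range k, (1 : ℝ) / (i + 1)) := by
  refine ⟨(k + 1) ^ k * (8 * k ^ 2) ^ k + 1, by positivity, fun n hkn => ⟨1, one_pos, ?_⟩⟩
  have hn : 1 ≤ n := hk.trans hkn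
  let D : ℕ → ℕ := fun r => ⌈((4 * k * n : ℕ) : ℝ) ^ (1 / (k - r : ℕ) : ℝ)⌉₊
  let d : ℕ → ℕ := fun r => k * D r
  have hd0 : ∀ r, 1 ≤ d r := fun r => Nat.mul_pos hk (Nat.ceil_pos.2 (by positivity))
  refine ⟨(k + 1) ^ k * ∏ l ∈ Finset.range k, d l + 1, fun q hq _ F _ _ hF => ?_⟩
  obtain ⟨f, hf⟩ := MvPolynomial.exists_forall_avoidsMinimalPrimes (F := F) (n := n) (D := D) hd0
    (fun r _ => Nat.mul_le_mul_right _ (Nat.sub_le k r))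
    (fun r hr => mul_succ_le_ceil_rpow_add_one_pow hk hn (by omega))
    (by rw [Nat.card_eq_fintype_card]; omega)
  obtain ⟨c, hc⟩ := exists_pow_sub_le_ncard_fiber hkn
    fun (x : Fin n → F) (l : Fin k) => MvPolynomial.eval x (f l)
  simp only [funext_iff] at hc
  refine ⟨_, by rw [one_mul, ← hF]; exact_mod_cast hc, fun W hW => ?_⟩
  have h1 : (0 : ℝ) < (n : ℝ) ^ (∑ i ∈ Finset.range k, (1 : ℝ) / (i + 1)) :=
    Real.rpow_pos_of_pos (by exact_mod_cast hn) _
  have h2 : ((∏ l ∈ Finset.range k, d l : ℕ) : ℝ) ≤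
      (8 * k ^ 2) ^ k * (n : ℝ) ^ (∑ i ∈ Finset.range k, (1 : ℝ) / (i + 1)) := by
    rw [← prod_range_rpow_one_div_sub hn]
    push_cast
    calc _ ≤ ∏ r ∈ Finset.range k, (8 * (k : ℝ) ^ 2 * (n : ℝ) ^ (1 / (k - r : ℕ) : ℝ)) :=
          Finset.prod_le_prod (fun _ _ => by positivity) fun r hr =>
            natCast_mul_ceil_rpow_le hk hn (by have := Finset.mem_range.1 hr; omega)
      _ = _ := by rw [Finset.prod_mul_distrib]; simp
  calc _ ≤ (((k + 1) ^ k * ∏ l ∈ Finset.range k, d l : ℕ) : ℝ) := by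
        exact_mod_cast MvPolynomial.ncard_fiber_inter_affineSubspace_le hd0 hf c W hW
    _ ≤ (k + 1) ^ k * ((8 * k ^ 2) ^ k *
          (n : ℝ) ^ (∑ i ∈ Finset.range k, (1 : ℝ) / (i + 1))) := by
        rw [Nat.cast_mul]
        push_cast at h2 ⊢
        gcongr
    _ < _ := by rw [add_mul, one_mul, ← mul_assoc]; linarith
end

section
/- For all positive integers k ≤ n and every algebraically closed field F, there exist nonconstant homogeneous polynomials f_1, …, f_k ∈ F[x_0, …, x_n] with (deg f_1)·(deg f_2)⋯(deg f_k) ≤ c_k · n^{H_k}, where c_k > 0 depends only on k, such that the projective zero locus Z(f_1,…,f_k) ⊆ P^n(F) meets every k-plane of P^n(F) in a finite set; equivalently, for every (k+1)-dimensional linear subspace W of F^{n+1}, only finitely many lines through the origin in W lie in the common vanishing set of f_1, …, f_k. -/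
/-- If every sufficiently high power of each `x j` is a polynomial of lower degree in the `x`'s,
then every polynomial in the `x`'s lies in the span of finitely many monomials. -/
lemma isIntegral_of_pow_eq_lower {σ K A : Type*} [Finite σ] [Field K] [CommRing A] [Algebra K A]
    (x : σ → A) (E : ℕ)
    (h : ∀ j, ∃ r : MvPolynomial σ K, (∀ γ ∈ r.support, γ.degree < E) ∧
      x j ^ E = MvPolynomial.aeval x r) (j : σ) : IsIntegral K (x j) := by
  classical
  have := Fintype.ofFinite σ
  let box : Set (σ →₀ ℕ) := {γ | ∀ j, γ j < E}
  have hbox : box.Finite := by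
    refine Set.Finite.of_finite_image (f := fun γ : σ →₀ ℕ => (γ : σ → ℕ)) ?_
      (DFunLike.coe_injective.injOn)
    refine (Set.Finite.pi' (fun _ : σ => Set.finite_Iio E)).subset ?_
    rintro _ ⟨γ, hγ, rfl⟩ i
    exact hγ i
  let mon : (σ →₀ ℕ) → A := fun γ => MvPolynomial.aeval x (MvPolynomial.monomial γ (1 : K))
  let B : Submodule K A := Submodule.span K (mon '' box)
  have key : ∀ N : ℕ, ∀ γ : σ →₀ ℕ, γ.degree = N → mon γ ∈ B := by
    intro N
    induction N using Nat.strong_induction_on with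
    | _ N ih =>
      intro γ hγ
      by_cases hb : γ ∈ box
      · exact Submodule.subset_span ⟨γ, hb, rfl⟩
      · obtain ⟨i, hi⟩ : ∃ i, E ≤ γ i := by simpa [box] using hb
        obtain ⟨r, hr, hxr⟩ := h i
        obtain ⟨δ, rfl⟩ : ∃ δ, γ = δ + Finsupp.single i E :=
          ⟨γ - Finsupp.single i E, by rw [tsub_add_cancel_of_le]; simpa using hi⟩
        have h1 : mon (δ + Finsupp.single i E) =
            MvPolynomial.aeval x (MvPolynomial.monomial δ (1 : K) * r) := by
          simp only [mon, map_mul, ← hxr]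
          rw [MvPolynomial.aeval_monomial, MvPolynomial.aeval_monomial,
            Finsupp.prod_add_index' (by simp) (by simp [pow_add])]
          simp
        rw [h1, r.as_sum, Finset.mul_sum, map_sum]
        refine Submodule.sum_mem _ fun β hβ => ?_
        rw [MvPolynomial.monomial_mul, one_mul]
        have h2 : MvPolynomial.aeval x (MvPolynomial.monomial (δ + β) (r.coeff β)) =
            r.coeff β • mon (δ + β) := by
          rw [← map_smul, MvPolynomial.smul_monomial, smul_eq_mul, mul_one]
        rw [h2]
        refine B.smul_mem _ (ih _ ?_ _ rfl)
        have := hr β hβ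
        simp only [map_add, Finsupp.degree_single] at hγ ⊢
        omega
  have hfg : (MvPolynomial.aeval (R := K) x).range.toSubmodule.FG := by
    have hle : (MvPolynomial.aeval (R := K) x).range.toSubmodule ≤ B := by
      rintro _ ⟨p, rfl⟩
      change MvPolynomial.aeval x p ∈ B
      rw [p.as_sum, map_sum]
      refine Submodule.sum_mem _ fun β _ => ?_
      have h2 : MvPolynomial.aeval x (MvPolynomial.monomial β (p.coeff β)) =
            p.coeff β • mon β := by
        rw [← map_smul, MvPolynomial.smul_monomial, smul_eq_mul, mul_one]
      rw [h2]
      exact B.smul_mem _ (key _ _ rfl)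
    have : FiniteDimensional K B := FiniteDimensional.span_of_finite K (hbox.image _)
    have := Submodule.finiteDimensional_of_le hle
    exact Module.Finite.iff_fg.mp this
  exact IsIntegral.of_mem_of_fg _ hfg _ ⟨MvPolynomial.X j, by simp⟩

/-- Homogeneous polynomials without a common zero on the hyperplane `x none = 0` have
only integral solutions on the affine chart `x none = 1`. -/
lemma isIntegral_of_zero_of_hyperplane {σ L K A lam : Type*} [Finite σ] [Field L] [Field K]
    [Algebra L K] [IsAlgClosed K] [CommRing A] [Algebra L A]
    (G : lam → MvPolynomial (Option σ) L) (d : lam → ℕ) (hG : ∀ l, (G l).IsHomogeneous (d l))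
    (hz : ∀ x : Option σ → K, x none = 0 → (∀ l, MvPolynomial.aeval x (G l) = 0) → x = 0)
    (x : Option σ → A) (hx : x none = 1) (hxG : ∀ l, MvPolynomial.aeval x (G l) = 0)
    (j : Option σ) : IsIntegral L (x j) := by
  classical
  have := Fintype.ofFinite σ
  let I : Ideal (MvPolynomial (Option σ) L) := Ideal.span (Set.range G)
  let J := I ⊔ Ideal.span {MvPolynomial.X none}
  have hrad : ∀ i, MvPolynomial.X i ∈ J.radical := by
    intro i
    rw [← MvPolynomial.vanishingIdeal_zeroLocus_eq_radical (K := K),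
      MvPolynomial.mem_vanishingIdeal_iff]
    intro y hy
    have hy' : ∀ p ∈ J, MvPolynomial.aeval y p = 0 := hy
    have := hz y
      (by simpa only [MvPolynomial.aeval_X] using
        hy' (MvPolynomial.X none) (Ideal.mem_sup_right (Ideal.subset_span rfl)))
      (fun l => hy' _ (Ideal.mem_sup_left (Ideal.subset_span ⟨l, rfl⟩)))
    simp [this]
  choose e he using hrad
  let E := (∑ i, e i) + 1
  have hE : ∀ i, (MvPolynomial.X i : MvPolynomial (Option σ) L) ^ E ∈ J := by
    intro i
    refine Ideal.mem_of_dvd _ (pow_dvd_pow _ ?_) (he i)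
    exact (Finset.single_le_sum (fun _ _ => Nat.zero_le _) (Finset.mem_univ i)).trans
      (Nat.le_succ _)
  let := MvPolynomial.gradedAlgebra (σ := Option σ) (R := L)
  have hI : I.IsHomogeneous (MvPolynomial.homogeneousSubmodule (Option σ) L) := by
    refine Ideal.homogeneous_span _ _ ?_
    rintro _ ⟨l, rfl⟩
    exact ⟨d l, hG l⟩
  have hI0 : ∀ p ∈ I, MvPolynomial.aeval x p = 0 := by
    have : I ≤ RingHom.ker (MvPolynomial.aeval (R := L) x) := by
      refine Ideal.span_le.mpr ?_
      rintro _ ⟨l, rfl⟩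
      exact hxG l
    exact this
  refine isIntegral_of_pow_eq_lower x E (fun i => ?_) j
  obtain ⟨p, hp, q, hq, hpq⟩ := Submodule.mem_sup.mp (hE i)
  obtain ⟨r, rfl⟩ := Ideal.mem_span_singleton.mp hq
  refine ⟨MvPolynomial.homogeneousComponent (E - 1) r, ?_, ?_⟩
  · intro γ hγ
    have := MvPolynomial.homogeneousComponent_isHomogeneous (E - 1) r
      (MvPolynomial.mem_support_iff.mp hγ)
    rw [Finsupp.degree_eq_weight_one]
    have hE1 : 1 ≤ E := Nat.le_add_left _ _
    change Finsupp.weight 1 γ < E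
    omega
  · have h1 := congrArg (MvPolynomial.homogeneousComponent E) hpq
    have h2 : MvPolynomial.homogeneousComponent E
        (MvPolynomial.X none * r : MvPolynomial (Option σ) L) =
        MvPolynomial.X none * MvPolynomial.homogeneousComponent (E - 1) r := by
      ext γ
      rw [MvPolynomial.coeff_homogeneousComponent, MvPolynomial.coeff_X_mul',
        MvPolynomial.coeff_X_mul', MvPolynomial.coeff_homogeneousComponent]
      by_cases hγ : none ∈ γ.support
      · obtain ⟨δ, rfl⟩ : ∃ δ, γ = δ + Finsupp.single none 1 :=
          ⟨γ - Finsupp.single none 1, by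
            rw [tsub_add_cancel_of_le]
            simpa [Nat.one_le_iff_ne_zero] using hγ⟩
        have hE1 : 1 ≤ E := Nat.le_add_left _ _
        have : (δ.degree + 1 = E) ↔ δ.degree = E - 1 := by omega
        simp [this]
      · simp [hγ]
    have h3 := MvPolynomial.homogeneousComponent_mem_of_mem hI hp E
    rw [map_add, h2, MvPolynomial.homogeneousComponent_eq_self
      (MvPolynomial.isHomogeneous_X_pow i E)] at h1
    have h4 := congrArg (MvPolynomial.aeval x) h1
    simp only [map_add, map_mul, hI0 _ h3, MvPolynomial.aeval_X, hx, map_pow] at h4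
    simpa using h4.symm

/-- A point of an affine subspace `a + span u` that is a common zero of homogeneous polynomials
which have no nontrivial common zero on `span u` has integral coordinates. -/
lemma isIntegral_coord_of_zero {m σ L K A lam : Type*} [Fintype σ] [Field L]
    [Field K] [Algebra L K] [IsAlgClosed K] [CommRing A] [Algebra L A]
    (f : lam → MvPolynomial m L) (d : lam → ℕ) (hf : ∀ l, (f l).IsHomogeneous (d l))
    (a : m → L) (u : σ → m → L)
    (hz : ∀ y : σ → K,
      (∀ l, MvPolynomial.aeval (fun t => ∑ j, y j * algebraMap L K (u j t)) (f l) = 0) → y = 0)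
    (y : σ → A)
    (hy : ∀ l, MvPolynomial.aeval
      (fun t => algebraMap L A (a t) + ∑ j, y j * algebraMap L A (u j t)) (f l) = 0)
    (j : σ) : IsIntegral L (y j) := by
  let g : m → MvPolynomial (Option σ) L := fun t =>
    MvPolynomial.X none * MvPolynomial.C (a t) +
      ∑ j, MvPolynomial.X (some j) * MvPolynomial.C (u j t)
  have hg : ∀ t, (g t).IsHomogeneous 1 := fun t => by
    refine MvPolynomial.IsHomogeneous.add ?_ (MvPolynomial.IsHomogeneous.sum _ _ _ fun j _ => ?_)
    · exact (MvPolynomial.isHomogeneous_X _ _).mul (MvPolynomial.isHomogeneous_C _ _)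
    · exact (MvPolynomial.isHomogeneous_X _ _).mul (MvPolynomial.isHomogeneous_C _ _)
  refine isIntegral_of_zero_of_hyperplane (K := K) (fun l => MvPolynomial.bind₁ g (f l)) d
    (fun l => ?_) (fun x hx0 hx => ?_) (fun o => o.elim 1 y) rfl (fun l => ?_) (some j)
  · simpa using (hf l).aeval g hg
  · have h0 : (fun j => x (some j)) = 0 := by
      refine hz _ fun l => ?_
      have := hx l
      rw [MvPolynomial.aeval_bind₁] at this
      simpa [g, hx0] using this
    funext o
    cases o with
    | none => exact hx0
    | some j => exact congrFun h0 j
  · rw [MvPolynomial.aeval_bind₁]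
    simpa [g] using hy l

open AlgebraicIndependent IntermediateField.algebraAdjoinAdjoin in
lemma mem_algebraicClosure_adjoin_iff {F Om : Type*} [Field F] [Field Om] [Algebra F Om]
    (S : Set Om) (x : Om) : x ∈ algebraicClosure (IntermediateField.adjoin F S) Om ↔
      x ∈ (matroid F Om).closure S := by
  rw [matroid_closure_eq, mem_algebraicClosure_iff]
  exact (IsFractionRing.isAlgebraic_iff (Algebra.adjoin F S)
    (IntermediateField.adjoin F S) Om).symm

lemma algebraicClosure_adjoin_mono {F Om : Type*} [Field F] [Field Om] [Algebra F Om]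
    {S T : Set Om} (h : S ⊆ T) {x : Om}
    (hx : x ∈ algebraicClosure (IntermediateField.adjoin F S) Om) :
    x ∈ algebraicClosure (IntermediateField.adjoin F T) Om := by
  rw [mem_algebraicClosure_adjoin_iff] at hx ⊢
  exact Matroid.closure_subset_closure _ h hx

lemma subset_algebraicClosure_adjoin {F Om : Type*} [Field F] [Field Om] [Algebra F Om]
    {S : Set Om} {x : Om} (hx : x ∈ S) :
    x ∈ algebraicClosure (IntermediateField.adjoin F S) Om :=
  IntermediateField.algebraMap_mem _
    (⟨x, IntermediateField.subset_adjoin F S hx⟩ : IntermediateField.adjoin F S)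

open AlgebraicIndependent in
/-- The relative algebraic closure of `F(S)` has transcendence degree at most `#S`. -/
lemma card_le_of_mem_algebraicClosure_adjoin {F Om ι : Type*} [Field F] [Field Om] [Algebra F Om]
    [Fintype ι] (c : ι → Om) (hc : AlgebraicIndependent F c) (S : Set Om)
    (h : ∀ i, c i ∈ algebraicClosure (IntermediateField.adjoin F S) Om) :
    (Fintype.card ι : ℕ∞) ≤ S.encard := by
  have h1 : (matroid F Om).Indep (Set.range c) := by
    rw [matroid_indep_iff]
    exact (algebraicIndependent_subtype_range hc.injective).mpr hc
  have h2 : Set.range c ⊆ (matroid F Om).closure S := by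
    rintro _ ⟨i, rfl⟩
    exact (mem_algebraicClosure_adjoin_iff S _).mp (h i)
  have h3 : (Set.range c).encard = Fintype.card ι := by
    rw [← Set.image_univ, hc.injective.encard_image]
    simp
  rw [← h3, ← h1.eRk_eq_encard]
  exact ((matroid F Om).eRk_mono h2).trans
    (((matroid F Om).eRk_closure_eq S).le.trans ((matroid F Om).eRk_le_encard S))

/-- A vector satisfying `#Γ` independent linear equations over `L` has its coordinates in the
`L`-span of `#ι - #Γ` elements. -/
lemma exists_span_of_linear_relations {L M ι Γ : Type*} [Field L] [AddCommGroup M] [Module L M]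
    [Fintype ι] [Fintype Γ] (c : ι → M) (r : Γ → ι → L) (hr : LinearIndependent L r)
    (h : ∀ γ, ∑ i, r γ i • c i = 0) :
    ∃ B : Set M, B.encard + Fintype.card Γ ≤ Fintype.card ι ∧
      ∀ i, c i ∈ Submodule.span L B := by
  classical
  let T : (ι → L) →ₗ[L] M := Fintype.linearCombination L c
  have hker : Fintype.card Γ ≤ Module.finrank L (LinearMap.ker T) := by
    let r' : Γ → LinearMap.ker T := fun γ => ⟨r γ, by
      simpa [T, Fintype.linearCombination_apply] using h γ⟩
    have : LinearIndependent L r' := LinearIndependent.of_comp (LinearMap.ker T).subtype hr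
    exact this.fintype_card_le_finrank
  have hrn := T.finrank_range_add_finrank_ker
  rw [Module.finrank_fintype_fun_eq_card] at hrn
  let b := Module.finBasis L (LinearMap.range T)
  refine ⟨Set.range fun j => (b j : M), ?_, fun i => ?_⟩
  · have h1 : (Set.range fun j => (b j : M)).encard ≤ Module.finrank L (LinearMap.range T) := by
      rw [← Set.image_univ]
      refine (Set.encard_image_le _ _).trans ?_
      simp
    calc _ ≤ (Module.finrank L (LinearMap.range T) : ℕ∞) + Fintype.card Γ := by gcongr
      _ ≤ Fintype.card ι := by exact_mod_cast (by omega)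
  · have hi : c i ∈ LinearMap.range T := ⟨Pi.single i 1, by simp [T]⟩
    have hrep := congrArg Subtype.val (b.sum_repr ⟨c i, hi⟩)
    simp only [Submodule.coe_sum, Submodule.coe_smul] at hrep
    rw [← hrep]
    exact sum_mem fun j _ => Submodule.smul_mem _ _ (Submodule.subset_span ⟨j, rfl⟩)

/-- A vector satisfying `#Γ` independent linear equations over the relative algebraic closure of
`F(S)` becomes algebraic after adjoining `#ι - #Γ` further elements. -/
lemma exists_generators_of_linear_relations {F Om ι Γ : Type*} [Field F] [Field Om] [Algebra F Om]
    [Fintype ι] [Fintype Γ] (S : Set Om) (c : ι → Om)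
    (r : Γ → ι → algebraicClosure (IntermediateField.adjoin F S) Om)
    (hr : LinearIndependent (algebraicClosure (IntermediateField.adjoin F S) Om) r)
    (h : ∀ γ, ∑ i, (r γ i : Om) * c i = 0) :
    ∃ B : Set Om, B.encard + Fintype.card Γ ≤ Fintype.card ι ∧
      ∀ i, c i ∈ algebraicClosure (IntermediateField.adjoin F (S ∪ B)) Om := by
  obtain ⟨B, hB, hc⟩ := exists_span_of_linear_relations c r hr h
  suffices key : ∀ x ∈ Submodule.span (algebraicClosure (IntermediateField.adjoin F S) Om) B,
      x ∈ algebraicClosure (IntermediateField.adjoin F (S ∪ B)) Om from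
    ⟨B, hB, fun i => key _ (hc i)⟩
  intro x hx
  induction hx using Submodule.span_induction with
  | mem x hx => exact subset_algebraicClosure_adjoin (Or.inr hx)
  | zero => exact zero_mem _
  | add x y _ _ hx hy => exact add_mem hx hy
  | smul a x _ hx =>
    rw [Algebra.smul_def]
    exact mul_mem (algebraicClosure_adjoin_mono Set.subset_union_left a.2) hx

/-- Monomial vectors at points which are separated by homogeneous polynomials of degree `d` are
linearly independent. -/
lemma linearIndependent_monomials_of_separated {m ι L K Γ : Type*} [Fintype m] [Field L]
    [Field K] [Algebra L K]
    (d : ℕ) (e : ι → m →₀ ℕ) (he : ∀ α : m →₀ ℕ, α.degree = d → ∃ i, e i = α)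
    (b : Γ → m → L) (p : Γ → MvPolynomial m K) (hp : ∀ γ, (p γ).IsHomogeneous d)
    (h0 : ∀ γ δ, γ ≠ δ → MvPolynomial.eval (fun t => algebraMap L K (b δ t)) (p γ) = 0)
    (h1 : ∀ γ, MvPolynomial.eval (fun t => algebraMap L K (b γ t)) (p γ) ≠ 0) :
    LinearIndependent L (fun γ i => ∏ t, b γ t ^ e i t) := by
  classical
  rw [linearIndependent_iff']
  intro s g hg γ hγ
  have hα : ∀ α ∈ (p γ).support, ∑ δ ∈ s, algebraMap L K (g δ) *
      ∏ t, algebraMap L K (b δ t) ^ α t = 0 := by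
    intro α hα
    obtain ⟨i, rfl⟩ := he α (by
      rw [Finsupp.degree_eq_weight_one]
      exact hp γ (MvPolynomial.mem_support_iff.mp hα))
    have := congrArg (algebraMap L K) (congrFun hg i)
    simpa using this
  have key : ∑ δ ∈ s, algebraMap L K (g δ) *
      MvPolynomial.eval (fun t => algebraMap L K (b δ t)) (p γ) = 0 := by
    simp only [MvPolynomial.eval_eq', Finset.mul_sum]
    rw [Finset.sum_comm]
    refine Finset.sum_eq_zero fun α h => ?_
    have := congrArg (fun z => (p γ).coeff α * z) (hα α h)
    simp only [Finset.mul_sum, mul_zero] at this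
    rw [← this]
    exact Finset.sum_congr rfl fun δ _ => by ring
  rw [Finset.sum_eq_single_of_mem γ hγ (fun δ _ hδ => by rw [h0 γ δ hδ.symm, mul_zero])] at key
  simpa [h1 γ] using key

/-- Independent vectors admit separating homogeneous polynomials on the grid they span. -/
lemma exists_separating_polynomials {m σ K : Type*} [Fintype m] [Field K] (s e : ℕ)
    (u : σ → m → K) (v : Option (Fin s) → m → K) (huv : LinearIndependent K (Sum.elim u v))
    (τ : Fin (e + 1) → K) (hτ : Function.Injective τ)
    (b : (Fin s → Fin (e + 1)) → m → K)
    (hb : ∀ γ, b γ - (v none + ∑ l, τ (γ l) • v (some l)) ∈ Submodule.span K (Set.range u)) :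
    ∃ p : (Fin s → Fin (e + 1)) → MvPolynomial m K,
      (∀ γ, (p γ).IsHomogeneous (s * e)) ∧
      (∀ γ δ, γ ≠ δ → MvPolynomial.eval (b δ) (p γ) = 0) ∧
      ∀ γ, MvPolynomial.eval (b γ) (p γ) ≠ 0 := by
  classical
  obtain ⟨ψ, hψ⟩ := LinearMap.exists_leftInverse_of_injective _
    (LinearMap.ker_eq_bot_of_injective huv)
  have hψ' : ∀ z, ψ (Sum.elim u v z) = Finsupp.single z 1 := fun z => by
    have := congrArg (fun T => T (Finsupp.single z 1)) hψ
    simpa using this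
  let lam : Option (Fin s) → (m → K) →ₗ[K] K := fun o => Finsupp.lapply (Sum.inr o) ∘ₗ ψ
  have hu : ∀ o, ∀ w ∈ Submodule.span K (Set.range u), lam o w = 0 := by
    intro o w hw
    have : Submodule.span K (Set.range u) ≤ LinearMap.ker (lam o) := by
      refine Submodule.span_le.mpr ?_
      rintro _ ⟨j, rfl⟩
      have := hψ' (Sum.inl j)
      simp only [Sum.elim_inl] at this
      simp [lam, this]
    exact this hw
  have hv : ∀ o o', lam o (v o') = if o' = o then 1 else 0 := by
    intro o o'
    have := hψ' (Sum.inr o')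
    simp only [Sum.elim_inr] at this
    simp [lam, this, Finsupp.single_apply]
  have hlb : ∀ o γ, lam o (b γ) = lam o (v none + ∑ l, τ (γ l) • v (some l)) := by
    intro o γ
    rw [← sub_eq_zero, ← map_sub]
    exact hu o _ (hb γ)
  have hb0 : ∀ γ, lam none (b γ) = 1 := fun γ => by simp [hlb, hv]
  have hb1 : ∀ γ l, lam (some l) (b γ) = τ (γ l) := fun γ l => by simp [hlb, hv]
  let q : Option (Fin s) → MvPolynomial m K := fun o =>
    ∑ t, MvPolynomial.C (lam o (Pi.single t 1)) * MvPolynomial.X t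
  have hq : ∀ o, (q o).IsHomogeneous 1 := fun o =>
    MvPolynomial.IsHomogeneous.sum _ _ _ fun t _ => by
      simpa using (MvPolynomial.isHomogeneous_C m (lam o (Pi.single t 1))).mul
        (MvPolynomial.isHomogeneous_X K t)
  have hqe : ∀ o x, MvPolynomial.eval x (q o) = lam o x := by
    intro o x
    conv_rhs => rw [pi_eq_sum_univ' x, map_sum]
    simp only [q, map_sum, map_mul, MvPolynomial.eval_C, MvPolynomial.eval_X, map_smul,
      smul_eq_mul]
    exact Finset.sum_congr rfl fun t _ => by
      rw [mul_comm]
  let p : (Fin s → Fin (e + 1)) → MvPolynomial m K := fun γ =>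
    ∏ l : Fin s, ∏ t ∈ Finset.univ.erase (γ l), (q (some l) - MvPolynomial.C (τ t) * q none)
  have hpe : ∀ γ δ, MvPolynomial.eval (b δ) (p γ) =
      ∏ l : Fin s, ∏ t ∈ Finset.univ.erase (γ l), (τ (δ l) - τ t) := by
    intro γ δ
    simp [p, hqe, hb0, hb1]
  refine ⟨p, fun γ => ?_, fun γ δ hγδ => ?_, fun γ => ?_⟩
  · have h := MvPolynomial.IsHomogeneous.prod (Finset.univ : Finset (Fin s))
      (fun l => ∏ t ∈ Finset.univ.erase (γ l), (q (some l) - MvPolynomial.C (τ t) * q none))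
      (fun _ => e) (fun l _ => by
        have h := MvPolynomial.IsHomogeneous.prod (Finset.univ.erase (γ l))
          (fun t => q (some l) - MvPolynomial.C (τ t) * q none) (fun _ => 1)
          (fun t _ => (hq _).sub (by
            simpa using (MvPolynomial.isHomogeneous_C m (τ t)).mul (hq none)))
        simpa using h)
    simpa using h
  · rw [hpe]
    obtain ⟨l, hl⟩ := Function.ne_iff.mp hγδ
    exact Finset.prod_eq_zero (Finset.mem_univ l)
      (Finset.prod_eq_zero (Finset.mem_erase.mpr ⟨hl.symm, Finset.mem_univ (δ l)⟩) (sub_self _))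
  · rw [hpe]
    refine Finset.prod_ne_zero_iff.mpr fun l _ => Finset.prod_ne_zero_iff.mpr fun t ht => ?_
    rw [sub_ne_zero]
    exact fun h => (Finset.mem_erase.mp ht).1 (hτ h).symm

/-- The polynomial with coefficients `c` at the exponents `e`. -/
noncomputable def polyOfCoeffs {m R J : Type*} [CommSemiring R] [Fintype J]
    (e : J → m →₀ ℕ) (c : J → R) : MvPolynomial m R :=
  ∑ j, MvPolynomial.monomial (e j) (c j)

lemma isHomogeneous_polyOfCoeffs {m R J : Type*} [CommSemiring R] [Fintype J]
    (e : J → m →₀ ℕ) (c : J → R) {d : ℕ} (he : ∀ j, (e j).degree = d) :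
    (polyOfCoeffs e c).IsHomogeneous d :=
  MvPolynomial.IsHomogeneous.sum _ _ _ fun j _ =>
    MvPolynomial.isHomogeneous_monomial _ (he j)

lemma aeval_polyOfCoeffs {m R A J : Type*} [Fintype m] [CommSemiring R] [CommSemiring A]
    [Algebra R A] [Fintype J] (e : J → m →₀ ℕ) (c : J → R) (x : m → A) :
    MvPolynomial.aeval x (polyOfCoeffs e c) = ∑ j, algebraMap R A (c j) * ∏ t, x t ^ e j t := by
  simp [polyOfCoeffs, MvPolynomial.aeval_monomial, Finsupp.prod_fintype]

lemma eval_polyOfCoeffs {m R J : Type*} [Fintype m] [CommSemiring R] [Fintype J]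
    (e : J → m →₀ ℕ) (c : J → R) (x : m → R) :
    MvPolynomial.eval x (polyOfCoeffs e c) = ∑ j, c j * ∏ t, x t ^ e j t := by
  simpa using aeval_polyOfCoeffs e c x

/-- Forms with generic coefficients: if the forms indexed by `A` have no common zero on `span u`
and the degree of a further form is large, then some translate of `span u` contains no common
zero of all these forms. -/
lemma exists_translate_without_zero {F Om m σ lam : Type*} {J : lam → Type*} [Field F] [Field Om]
    [Algebra F Om] [IsAlgClosed Om] [Fintype m] [Fintype σ] [Fintype lam] [∀ l, Fintype (J l)]
    (c : (Σ l, J l) → Om) (hc : AlgebraicIndependent F c)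
    (e : ∀ l, J l → m →₀ ℕ) (d : lam → ℕ) (he : ∀ l j, (e l j).degree = d l)
    (A : Set lam) (i : lam) (hiA : i ∉ A)
    (hsurj : ∀ α : m →₀ ℕ, α.degree = d i → ∃ j, e i j = α)
    (s E : ℕ) (hd : d i = s * E)
    (u : σ → m → Om) (v : Option (Fin s) → m → Om) (huv : LinearIndependent Om (Sum.elim u v))
    (τ : Fin (E + 1) → F) (hτ : Function.Injective τ)
    (hcard : (Fintype.card σ + s + 1) * Fintype.card m < (E + 1) ^ s)
    (hz : ∀ y : σ → Om, (∀ l ∈ A, MvPolynomial.eval (∑ j, y j • u j)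
      (polyOfCoeffs (e l) fun j => c ⟨l, j⟩) = 0) → y = 0) :
    ∃ γ : Fin s → Fin (E + 1), ∀ y : σ → Om,
      ¬ ∀ l, l ∈ A ∨ l = i → MvPolynomial.eval
        (v none + ∑ l, algebraMap F Om (τ (γ l)) • v (some l) + ∑ j, y j • u j)
        (polyOfCoeffs (e l) fun j => c ⟨l, j⟩) = 0 := by
  classical
  by_contra! hcon
  choose y hy using hcon
  let uv := Sum.elim u v
  let S : Set Om := c '' {p | p.1 ≠ i} ∪ Set.range fun p : (σ ⊕ Option (Fin s)) × m => uv p.1 p.2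
  let L := algebraicClosure (IntermediateField.adjoin F S) Om
  have hcL : ∀ l ∈ A, ∀ j, c ⟨l, j⟩ ∈ L := fun l hl j =>
    subset_algebraicClosure_adjoin (Or.inl ⟨⟨l, j⟩, fun h : l = i => hiA (h ▸ hl), rfl⟩)
  have hvL : ∀ o t, uv o t ∈ L := fun o t => subset_algebraicClosure_adjoin (Or.inr ⟨(o, t), rfl⟩)
  have hFL : ∀ x : F, algebraMap F Om x ∈ L := fun x => by
    rw [IsScalarTower.algebraMap_apply F (IntermediateField.adjoin F S) Om]
    exact L.algebraMap_mem _
  let a : (Fin s → Fin (E + 1)) → m → Om := fun γ =>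
    v none + ∑ l, algebraMap F Om (τ (γ l)) • v (some l)
  have haL : ∀ γ t, a γ t ∈ L := fun γ t => by
    simp only [a, Pi.add_apply, Finset.sum_apply, Pi.smul_apply, smul_eq_mul]
    exact add_mem (hvL (Sum.inr none) t)
      (sum_mem fun l _ => mul_mem (hFL _) (hvL (Sum.inr (some l)) t))
  have hyL : ∀ γ j, y γ j ∈ L := by
    intro γ j
    have hint : IsIntegral L (y γ j) := by
      refine isIntegral_coord_of_zero (K := Om)
        (fun l : A => polyOfCoeffs (e l) fun j => (⟨c ⟨l, j⟩, hcL l l.2 j⟩ : L))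
        (fun l => d l) (fun l => isHomogeneous_polyOfCoeffs _ _ (he l))
        (fun t => ⟨a γ t, haL γ t⟩) (fun j t => ⟨u j t, hvL (Sum.inl j) t⟩) ?_ (y γ) ?_ j
      · intro z hzz
        refine hz z fun l hl => ?_
        have := hzz ⟨l, hl⟩
        rw [aeval_polyOfCoeffs] at this
        rw [eval_polyOfCoeffs]
        simpa [IntermediateField.algebraMap_apply] using this
      · intro l
        have := hy γ l (Or.inl l.2)
        rw [eval_polyOfCoeffs] at this
        rw [aeval_polyOfCoeffs]
        simpa [IntermediateField.algebraMap_apply, a] using this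
    have h2 : y γ j ∈ algebraicClosure L Om :=
      mem_algebraicClosure_iff.mpr hint.isAlgebraic
    rw [algebraicClosure.algebraicClosure_eq_bot] at h2
    obtain ⟨z, hz⟩ := h2
    rw [← hz]
    exact z.2
  let b : (Fin s → Fin (E + 1)) → m → Om := fun γ => a γ + ∑ j, y γ j • u j
  have hbL : ∀ γ t, b γ t ∈ L := fun γ t => by
    simp only [b, Pi.add_apply, Finset.sum_apply, Pi.smul_apply, smul_eq_mul]
    exact add_mem (haL γ t) (sum_mem fun j _ => mul_mem (hyL γ j) (hvL (Sum.inl j) t))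
  obtain ⟨p, hp, hp0, hp1⟩ := exists_separating_polynomials s E u v huv
    (fun t => algebraMap F Om (τ t)) ((algebraMap F Om).injective.comp hτ) b (fun γ => by
      simp only [b, a, add_sub_cancel_left]
      exact sum_mem fun j _ => Submodule.smul_mem _ _ (Submodule.subset_span ⟨j, rfl⟩))
  have hind := linearIndependent_monomials_of_separated (L := L) (K := Om) (d i) (e i) hsurj
    (fun γ t => ⟨b γ t, hbL γ t⟩) p (fun γ => hd ▸ hp γ) hp0 hp1
  obtain ⟨B, hB, hcB⟩ := exists_generators_of_linear_relations S (fun j => c ⟨i, j⟩) _ hind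
    (fun γ => by
      have := hy γ i (Or.inr rfl)
      rw [eval_polyOfCoeffs] at this
      rw [← this]
      exact Finset.sum_congr rfl fun j _ => by simp [b, a, mul_comm])
  have hle := card_le_of_mem_algebraicClosure_adjoin c hc (S ∪ B) (by
    rintro ⟨l, j⟩
    by_cases hl : l = i
    · subst hl
      exact hcB j
    · exact subset_algebraicClosure_adjoin (Or.inl (Or.inl ⟨⟨l, j⟩, hl, rfl⟩)))
  have hS1 : (c '' {p | p.1 ≠ i}).encard + Fintype.card (J i) ≤ Fintype.card (Σ l, J l) := by
    have h1 := Set.encard_add_encard_compl {p : Σ l, J l | p.1 ≠ i}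
    have h2 : ({p : Σ l, J l | p.1 ≠ i}ᶜ).encard = Fintype.card (J i) := by
      have : {p : Σ l, J l | p.1 ≠ i}ᶜ = Set.range (Sigma.mk i) := by
        ext ⟨l, j⟩
        simp [eq_comm]
      rw [this, ← Set.image_univ, sigma_mk_injective.encard_image]
      simp
    rw [h2] at h1
    calc _ ≤ _ := by gcongr; exact Set.encard_image_le _ _
      _ = _ := h1
      _ = _ := by simp
  have hS2 : (Set.range fun p : (σ ⊕ Option (Fin s)) × m => uv p.1 p.2).encard ≤
      ((Fintype.card σ + s + 1) * Fintype.card m : ℕ) := by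
    rw [← Set.image_univ]
    refine (Set.encard_image_le _ _).trans ?_
    simp [add_assoc]
  have hSB : (S ∪ B).encard ≤ _ := (Set.encard_union_le _ _).trans
    (add_le_add_left (Set.encard_union_le _ _) _)
  simp only [Fintype.card_fun, Fintype.card_fin] at hB
  have hf1 : (c '' {p | p.1 ≠ i}).Finite := Set.toFinite _
  have hf2 : (Set.range fun p : (σ ⊕ Option (Fin s)) × m => uv p.1 p.2).Finite := Set.toFinite _
  have hf3 : B.encard ≠ ⊤ := fun h => by simp [h] at hB
  have hf3 := Set.encard_ne_top_iff.mp hf3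
  have hf := hle.trans hSB
  rw [← hf1.cast_ncard_eq] at hf hS1
  rw [← hf2.cast_ncard_eq] at hf hS2
  rw [← hf3.cast_ncard_eq] at hf hB
  norm_cast at hf hS1 hS2 hB
  omega

/-- Forms with generic coefficients of the right degrees: every `(k+1)`-dimensional subspace
contains a `k`-dimensional subspace on which they have no nontrivial common zero. -/
lemma exists_le_finrank_eq_without_zero {F Om m : Type*} [Field F] [Infinite F] [Field Om]
    [Algebra F Om] [IsAlgClosed Om] [Fintype m] {k : ℕ} {J : Fin k → Type*} [∀ l, Fintype (J l)]
    (c : (Σ l, J l) → Om) (hc : AlgebraicIndependent F c)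
    (e : ∀ l, J l → m →₀ ℕ) (d : Fin k → ℕ) (he : ∀ l j, (e l j).degree = d l)
    (hsurj : ∀ l, ∀ α : m →₀ ℕ, α.degree = d l → ∃ j, e l j = α)
    (hd0 : ∀ l, d l ≠ 0) (E : Fin k → ℕ) (hd : ∀ l, d l = (k - l) * E l)
    (hcard : ∀ l : Fin k, (k + 1) * Fintype.card m < (E l + 1) ^ (k - l : ℕ))
    (W : Submodule Om (m → Om)) (hW : Module.finrank Om W = k + 1) (i : ℕ) (hi : i ≤ k) :
    ∃ U ≤ W, Module.finrank Om U = i ∧ ∀ x ∈ U, (∀ l : Fin k, (l : ℕ) < i →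
      MvPolynomial.eval x (polyOfCoeffs (e l) fun j => c ⟨l, j⟩) = 0) → x = 0 := by
  classical
  induction i with
  | zero => exact ⟨⊥, bot_le, by simp, fun x hx _ => by simpa using hx⟩
  | succ i ih =>
    obtain ⟨U, hUW, hU, hUz⟩ := ih (by omega)
    let i' : Fin k := ⟨i, by omega⟩
    let f : Fin k → MvPolynomial m Om := fun l => polyOfCoeffs (e l) fun j => c ⟨l, j⟩
    have hfs : ∀ (l) (t : Om) (x : m → Om), MvPolynomial.eval (t • x) (f l) =
        t ^ d l * MvPolynomial.eval x (f l) := fun l t x => by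
      simp only [f, eval_polyOfCoeffs, Finset.mul_sum, Pi.smul_apply, smul_eq_mul, mul_pow,
        Finset.prod_mul_distrib, Finset.prod_pow_eq_pow_sum]
      refine Finset.sum_congr rfl fun j _ => ?_
      rw [← Finsupp.degree_eq_sum, he]
      ring
    obtain ⟨Q, hQW, hQ, hQr⟩ : ∃ Q ≤ W, Disjoint U Q ∧
        Module.finrank Om Q = Fintype.card (Option (Fin (k - i))) := by
      obtain ⟨Q, hQ⟩ := Submodule.exists_isCompl U
      have h1 : Disjoint U (Q ⊓ W) := hQ.disjoint.mono_right inf_le_left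
      have h2 : U ⊔ Q ⊓ W = W := by
        rw [← sup_inf_assoc_of_le Q hUW, hQ.sup_eq_top, top_inf_eq]
      have h3 := Submodule.finrank_sup_add_finrank_inf_eq U (Q ⊓ W)
      rw [h2, hW, hU, h1.eq_bot, finrank_bot] at h3
      refine ⟨Q ⊓ W, inf_le_right, h1, ?_⟩
      rw [Fintype.card_option, Fintype.card_fin]
      omega
    let bu := Module.finBasisOfFinrankEq Om U hU
    let bv : Module.Basis (Option (Fin (k - i))) Om Q :=
      (Module.finBasisOfFinrankEq Om Q hQr).reindex (Fintype.equivFin _).symm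
    let u : Fin i → m → Om := fun j => bu j
    let v : Option (Fin (k - i)) → m → Om := fun o => bv o
    have hu : LinearIndependent Om u := bu.linearIndependent.map' U.subtype (by simp)
    have hus : Submodule.span Om (Set.range u) = U := by
      have := congrArg (Submodule.map U.subtype) bu.span_eq
      rw [Submodule.map_span, ← Set.range_comp] at this
      simpa [Function.comp_def] using this
    have hv : LinearIndependent Om v :=
      bv.linearIndependent.map' Q.subtype (by simp)
    have hvs : Submodule.span Om (Set.range v) ≤ Q := by
      refine Submodule.span_le.mpr ?_
      rintro _ ⟨o, rfl⟩
      exact (bv o).2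
    have huv : LinearIndependent Om (Sum.elim u v) := by
      refine hu.sum_type hv ?_
      rw [hus]
      exact hQ.mono_right hvs
    obtain ⟨γ, hγ⟩ := exists_translate_without_zero c hc e d he {l | l < i'} i' (by simp)
      (hsurj i') (k - i) (E i') (hd i') u v huv
      (fun t => Infinite.natEmbedding F t)
      ((Infinite.natEmbedding F).injective.comp Fin.val_injective)
      (by
        have := hcard i'
        simp only [Fintype.card_fin]
        rwa [show i + (k - i) + 1 = k + 1 by omega]) (by
        intro y hy
        have := hUz (∑ j, y j • u j) (sum_mem fun j _ => U.smul_mem _ (bu j).2)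
          (fun l hl => hy l hl)
        exact funext fun j => Fintype.linearIndependent_iff.mp hu y this j)
    set w := v none + ∑ l, algebraMap F Om (Infinite.natEmbedding F (γ l : ℕ)) • v (some l)
    have hwU : ∀ z ∈ U, ∃ l : Fin k, (l : ℕ) < i + 1 ∧ MvPolynomial.eval (w + z) (f l) ≠ 0 := by
      intro z hz
      rw [← hus] at hz
      obtain ⟨y, rfl⟩ := (Submodule.mem_span_range_iff_exists_fun Om).mp hz
      have := hγ y
      push Not at this
      obtain ⟨l, hl, hl'⟩ := this
      refine ⟨l, ?_, hl'⟩
      rcases hl with hl | rfl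
      · exact Nat.lt_succ_of_lt hl
      · exact Nat.lt_succ_self i
    have hwn : w ∉ U := by
      intro h
      obtain ⟨l, -, hl⟩ := hwU (-w) (U.neg_mem h)
      have := hfs l 0 0
      rw [zero_smul, zero_pow (hd0 l), zero_mul] at this
      exact hl (by simpa using this)
    have hli : LinearIndependent Om (Fin.snoc u w : Fin (i + 1) → m → Om) :=
      linearIndependent_finSnoc.mpr ⟨hu, by rwa [hus]⟩
    refine ⟨Submodule.span Om (Set.range (Fin.snoc u w : Fin (i + 1) → m → Om)), ?_, ?_, ?_⟩
    · rw [Fin.range_snoc, Submodule.span_le, Set.insert_subset_iff]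
      refine ⟨?_, ?_⟩
      · exact add_mem (hQW (bv none).2)
          (sum_mem fun l _ => W.smul_mem _ (hQW (bv (some l)).2))
      · rintro _ ⟨j, rfl⟩
        exact hUW (bu j).2
    · rw [finrank_span_eq_card hli, Fintype.card_fin]
    · intro x hx hxz
      rw [Fin.range_snoc, Submodule.mem_span_insert] at hx
      obtain ⟨t, z, hz, rfl⟩ := hx
      rw [hus] at hz
      by_cases ht : t = 0
      · subst ht
        rw [zero_smul, zero_add] at hxz ⊢
        exact hUz z hz fun l hl => hxz l (by omega)
      · obtain ⟨l, hl, hl'⟩ := hwU (t⁻¹ • z) (U.smul_mem _ hz)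
        refine absurd ?_ hl'
        have h1 := hxz l hl
        rw [show t • w + z = t • (w + t⁻¹ • z) by rw [smul_add t w, smul_inv_smul₀ ht]] at h1
        have h2 := hfs l t (w + t⁻¹ • z)
        rw [show MvPolynomial.eval (t • (w + t⁻¹ • z)) (f l) = 0 from h1] at h2
        exact (mul_eq_zero.mp h2.symm).resolve_left (pow_ne_zero _ ht)

/-- Coordinate version of the existence of forms with exponents `e` and nonzero coefficients such
that the span of any `#A` independent vectors contains a `#B`-dimensional subspace on which the
forms have no nontrivial common zero. -/
def ExistsCoeffs {lam m : Type} {J : lam → Type} [Fintype m] [∀ l, Fintype (J l)]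
    (e : ∀ l, J l → m →₀ ℕ) (A B : Type) [Fintype A] [Fintype B] (K : Type) [Field K] : Prop :=
  ∃ c : (Σ l, J l) → K, (∀ p, c p ≠ 0) ∧ ∀ φ : A × m → K,
    (∃ w : A → K, (∃ a, w a ≠ 0) ∧ ∀ t, ∑ a, w a * φ (a, t) = 0) ∨
    ∃ θ : B × A → K, ∀ s : B → K,
      (∀ l, ∑ j, c ⟨l, j⟩ * ∏ t, (∑ b, s b * ∑ a, θ (b, a) * φ (a, t)) ^ e l j t = 0) →
        ∀ b, s b = 0

section

open FirstOrder FirstOrder.Language FirstOrder.Ring FirstOrder.Field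

/-- The first-order formula `p = 0`. -/
noncomputable def eqZeroFormula {α : Type} (p : FreeCommRing α) : Language.ring.Formula α :=
  (termOfFreeCommRing p).equal (termOfFreeCommRing 0)

lemma realize_eqZeroFormula {α K : Type} [Field K] [CompatibleRing K] (p : FreeCommRing α)
    (v : α → K) : (eqZeroFormula p).Realize v ↔ FreeCommRing.lift v p = 0 := by
  simp [eqZeroFormula, Formula.realize_equal]

/-- The sentence expressing `ExistsCoeffs`. -/
noncomputable def existsCoeffsSentence {lam m : Type} {J : lam → Type} [Fintype lam] [Fintype m]
    [∀ l, Fintype (J l)] (e : ∀ l, J l → m →₀ ℕ) (A B : Type) [Fintype A] [Fintype B] :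
    Language.ring.Sentence :=
  Formula.iExs (Σ l, J l) <|
    (Formula.iInf fun p => ∼(eqZeroFormula (.of (Sum.inr p)))) ⊓
    (Formula.iAlls (A × m) <|
      (Formula.iExs A <|
        (Formula.iSup fun a => ∼(eqZeroFormula (.of (Sum.inr a)))) ⊓
        (Formula.iInf fun t => eqZeroFormula
          (∑ a, .of (Sum.inr a) * .of (Sum.inl (Sum.inr (a, t)))))) ⊔
      (Formula.iExs (B × A) <| Formula.iAlls B <|
        (Formula.iInf fun l => eqZeroFormula
          (∑ j, .of (Sum.inl (Sum.inl (Sum.inl (Sum.inr ⟨l, j⟩)))) *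
            ∏ t, (∑ b, .of (Sum.inr b) * ∑ a, .of (Sum.inl (Sum.inr (b, a))) *
              .of (Sum.inl (Sum.inl (Sum.inr (a, t))))) ^ e l j t)).imp
        (Formula.iInf fun b => eqZeroFormula (.of (Sum.inr b)))))

lemma realize_existsCoeffsSentence {lam m : Type} {J : lam → Type} [Fintype lam] [Fintype m]
    [∀ l, Fintype (J l)] (e : ∀ l, J l → m →₀ ℕ) (A B : Type) [Fintype A] [Fintype B]
    (K : Type) [Field K] [CompatibleRing K] :
    K ⊨ existsCoeffsSentence e A B ↔ ExistsCoeffs e A B K := by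
  simp only [existsCoeffsSentence, ExistsCoeffs, Sentence.Realize, Formula.realize_iExs,
    Formula.realize_inf, Formula.realize_iInf, Formula.realize_not, Formula.realize_iAlls,
    Formula.realize_sup, Formula.realize_iSup, Formula.realize_imp, realize_eqZeroFormula,
    map_sum, map_mul, map_prod, map_pow, FreeCommRing.lift_of, Sum.elim_inl, Sum.elim_inr, ne_eq]

lemma existsCoeffs_iff {lam m : Type} {J : lam → Type} [Fintype lam] [Fintype m]
    [∀ l, Fintype (J l)] (e : ∀ l, J l → m →₀ ℕ) (A B : Type) [Fintype A] [Fintype B]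
    (K Om : Type) [Field K] [IsAlgClosed K] [Field Om] [IsAlgClosed Om] [Algebra K Om] :
    ExistsCoeffs e A B K ↔ ExistsCoeffs e A B Om := by
  let p := ringChar K
  have : CharP Om p := charP_of_injective_algebraMap (algebraMap K Om).injective p
  let := compatibleRingOfRing K
  let := compatibleRingOfRing Om
  rw [← realize_existsCoeffsSentence, ← realize_existsCoeffsSentence]
  have hp := ACF_isComplete (CharP.char_is_prime_or_zero K p)
  rw [hp.realize_sentence_iff, hp.realize_sentence_iff]

end

/-- Suitable coefficients exist over every algebraically closed field. -/
lemma existsCoeffs_of_card_lt {m : Type} [Fintype m] {k : ℕ} {J : Fin k → Type}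
    [∀ l, Fintype (J l)] (e : ∀ l, J l → m →₀ ℕ) (d : Fin k → ℕ)
    (he : ∀ l j, (e l j).degree = d l)
    (hsurj : ∀ l, ∀ α : m →₀ ℕ, α.degree = d l → ∃ j, e l j = α)
    (hd0 : ∀ l, d l ≠ 0) (E : Fin k → ℕ) (hd : ∀ l, d l = (k - l) * E l)
    (hcard : ∀ l : Fin k, (k + 1) * Fintype.card m < (E l + 1) ^ (k - l : ℕ))
    (K : Type) [Field K] [IsAlgClosed K] : ExistsCoeffs e (Fin (k + 1)) (Fin k) K := by
  let R := MvPolynomial (Σ l, J l) K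
  let Om := AlgebraicClosure (FractionRing R)
  rw [existsCoeffs_iff e _ _ K Om]
  have hinj : Function.Injective (algebraMap R Om) := by
    rw [IsScalarTower.algebraMap_eq R (FractionRing R) Om]
    exact (algebraMap (FractionRing R) Om).injective.comp (IsFractionRing.injective R _)
  let c : (Σ l, J l) → Om := fun p => algebraMap R Om (MvPolynomial.X p)
  have hc : AlgebraicIndependent K c :=
    (MvPolynomial.algebraicIndependent_X (Σ l, J l) K).map'
      (f := IsScalarTower.toAlgHom K R Om) hinj
  refine ⟨c, fun p => hc.ne_zero p, fun φ => ?_⟩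
  let φ' : Fin (k + 1) → m → Om := fun a t => φ (a, t)
  by_cases hφ : LinearIndependent Om φ'
  swap
  · left
    obtain ⟨w, hw, hw'⟩ := Fintype.not_linearIndependent_iff.mp hφ
    exact ⟨w, hw', fun t => by simpa [φ'] using congrFun hw t⟩
  right
  obtain ⟨U, hUW, hU, hUz⟩ := exists_le_finrank_eq_without_zero c hc e d he hsurj hd0 E hd hcard
    (Submodule.span Om (Set.range φ')) (by rw [finrank_span_eq_card hφ, Fintype.card_fin]) k le_rfl
  let b := Module.finBasisOfFinrankEq Om U hU
  have hθ : ∀ i, ∃ θ : Fin (k + 1) → Om, ∑ a, θ a • φ' a = b i := fun i =>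
    (Submodule.mem_span_range_iff_exists_fun Om).mp (hUW (b i).2)
  choose θ hθ using hθ
  have hθ' : ∀ i t, ∑ a, θ i a * φ (a, t) = (b i : m → Om) t := fun i t => by
    simpa [φ'] using congrFun (hθ i) t
  refine ⟨fun p => θ p.1 p.2, fun s hs => ?_⟩
  have hx := hUz _ (sum_mem fun i (_ : i ∈ Finset.univ) => U.smul_mem (s i) (b i).2)
    fun l _ => by
      rw [eval_polyOfCoeffs, ← hs l]
      simp [hθ']
  exact Fintype.linearIndependent_iff.mp
    (b.linearIndependent.map' U.subtype (by simp)) s hx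

/-- If homogeneous polynomials have no nontrivial common zero on a hyperplane `U` of `W`, then
their common zero locus in `W` consists of finitely many lines. -/
lemma finite_lines_of_hyperplane {K m lam : Type*} [Field K] [IsAlgClosed K] [Fintype m]
    (f : lam → MvPolynomial m K) (d : lam → ℕ) (hf : ∀ l, (f l).IsHomogeneous (d l))
    (U W : Submodule K (m → K)) (hUW : U ≤ W)
    (hW : Module.finrank K W = Module.finrank K U + 1)
    (hUz : ∀ x ∈ U, (∀ l, MvPolynomial.eval x (f l) = 0) → x = 0) :
    {L : Submodule K (m → K) | L ≤ W ∧ Module.finrank K L = 1 ∧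
      ∀ x ∈ L, ∀ l, MvPolynomial.eval x (f l) = 0}.Finite := by
  let b := Module.finBasis K U
  let u : Fin (Module.finrank K U) → m → K := fun j => b j
  have hu : LinearIndependent K u := b.linearIndependent.map' U.subtype (by simp)
  have huU : ∀ z ∈ U, ∃ y : Fin (Module.finrank K U) → K, ∑ j, y j • u j = z := fun z hz => by
    refine ⟨b.repr ⟨z, hz⟩, ?_⟩
    simpa only [Submodule.coe_sum, Submodule.coe_smul] using
      congrArg Subtype.val (b.sum_repr ⟨z, hz⟩)
  obtain ⟨v, hvW, hvU⟩ : ∃ v ∈ W, v ∉ U := by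
    by_contra! h
    have := Submodule.finrank_mono h
    omega
  have hWv : W = Submodule.span K {v} ⊔ U := by
    symm
    refine Submodule.eq_of_le_of_finrank_le
      (sup_le (by simpa using hvW) hUW) ?_
    rw [hW, Nat.succ_le_iff]
    refine Submodule.finrank_lt_finrank_of_lt (lt_of_le_of_ne le_sup_right fun h => hvU ?_)
    rw [h]
    exact Submodule.mem_sup_left (Submodule.mem_span_singleton_self v)
  let Y : Set (Fin (Module.finrank K U) → K) :=
    {y | ∀ l, MvPolynomial.eval (v + ∑ j, y j • u j) (f l) = 0}
  have hY : Y.Finite := by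
    have hint : ∀ j, IsIntegral K (fun y : Y => y.1 j) := by
      intro j
      refine isIntegral_coord_of_zero (K := K) f d hf v u (fun y hy => ?_)
        (fun j (y : Y) => y.1 j) (fun l => ?_) j
      · have := hUz (∑ j, y j • u j) (sum_mem fun j _ => U.smul_mem _ (b j).2) fun l => by
          rw [← hy l, ← MvPolynomial.aeval_eq_eval]
          congr 1
          ext t
          simp
        exact funext fun j => Fintype.linearIndependent_iff.mp hu y this j
      · funext y
        have h1 := y.2 l
        change Pi.evalAlgHom K (fun _ : Y => K) y (MvPolynomial.aeval _ (f l)) = 0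
        rw [MvPolynomial.comp_aeval_apply, ← h1, ← MvPolynomial.aeval_eq_eval]
        congr 2
        ext t
        simp
    choose P hP hPr using hint
    refine (Set.Finite.pi' fun j => (P j).rootSet_finite K).subset fun y hy j => ?_
    rw [Polynomial.mem_rootSet]
    refine ⟨(hP j).ne_zero, ?_⟩
    have := congrFun (hPr j) ⟨y, hy⟩
    rw [← Polynomial.aeval_def] at this
    have h2 := Polynomial.aeval_algHom_apply (Pi.evalAlgHom K (fun _ : Y => K) ⟨y, hy⟩)
      (fun y : Y => y.1 j) (P j)
    exact h2.trans this
  refine (hY.image fun y => Submodule.span K {v + ∑ j, y j • u j}).subset ?_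
  rintro L ⟨hLW, hL, hLz⟩
  obtain ⟨⟨x, hxL⟩, hx0, -⟩ := finrank_eq_one_iff'.mp hL
  have hx0 : x ≠ 0 := fun h => hx0 (Subtype.ext h)
  have hx := hLW hxL
  rw [hWv, Submodule.mem_sup] at hx
  obtain ⟨w, hw, z, hz, hwz⟩ := hx
  obtain ⟨t, rfl⟩ := Submodule.mem_span_singleton.mp hw
  have ht : t ≠ 0 := by
    rintro rfl
    rw [zero_smul, zero_add] at hwz
    subst hwz
    exact hx0 (hUz z hz (hLz z hxL))
  obtain ⟨y, hy⟩ := huU _ (U.smul_mem t⁻¹ hz)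
  have hvy : v + ∑ j, y j • u j = t⁻¹ • x := by
    rw [hy, ← hwz, smul_add, inv_smul_smul₀ ht]
  have hmem : v + ∑ j, y j • u j ∈ L := hvy ▸ L.smul_mem _ hxL
  refine ⟨y, fun l => hLz _ hmem l, ?_⟩
  refine Submodule.eq_of_le_of_finrank_le (by simpa using hmem) ?_
  rw [hL, finrank_span_singleton]
  rw [hvy]
  exact smul_ne_zero (inv_ne_zero ht) hx0

lemma coeff_polyOfCoeffs {m R J : Type*} [CommSemiring R] [Fintype J]
    (e : J → m →₀ ℕ) (he : Function.Injective e) (c : J → R) (j : J) :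
    (polyOfCoeffs e c).coeff (e j) = c j := by
  classical
  simp [polyOfCoeffs, MvPolynomial.coeff_sum, MvPolynomial.coeff_monomial, he.eq_iff]

/-- The degree bound of a single form. -/
lemma exists_lt_add_one_pow (k n s : ℕ) (hn : 1 ≤ n) (hs : 1 ≤ s) (hsk : s ≤ k) :
    ∃ E : ℕ, E ≠ 0 ∧ (k + 1) * (n + 1) < (E + 1) ^ s ∧
      ((s * E : ℕ) : ℝ) ≤ (4 * k * (k + 1)) * (n : ℝ) ^ ((1 : ℝ) / s) := by
  have hs0 : (0 : ℝ) < s := by exact_mod_cast hs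
  have hs1 : (1 : ℝ) ≤ s := by exact_mod_cast hs
  have hn1 : (1 : ℝ) ≤ n := by exact_mod_cast hn
  have hk0 : (0 : ℝ) ≤ k := Nat.cast_nonneg k
  have hsk' : (s : ℝ) ≤ k := by exact_mod_cast hsk
  set N : ℝ := (k + 1) * (n + 1)
  have hN1 : 1 ≤ N := by nlinarith
  have hN2 : N ≤ (2 * (k + 1)) * n := by nlinarith
  have hr1 : 1 ≤ N ^ ((1 : ℝ) / s) := Real.one_le_rpow hN1 (by positivity)
  have hr2 : N ^ ((1 : ℝ) / s) ≤ (2 * (k + 1)) * (n : ℝ) ^ ((1 : ℝ) / s) := by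
    calc N ^ ((1 : ℝ) / s) ≤ ((2 * (k + 1)) * n) ^ ((1 : ℝ) / s) :=
          Real.rpow_le_rpow (by positivity) hN2 (by positivity)
      _ = (2 * (k + 1) : ℝ) ^ ((1 : ℝ) / s) * (n : ℝ) ^ ((1 : ℝ) / s) :=
          Real.mul_rpow (by positivity) (by positivity)
      _ ≤ (2 * (k + 1) : ℝ) ^ (1 : ℝ) * (n : ℝ) ^ ((1 : ℝ) / s) := by
          gcongr
          · linarith
          · exact (div_le_one hs0).mpr hs1
      _ = _ := by rw [Real.rpow_one]
  refine ⟨⌈N ^ ((1 : ℝ) / s)⌉₊, ?_, ?_, ?_⟩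
  · exact (Nat.ceil_pos.mpr (by linarith)).ne'
  · have h1 : N ^ ((1 : ℝ) / s) < (⌈N ^ ((1 : ℝ) / s)⌉₊ : ℝ) + 1 :=
      lt_of_le_of_lt (Nat.le_ceil _) (lt_add_one _)
    have h2 := pow_lt_pow_left₀ h1 (by positivity) (by omega : s ≠ 0)
    rw [← Real.rpow_natCast, ← Real.rpow_mul (by positivity), one_div_mul_cancel hs0.ne',
      Real.rpow_one] at h2
    refine (Nat.cast_lt (α := ℝ)).mp ?_
    push_cast
    exact h2
  · have h1 := (Nat.ceil_lt_add_one (by positivity : 0 ≤ N ^ ((1 : ℝ) / s))).le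
    push_cast
    calc (s : ℝ) * ⌈N ^ ((1 : ℝ) / s)⌉₊ ≤ k * (2 * ((2 * (k + 1)) * (n : ℝ) ^ ((1 : ℝ) / s))) := by
          gcongr
          linarith
      _ = _ := by ring

lemma sum_one_div_sub (k : ℕ) : ∑ i : Fin k, (1 : ℝ) / ((k - i : ℕ) : ℝ) =
    ∑ i ∈ Finset.range k, (1 : ℝ) / (i + 1) := by
  rw [Fin.sum_univ_eq_sum_range fun i => (1 : ℝ) / ((k - i : ℕ) : ℝ), ← Finset.sum_range_reflect]
  refine Finset.sum_congr rfl fun i hi => ?_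
  have hi := Finset.mem_range.mp hi
  rw [show k - (k - 1 - i) = i + 1 by omega]
  push_cast
  rfl

/-- For all positive integers `k ≤ n` and every algebraically closed field
`F`, there exist nonzero homogeneous polynomials `f 0, …, f (k-1)` in `n + 1` variables, of
positive degrees `d 0, …, d (k-1)` with `d 0 ⬝ ⋯ ⬝ d (k-1) ≤ c · n^(H_k)` (where `c > 0`
depends only on `k` and `H_k = 1 + 1/2 + ⋯ + 1/k`), such that their common projective zero
locus meets every `k`-plane of `ℙ^n(F)` in a finite set: for every `(k+1)`-dimensional linear
subspace `W` of `F^(n+1)`, only finitely many lines through the origin inside `W` are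
contained in the common vanishing set of the `f i`. -/
theorem statement1 (k : ℕ) (hk : 1 ≤ k) :
    ∃ c : ℝ, 0 < c ∧
      ∀ n : ℕ, k ≤ n →
        ∀ (F : Type) [Field F] [IsAlgClosed F],
          ∃ (f : Fin k → MvPolynomial (Fin (n + 1)) F) (d : Fin k → ℕ),
            (∀ i, f i ≠ 0) ∧
            (∀ i, 1 ≤ d i) ∧
            (∀ i, (f i).IsHomogeneous (d i)) ∧
            ((∏ i, (d i : ℝ)) ≤ c * (n : ℝ) ^ (∑ i ∈ Finset.range k, (1 : ℝ) / (i + 1))) ∧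
            (∀ W : Submodule F (Fin (n + 1) → F), Module.finrank F W = k + 1 →
              {L : Submodule F (Fin (n + 1) → F) |
                L ≤ W ∧ Module.finrank F L = 1 ∧
                  ∀ x ∈ L, ∀ i, MvPolynomial.eval x (f i) = 0}.Finite) := by
  refine ⟨(4 * k * (k + 1)) ^ k, by positivity, fun n hkn F _ _ => ?_⟩
  have hn : 1 ≤ n := hk.trans hkn
  have hE := fun i : Fin k =>
    exists_lt_add_one_pow k n (k - i) hn (by have := i.2; omega) (Nat.sub_le _ _)
  choose E hE0 hE1 hE2 using hE
  let d : Fin k → ℕ := fun i => (k - i) * E i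
  have hd0 : ∀ i, d i ≠ 0 := fun i => mul_ne_zero (by have := i.2; omega) (hE0 i)
  let J : Fin k → Type := fun i => (Finset.univ : Finset (Fin (n + 1))).finsuppAntidiag (d i)
  have : ∀ i, Fintype (J i) := fun i => Finset.fintypeCoeSort _
  let e : ∀ i, J i → Fin (n + 1) →₀ ℕ := fun i j => j.1
  have hmem : ∀ (i) (α : Fin (n + 1) →₀ ℕ),
      α ∈ Finset.univ.finsuppAntidiag (d i) ↔ α.degree = d i := fun i α => by
    rw [Finset.mem_finsuppAntidiag, Finsupp.degree_eq_sum]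
    simp
  have he : ∀ i (j : J i), (e i j).degree = d i := fun i j => (hmem i _).mp j.2
  have hsurj : ∀ i, ∀ α : Fin (n + 1) →₀ ℕ, α.degree = d i → ∃ j, e i j = α :=
    fun i α hα => ⟨⟨α, (hmem i α).mpr hα⟩, rfl⟩
  obtain ⟨c, hc0, hc⟩ := existsCoeffs_of_card_lt e d he hsurj hd0 E (fun _ => rfl)
    (fun i => by simpa using hE1 i) F
  have hhom : ∀ i, (polyOfCoeffs (e i) fun j => c ⟨i, j⟩).IsHomogeneous (d i) := fun i =>
    isHomogeneous_polyOfCoeffs _ _ (he i)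
  refine ⟨fun i => polyOfCoeffs (e i) fun j => c ⟨i, j⟩, d, fun i hi => ?_,
    fun i => Nat.one_le_iff_ne_zero.mpr (hd0 i), hhom, ?_, fun W hW => ?_⟩
  · obtain ⟨j, -⟩ := hsurj i (Finsupp.single 0 (d i)) (by simp)
    have := coeff_polyOfCoeffs (e i) Subtype.val_injective (fun j => c ⟨i, j⟩) j
    rw [show polyOfCoeffs (e i) (fun j => c ⟨i, j⟩) = 0 from hi, MvPolynomial.coeff_zero] at this
    exact hc0 _ this.symm
  · calc ∏ i, (d i : ℝ)
        ≤ ∏ i : Fin k, (4 * k * (k + 1) : ℝ) * (n : ℝ) ^ ((1 : ℝ) / ((k - i : ℕ) : ℝ)) :=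
          Finset.prod_le_prod (fun i _ => Nat.cast_nonneg _) fun i _ => hE2 i
      _ = _ := by
          rw [Finset.prod_mul_distrib, Finset.prod_const, Finset.card_univ, Fintype.card_fin,
            ← sum_one_div_sub, Real.rpow_sum_of_pos (by exact_mod_cast hn)]
  · let b := Module.finBasisOfFinrankEq F W hW
    have hb : LinearIndependent F fun a => (b a : Fin (n + 1) → F) :=
      b.linearIndependent.map' W.subtype (by simp)
    obtain ⟨w, ⟨a, ha⟩, hw⟩ | ⟨θ, hθ⟩ := hc fun p => (b p.1 : Fin (n + 1) → F) p.2
    · refine absurd (Fintype.linearIndependent_iff.mp hb w ?_ a) ha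
      ext t
      simpa using hw t
    let u : Fin k → Fin (n + 1) → F := fun i => ∑ a, θ (i, a) • (b a : Fin (n + 1) → F)
    have hueval : ∀ s : Fin k → F, (∀ l, MvPolynomial.eval (∑ i, s i • u i)
        (polyOfCoeffs (e l) fun j => c ⟨l, j⟩) = 0) → ∀ i, s i = 0 := by
      intro s hs
      refine hθ s fun l => ?_
      rw [← hs l, eval_polyOfCoeffs]
      simp [u]
    have hu : LinearIndependent F u := by
      refine Fintype.linearIndependent_iff.mpr fun s hs => hueval s fun l => ?_
      rw [hs, MvPolynomial.eval_zero, MvPolynomial.constantCoeff_eq]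
      exact (hhom l).coeff_eq_zero (by simpa using (hd0 l).symm)
    refine finite_lines_of_hyperplane _ d hhom (Submodule.span F (Set.range u)) W ?_ ?_ ?_
    · refine Submodule.span_le.mpr ?_
      rintro _ ⟨i, rfl⟩
      exact sum_mem fun a _ => W.smul_mem _ (b a).2
    · rw [hW, finrank_span_eq_card hu, Fintype.card_fin]
    · intro x hx hxz
      obtain ⟨s, rfl⟩ := (Submodule.mem_span_range_iff_exists_fun F).mp hx
      have := hueval s hxz
      simp [this]
end

section
/- For every integer k ≥ 1 there exist c_k > 0 and n_0 such that the following holds for all integers n ≥ n_0 and every algebraically closed field F: if f_1, …, f_k ∈ F[x_0, …, x_n] are nonconstant homogeneous polynomials such that the projective zero locus Z(f_1,…,f_k) ⊆ P^n(F) meets every k-plane of P^n(F) in a finite set, then (deg f_1)·(deg f_2)⋯(deg f_k) ≥ c_k · n^{H_k}. (This is the tightness of the degree bound for 1-twisted complete intersections, whose degree equals the product of the degrees of their defining polynomials.) -/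
open MvPolynomial in
/-- Every maximal ideal of a polynomial ring in `n` variables over a field has height `n`. -/
lemma MvPolynomial.height_eq_of_isMaximal {F : Type*} [Field F] (n : ℕ)
    (P : Ideal (MvPolynomial (Fin n) F)) [hP : P.IsMaximal] : P.height = n := by
  induction n with
  | zero =>
    let e := (MvPolynomial.isEmptyAlgEquiv F (Fin 0)).toRingEquiv
    have : (P.comap e.symm).IsMaximal := Ideal.comap_isMaximal_of_equiv e.symm
    rw [← e.symm.height_comap P, Ideal.eq_bot_of_prime (P.comap e.symm), Ideal.height_bot]
    simp
  | succ n ih =>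
    let e := (finSuccEquiv F n).toRingEquiv
    have : (P.comap e.symm).IsMaximal := Ideal.comap_isMaximal_of_equiv e.symm
    have := Polynomial.isMaximal_comap_C_of_isJacobsonRing (P.comap e.symm)
    have : (P.comap e.symm).LiesOver ((P.comap e.symm).comap Polynomial.C) := ⟨rfl⟩
    rw [← e.symm.height_comap P, Polynomial.height_eq_height_add_one
      ((P.comap e.symm).comap Polynomial.C) (P.comap e.symm), ih]
    simp

open MvPolynomial in
/-- Fewer than `N` polynomials in `N` variables that vanish at the origin have another common
zero. -/
lemma MvPolynomial.exists_ne_zero_forall_eval_eq_zero {F : Type*} [Field F] [IsAlgClosed F] {N : ℕ}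
    {ι : Type*} [Fintype ι] (q : ι → MvPolynomial (Fin N) F) (hq : ∀ i, eval 0 (q i) = 0)
    (hN : Fintype.card ι < N) : ∃ x : Fin N → F, x ≠ 0 ∧ ∀ i, eval x (q i) = 0 := by
  by_contra! hcon
  set I : Ideal (MvPolynomial (Fin N) F) := Ideal.span (Set.range q) with hI
  have hzero : zeroLocus F I = {0} := by
    rw [hI, zeroLocus_span]
    ext x
    simp only [Set.mem_range, forall_exists_index, forall_apply_eq_imp_iff, Set.mem_ofPred_eq,
      Set.mem_singleton_iff, aeval_eq_eval]
    constructor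
    · intro h
      by_contra hx
      obtain ⟨i, hi⟩ := hcon x hx
      exact hi (h i)
    · rintro rfl
      exact hq
  have hrad : I.radical = vanishingIdeal F {(0 : Fin N → F)} := by
    rw [← vanishingIdeal_zeroLocus_eq_radical (K := F), hzero]
  have hmax : I.radical.IsMaximal := by
    rw [hrad]
    infer_instance
  have hmin : I.radical ∈ I.minimalPrimes := by
    refine ⟨⟨hmax.isPrime, Ideal.le_radical⟩, fun J hJ _ => ?_⟩
    exact (hJ.1.radical_le_iff).2 hJ.2
  have h1 := Ideal.height_le_card_of_mem_minimalPrimes_span (Set.finite_range q) hmin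
  rw [MvPolynomial.height_eq_of_isMaximal N I.radical] at h1
  have h2 : (Set.range q).ncard ≤ Fintype.card ι := by
    rw [← Set.image_univ, ← Nat.card_eq_fintype_card, ← Set.ncard_univ]
    exact Set.ncard_image_le
  have h3 : N ≤ (Set.range q).ncard := by exact_mod_cast h1
  omega

open MvPolynomial in
lemma MvPolynomial.totalDegree_aeval_le_of_forall_le_one {R σ τ : Type*} [CommSemiring R]
    (g : σ → MvPolynomial τ R) (hg : ∀ i, (g i).totalDegree ≤ 1) (p : MvPolynomial σ R) :
    (aeval g p).totalDegree ≤ p.totalDegree := by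
  rw [aeval_def, eval₂_eq]
  refine totalDegree_finsetSum_le fun e he => ?_
  refine (totalDegree_mul _ _).trans ?_
  rw [algebraMap_eq, totalDegree_C, zero_add]
  refine (totalDegree_finsetProd _ _).trans ?_
  refine le_trans (Finset.sum_le_sum fun i _ => (totalDegree_pow _ _).trans
    (Nat.mul_le_mul_left _ (hg i))) ?_
  simpa [Finsupp.sum] using le_totalDegree he

open MvPolynomial in
/-- The pullback of a polynomial along the affine map `s ↦ v + ∑ a, s a • p a`. -/
noncomputable def MvPolynomial.affinePullback_s2 {F : Type*} [Field F] {N r : ℕ} (v : Fin N → F)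
    (p : Fin r → Fin N → F) (g : MvPolynomial (Fin N) F) : MvPolynomial (Fin r) F :=
  aeval (fun i => C (v i) + ∑ a, C (p a i) * X a) g

open MvPolynomial in
lemma MvPolynomial.eval_affinePullback_s2 {F : Type*} [Field F] {N r : ℕ} (v : Fin N → F)
    (p : Fin r → Fin N → F) (g : MvPolynomial (Fin N) F) (s : Fin r → F) :
    eval s (affinePullback_s2 v p g) = eval (v + ∑ a, s a • p a) g := by
  rw [affinePullback_s2, ← aeval_eq_eval, ← aeval_eq_eval, ← AlgHom.comp_apply, comp_aeval]
  congr 2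
  ext i
  simp [mul_comm]

open MvPolynomial in
lemma MvPolynomial.totalDegree_affinePullback_le_s2 {F : Type*} [Field F] {N r : ℕ} (v : Fin N → F)
    (p : Fin r → Fin N → F) (g : MvPolynomial (Fin N) F) :
    (affinePullback_s2 v p g).totalDegree ≤ g.totalDegree := by
  refine totalDegree_aeval_le_of_forall_le_one _ (fun i => ?_) g
  refine (totalDegree_add _ _).trans (max_le (by simp) (totalDegree_finsetSum_le fun a _ => ?_))
  refine (totalDegree_mul _ _).trans ?_
  simp

open MvPolynomial in
lemma MvPolynomial.IsHomogeneous.eval_smul_eq_pow_mul {F σ : Type*} [Field F] {g : MvPolynomial σ F} {d : ℕ}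
    (hg : g.IsHomogeneous d) (c : F) (x : σ → F) : eval (c • x) g = c ^ d * eval x g := by
  rw [eval_eq, eval_eq, Finset.mul_sum]
  refine Finset.sum_congr rfl fun e he => ?_
  have h : ∑ i ∈ e.support, e i = d := by
    have := hg (mem_support_iff.1 he)
    simpa [Finsupp.weight_apply, Finsupp.sum] using this
  simp only [Pi.smul_apply, smul_eq_mul, mul_pow, Finset.prod_mul_distrib,
    Finset.prod_pow_eq_pow_sum, h]
  ring

open MvPolynomial in
lemma MvPolynomial.IsHomogeneous.eval_zero_eq_zero {F σ : Type*} [Field F] {g : MvPolynomial σ F}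
    {d : ℕ} (hg : g.IsHomogeneous d) (hd : 1 ≤ d) : eval 0 g = 0 := by
  have h := hg.eval_smul_eq_pow_mul 0 0
  rwa [zero_pow (by omega), zero_mul, zero_smul] at h

open MvPolynomial in
/-- A linear subspace of the common zero cone of homogeneous polynomials can be enlarged
if the number of variables is large. -/
lemma MvPolynomial.exists_finCons_linearIndependent {F : Type*} [Field F] [IsAlgClosed F]
    {N r D : ℕ} {ι : Type*} [Fintype ι] (f : ι → MvPolynomial (Fin N) F) (d : ι → ℕ)
    (hf : ∀ i, (f i).IsHomogeneous (d i)) (hD : ∀ i, d i ≤ D)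
    (p : Fin r → Fin N → F) (hp : LinearIndependent F p)
    (hz : ∀ i (s : Fin r → F), eval (∑ a, s a • p a) (f i) = 0)
    (hN : r + Fintype.card ι * (D + 1) ^ r < N) :
    ∃ v : Fin N → F, LinearIndependent F (Fin.cons v p : Fin (r + 1) → Fin N → F) ∧
      ∀ i (s : Fin (r + 1) → F),
        eval (∑ a, s a • (Fin.cons v p : Fin (r + 1) → Fin N → F) a) (f i) = 0 := by
  classical
  obtain ⟨φ, hφ⟩ := LinearMap.exists_leftInverse_of_injective (Fintype.linearCombination F p)
    (LinearMap.ker_eq_bot.2 hp.fintypeLinearCombination_injective)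
  obtain ⟨S, hS⟩ := Infinite.exists_subset_card_eq F (D + 1)
  let q : Fin r ⊕ (ι × (Fin r → S)) → MvPolynomial (Fin N) F :=
    Sum.elim (fun a => (LinearMap.toMatrix' φ).toMvPolynomial a)
      (fun u => affinePullback_s2 (∑ a, (u.2 a : F) • p a) (fun i => Pi.single i 1) (f u.1))
  have hsum (x : Fin N → F) : ∑ i, x i • (Pi.single i 1 : Fin N → F) = x :=
    (pi_eq_sum_univ' x).symm
  obtain ⟨v, hv0, hv⟩ := exists_ne_zero_forall_eval_eq_zero q
    (by
      rintro (a | u)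
      · simp [q]
      · simp only [q, Sum.elim_inr, eval_affinePullback_s2, hsum, add_zero]
        exact hz u.1 fun a => u.2 a)
    (by simpa [hS] using hN)
  have hφv : φ v = 0 := by
    ext a
    simpa [q, Matrix.toMvPolynomial_eval_eq_apply] using hv (Sum.inl a)
  have hgrid (i : ι) : affinePullback_s2 v p (f i) = 0 := by
    refine eq_zero_of_eval_zero_at_prod_finset _ (fun _ => S) (fun a => ?_) fun s hs => ?_
    · rw [hS, Nat.lt_succ_iff]
      exact (degreeOf_le_totalDegree _ _).trans ((totalDegree_affinePullback_le_s2 _ _ _).trans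
        ((hf i).totalDegree_le.trans (hD i)))
    · have := hv (Sum.inr (i, fun a => ⟨s a, hs a⟩))
      simp only [q, Sum.elim_inr, eval_affinePullback_s2, hsum] at this
      rw [eval_affinePullback_s2, add_comm]
      exact this
  refine ⟨v, linearIndependent_finCons.2 ⟨hp, fun hmem => hv0 ?_⟩, fun i s => ?_⟩
  · obtain ⟨c, rfl⟩ := (Submodule.mem_span_range_iff_exists_fun F).1 hmem
    have h := LinearMap.congr_fun hφ c
    rw [LinearMap.comp_apply, Fintype.linearCombination_apply, hφv] at h
    simp [← show (0 : Fin r → F) = c from h]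
  · rw [Fin.sum_univ_succ]
    simp only [Fin.cons_zero, Fin.cons_succ]
    by_cases h0 : s 0 = 0
    · rw [h0, zero_smul, zero_add]
      exact hz i _
    · have h1 : s 0 • v + ∑ a : Fin r, s a.succ • p a
          = s 0 • (v + ∑ a : Fin r, ((s 0)⁻¹ * s a.succ) • p a) := by
        rw [smul_add, Finset.smul_sum]
        congr 1
        refine Finset.sum_congr rfl fun a _ => ?_
        rw [smul_smul, mul_inv_cancel_left₀ h0]
      rw [h1, (hf i).eval_smul_eq_pow_mul, ← eval_affinePullback_s2 v p, hgrid]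
      simp

open MvPolynomial in
/-- Homogeneous polynomials of positive degree at most `D` in sufficiently many variables
vanish on an `m`-plane. -/
lemma MvPolynomial.exists_linearIndependent_forall_eval_eq_zero {F : Type*} [Field F]
    [IsAlgClosed F] {N m D : ℕ} {ι : Type*} [Fintype ι] (f : ι → MvPolynomial (Fin N) F)
    (d : ι → ℕ) (hf : ∀ i, (f i).IsHomogeneous (d i)) (hd : ∀ i, 1 ≤ d i) (hD : ∀ i, d i ≤ D)
    (hN : m + Fintype.card ι * (D + 1) ^ m < N) {r : ℕ} (hr : r ≤ m + 1) :
    ∃ p : Fin r → Fin N → F, LinearIndependent F p ∧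
      ∀ i (s : Fin r → F), eval (∑ a, s a • p a) (f i) = 0 := by
  induction r with
  | zero =>
    refine ⟨Fin.elim0, linearIndependent_empty_type, fun i s => ?_⟩
    simpa using (hf i).eval_zero_eq_zero (hd i)
  | succ r ih =>
    obtain ⟨p, hp, hz⟩ := ih (by omega)
    have hpow : (D + 1) ^ r ≤ (D + 1) ^ m := Nat.pow_le_pow_right (by omega) (by omega)
    have hmul := Nat.mul_le_mul_left (Fintype.card ι) hpow
    obtain ⟨v, hv⟩ := exists_finCons_linearIndependent f d hf hD p hp hz (by omega)
    exact ⟨_, hv⟩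

lemma Submodule.exists_le_finrank_eq {F V : Type*} [Field F] [AddCommGroup V] [Module F V]
    [FiniteDimensional F V] (U : Submodule F V) {r : ℕ} (h1 : Module.finrank F U ≤ r)
    (h2 : r ≤ Module.finrank F V) : ∃ W : Submodule F V, U ≤ W ∧ Module.finrank F W = r := by
  induction r, h1 using Nat.le_induction with
  | base => exact ⟨U, le_rfl, rfl⟩
  | succ r _ ih =>
    obtain ⟨W, hUW, hW⟩ := ih (by omega)
    have hne : W ≠ ⊤ := by
      rintro rfl
      rw [finrank_top] at hW
      omega
    obtain ⟨v, -, hv⟩ := SetLike.exists_of_lt hne.lt_top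
    have hv0 : v ≠ 0 := fun h => hv (h ▸ W.zero_mem)
    refine ⟨W ⊔ Submodule.span F {v}, hUW.trans le_sup_left, ?_⟩
    have hdisj : W ⊓ Submodule.span F {v} = ⊥ :=
      disjoint_iff.1 ((Submodule.disjoint_span_singleton' hv0).2 hv)
    have h := Submodule.finrank_sup_add_finrank_inf_eq W (Submodule.span F {v})
    rw [hdisj, finrank_bot, finrank_span_singleton hv0, hW] at h
    simpa using h

open MvPolynomial in
/-- If the forms `f i` with `i ∈ A` vanish on an `r`-dimensional linear subspace and there are fewer
than `r - 1` other forms, then infinitely many lines of the subspace lie in the common zero cone. -/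
lemma MvPolynomial.infinite_lines_of_forall_eval_eq_zero {F : Type*} [Field F] [IsAlgClosed F]
    {N r : ℕ} {ι : Type*} [Fintype ι] [DecidableEq ι] (f : ι → MvPolynomial (Fin N) F) (d : ι → ℕ)
    (hf : ∀ i, (f i).IsHomogeneous (d i)) (hd : ∀ i, 1 ≤ d i) (A : Finset ι)
    (p : Fin r → Fin N → F) (hp : LinearIndependent F p)
    (hz : ∀ i ∈ A, ∀ s : Fin r → F, eval (∑ a, s a • p a) (f i) = 0)
    (hr : Aᶜ.card + 1 < r) :
    {L : Submodule F (Fin N → F) | L ≤ Submodule.span F (Set.range p) ∧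
      Module.finrank F L = 1 ∧ ∀ x ∈ L, ∀ i, eval x (f i) = 0}.Infinite := by
  intro hfin
  have := hfin.to_subtype
  have hgen (L : {L : Submodule F (Fin N → F) | L ≤ Submodule.span F (Set.range p) ∧
      Module.finrank F L = 1 ∧ ∀ x ∈ L, ∀ i, eval x (f i) = 0}) : ∃ v ∈ L.1, v ≠ 0 := by
    refine Submodule.exists_mem_ne_zero_of_ne_bot fun h => ?_
    have := L.2.2.1
    rw [h, finrank_bot] at this
    omega
  choose v hvL hv0 using hgen
  obtain ⟨ψ, hψ⟩ := Module.exists_dual_forall_apply_ne_zero (K := F) v hv0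
  let q : Option {i // i ∈ Aᶜ} → MvPolynomial (Fin r) F := fun o =>
    o.elim (∑ a, C (ψ (p a)) * X a) fun i => affinePullback_s2 0 p (f i)
  obtain ⟨s, hs0, hs⟩ := exists_ne_zero_forall_eval_eq_zero q
    (by
      rintro (_ | i)
      · simp [q]
      · simp only [q, Option.elim_some, eval_affinePullback_s2]
        simpa using (hf i).eval_zero_eq_zero (hd i))
    (by simpa only [Fintype.card_option, Fintype.card_coe] using hr)
  set x := ∑ a, s a • p a with hx
  have hx0 : x ≠ 0 := fun h => hs0 (_root_.funext (Fintype.linearIndependent_iff.1 hp s h))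
  have hψx : ψ x = 0 := by
    have := hs none
    simpa [q, hx, mul_comm] using this
  have hfx (i : ι) : eval x (f i) = 0 := by
    by_cases hi : i ∈ A
    · exact hz i hi s
    · have := hs (some ⟨i, Finset.mem_compl.2 hi⟩)
      simpa [q, eval_affinePullback_s2] using this
  let L : {L : Submodule F (Fin N → F) | L ≤ Submodule.span F (Set.range p) ∧
      Module.finrank F L = 1 ∧ ∀ x ∈ L, ∀ i, eval x (f i) = 0} :=
    ⟨Submodule.span F {x}, by
      rw [Submodule.span_singleton_le_iff_mem]
      exact (Submodule.mem_span_range_iff_exists_fun F).2 ⟨s, rfl⟩,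
      finrank_span_singleton hx0, fun y hy i => by
        obtain ⟨c, rfl⟩ := Submodule.mem_span_singleton.1 hy
        rw [(hf i).eval_smul_eq_pow_mul, hfx, mul_zero]⟩
  obtain ⟨c, hc⟩ := Submodule.mem_span_singleton.1 (hvL L)
  refine hψ L ?_
  rw [← hc, map_smul, hψx, smul_zero]

open MvPolynomial in
/-- If the common zero locus of `k` forms meets every `k`-plane in a finite set, then
a subset of the forms of degree at most `D` cannot be too small compared to `n`. -/
lemma MvPolynomial.succ_le_of_finite_lines {F : Type*} [Field F] [IsAlgClosed F] {n k D m : ℕ}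
    (hkn : k ≤ n) (f : Fin k → MvPolynomial (Fin (n + 1)) F) (d : Fin k → ℕ)
    (hf : ∀ i, (f i).IsHomogeneous (d i)) (hd : ∀ i, 1 ≤ d i)
    (hfin : ∀ W : Submodule F (Fin (n + 1) → F), Module.finrank F W = k + 1 →
      {L : Submodule F (Fin (n + 1) → F) | L ≤ W ∧ Module.finrank F L = 1 ∧
        ∀ x ∈ L, ∀ i, eval x (f i) = 0}.Finite)
    (A : Finset (Fin k)) (hA : A.card + m = k + 1) (hm : m ≤ k) (hD : ∀ i ∈ A, d i ≤ D) :
    n + 1 ≤ m + A.card * (D + 1) ^ m := by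
  by_contra! hlt
  obtain ⟨p, hp, hz⟩ := exists_linearIndependent_forall_eval_eq_zero (m := m) (D := D)
    (fun i : A => f i) (fun i => d i) (fun i => hf i) (fun i => hd i) (fun i => hD i i.2)
    (by simpa using hlt) le_rfl
  have hrank := finrank_span_eq_card hp
  rw [Fintype.card_fin] at hrank
  obtain ⟨W, hpW, hW⟩ := Submodule.exists_le_finrank_eq (Submodule.span F (Set.range p))
    (r := k + 1) (by omega) (by simpa using hkn)
  refine infinite_lines_of_forall_eval_eq_zero f d hf hd A p hp (fun i hi => hz ⟨i, hi⟩) ?_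
    ((hfin W hW).subset fun L hL => ⟨hL.1.trans hpW, hL.2⟩)
  have hAk := A.card_le_univ
  rw [Fintype.card_fin] at hAk
  rw [Finset.card_compl, Fintype.card_fin]
  omega

open MvPolynomial in
/-- Lower bound for the `j`-th smallest degree among `k` forms whose common zero locus meets every
`k`-plane in a finite set. -/
lemma MvPolynomial.le_mul_pow_of_finite_lines {F : Type*} [Field F] [IsAlgClosed F]
    {n k : ℕ} (hkn : k ≤ n) (f : Fin k → MvPolynomial (Fin (n + 1)) F) (d : Fin k → ℕ)
    (hf : ∀ i, (f i).IsHomogeneous (d i)) (hd : ∀ i, 1 ≤ d i)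
    (hfin : ∀ W : Submodule F (Fin (n + 1) → F), Module.finrank F W = k + 1 →
      {L : Submodule F (Fin (n + 1) → F) | L ≤ W ∧ Module.finrank F L = 1 ∧
        ∀ x ∈ L, ∀ i, eval x (f i) = 0}.Finite) (j : Fin k) :
    n ≤ k * (1 + 2 ^ k) * d (Tuple.sort d j) ^ (k - (j : ℕ)) := by
  set D := d (Tuple.sort d j) with hDdef
  set m := k - (j : ℕ) with hm
  have hcard : ((Finset.Iic j).map (Tuple.sort d).toEmbedding).card = j + 1 := by simp
  have h := succ_le_of_finite_lines hkn f d hf hd hfin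
    ((Finset.Iic j).map (Tuple.sort d).toEmbedding) (D := D) (m := m)
    (by rw [hcard]; omega) (by omega) (by
      intro i hi
      obtain ⟨l, hl, rfl⟩ := Finset.mem_map.1 hi
      exact Tuple.monotone_sort d (Finset.mem_Iic.1 hl))
  rw [hcard] at h
  have hD1 : 1 ≤ D := hd _
  have hpow1 : 1 ≤ D ^ m := Nat.one_le_pow _ _ hD1
  have hmk : m ≤ k := by omega
  have hpow2 : (D + 1) ^ m ≤ 2 ^ k * D ^ m :=
    calc (D + 1) ^ m ≤ (2 * D) ^ m := Nat.pow_le_pow_left (by omega) _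
      _ = 2 ^ m * D ^ m := mul_pow _ _ _
      _ ≤ 2 ^ k * D ^ m := Nat.mul_le_mul_right _ (Nat.pow_le_pow_right (by omega) hmk)
  calc n ≤ m + (j + 1) * (D + 1) ^ m := by omega
    _ ≤ k * D ^ m + k * (2 ^ k * D ^ m) :=
      Nat.add_le_add (hmk.trans (Nat.le_mul_of_pos_right _ hpow1))
        (Nat.mul_le_mul j.2 hpow2)
    _ = k * (1 + 2 ^ k) * D ^ m := by ring

/-- For every integer `k ≥ 1` there exist `c > 0` and `n₀` such that for all
`n ≥ n₀` and every algebraically closed field `F`: if `f 0, …, f (k-1)` are nonzero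
homogeneous polynomials in `n + 1` variables over `F`, of positive degrees `d 0, …, d (k-1)`,
whose common projective zero locus meets every `k`-plane of `ℙ^n(F)` in a finite set
(for every `(k+1)`-dimensional linear subspace `W` of `F^(n+1)`, only finitely many lines
through the origin inside `W` lie in the common vanishing set), then
`d 0 ⬝ ⋯ ⬝ d (k-1) ≥ c · n^(H_k)` where `H_k = 1 + 1/2 + ⋯ + 1/k`. -/
theorem statement2 (k : ℕ) (hk : 1 ≤ k) :
    ∃ c : ℝ, 0 < c ∧
      ∃ n0 : ℕ, ∀ n : ℕ, n0 ≤ n →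
        ∀ (F : Type) [Field F] [IsAlgClosed F],
          ∀ (f : Fin k → MvPolynomial (Fin (n + 1)) F) (d : Fin k → ℕ),
            (∀ i, f i ≠ 0) →
            (∀ i, 1 ≤ d i) →
            (∀ i, (f i).IsHomogeneous (d i)) →
            (∀ W : Submodule F (Fin (n + 1) → F), Module.finrank F W = k + 1 →
              {L : Submodule F (Fin (n + 1) → F) |
                L ≤ W ∧ Module.finrank F L = 1 ∧
                  ∀ x ∈ L, ∀ i, MvPolynomial.eval x (f i) = 0}.Finite) →
            c * (n : ℝ) ^ (∑ i ∈ Finset.range k, (1 : ℝ) / (i + 1)) ≤ ∏ i, (d i : ℝ) := by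
  set H : ℝ := ∑ i ∈ Finset.range k, (1 : ℝ) / (i + 1) with hH
  have hk0 : (0 : ℝ) < k := by exact_mod_cast hk
  have hC : (0 : ℝ) < k * (1 + 2 ^ k) := by positivity
  refine ⟨((k * (1 + 2 ^ k) : ℝ) ^ H)⁻¹, by positivity, k, ?_⟩
  intro n hn F _ _ f d _ hd hf hfin
  have hprod : ((n : ℝ) / (k * (1 + 2 ^ k))) ^ H = ((k * (1 + 2 ^ k) : ℝ) ^ H)⁻¹ * (n : ℝ) ^ H := by
    rw [Real.div_rpow (by positivity) hC.le]
    ring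
  rw [← hprod, hH, Real.rpow_sum_of_nonneg (by positivity) (fun i _ => by positivity),
    ← Fin.prod_univ_eq_prod_range
      (fun i => ((n : ℝ) / (k * (1 + 2 ^ k))) ^ ((1 : ℝ) / (i + 1))) k,
    ← Equiv.prod_comp Fin.revPerm, ← Equiv.prod_comp (Tuple.sort d) (fun i => (d i : ℝ))]
  refine Finset.prod_le_prod (fun j _ => by positivity) fun j _ => ?_
  have hj := MvPolynomial.le_mul_pow_of_finite_lines hn f d hf hd hfin j
  have hrev : (((Fin.revPerm j : Fin k) : ℕ) : ℝ) + 1 = ((k - j : ℕ) : ℝ) := by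
    rw [Fin.revPerm_apply, Fin.val_rev, ← Nat.cast_add_one]
    congr 1
    omega
  have hm : k - (j : ℕ) ≠ 0 := by omega
  rw [hrev, one_div]
  refine (Real.rpow_le_rpow (by positivity) ?_ (by positivity)).trans_eq
    (Real.pow_rpow_inv_natCast (Nat.cast_nonneg (d (Tuple.sort d j))) hm)
  rw [div_le_iff₀ hC, mul_comm]
  exact_mod_cast hj
end

section
/- For all integers n > k ≥ 1 and r > k there exists a constant C > 0 such that for every prime power q, the number of (k,r)-evasive subsets of 𝔽_q^n is at most 2^{C·q^{n−k}}. -/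
open Finset

/-- Blocks contain each point with probability `1 / M` and each pair of distinct points with
probability at most `1 / M ^ 2`. -/
structure PairwiseDesign {P B : Type*} [DecidableEq P] [Fintype B] (inc : B → Finset P)
    (M lam : ℝ) : Prop where
  card_blocks : (Fintype.card B : ℝ) = lam * M ^ 2
  degree (p : P) : (#{b | p ∈ inc b} : ℝ) = lam * M
  codegree (p q : P) : p ≠ q → (#{b | p ∈ inc b ∧ q ∈ inc b} : ℝ) ≤ lam

/-- A choice of live points in `X` for some of the blocks, each such block containing at least `i`
points of `T` and at least `a` live points, with no point live in more than `d` blocks. -/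
structure LiveFamily {P B : Type*} [DecidableEq P] [Fintype B] (inc : B → Finset P)
    (X T : Finset P) (i : ℕ) (a U d : ℝ) (g : B → Finset P) : Prop where
  subset (b : B) : g b ⊆ X ∩ inc b
  le_card_inter (b : B) : (g b).Nonempty → i ≤ #(T ∩ inc b)
  le_card (b : B) : (g b).Nonempty → a ≤ #(g b)
  card_le (b : B) : (#(g b) : ℝ) ≤ U
  degree_le (u : P) : (#{b | u ∈ g b} : ℝ) ≤ d

section
variable {P B : Type*} [DecidableEq P] [Fintype B] {inc : B → Finset P}

omit [Fintype B] in
theorem sum_degree_eq_sum_card (s : Finset B) (Y : Finset P) (g : B → Finset P) :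
    ∑ u ∈ Y, (#{b ∈ s | u ∈ g b} : ℝ) = ∑ b ∈ s, (#(Y ∩ g b) : ℝ) := by
  have := Finset.sum_card_bipartiteAbove_eq_sum_card_bipartiteBelow (s := Y) (t := s)
    (fun u b => u ∈ g b)
  simp only [Finset.bipartiteAbove, Finset.bipartiteBelow, Finset.filter_mem_eq_inter] at this
  exact_mod_cast this

theorem LiveFamily.empty (X T : Finset P) (i : ℕ) (a : ℝ) {U d : ℝ} (hU : 0 ≤ U) (hd : 0 ≤ d) :
    LiveFamily inc X T i a U d (fun _ => ∅) where
  subset b := by simp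
  le_card_inter b h := by simp at h
  le_card b h := by simp at h
  card_le b := by simpa
  degree_le u := by simpa

open Classical in
theorem LiveFamily.insert_vertex {M lam : ℝ} (D : PairwiseDesign inc M lam)
    {X T : Finset P} {i : ℕ} {a U d d' : ℝ} {g g' : B → Finset P}
    (hg : LiveFamily inc X T i a U d g) (hg' : LiveFamily inc X T (i + 1) (a / 2) U d' g')
    (ha : 4 ≤ a) {C : Finset P} (hC : ∀ u ∈ X, u ∉ C → (#{b | u ∈ g' b} : ℝ) ≤ d' - lam)
    {G : Finset B} (hG' : ∀ b ∈ G, g' b = ∅)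
    (hGC : ∀ b ∈ G, 3 * a / 4 ≤ (#(g b \ C) : ℝ)) {v : P} (hvT : v ∉ T) :
    ∃ g'', LiveFamily inc X (insert v T) (i + 1) (a / 2) U d' g'' ∧
      #{b | (g'' b).Nonempty} = #{b | (g' b).Nonempty} + #{b ∈ G | v ∈ g b} := by
  set g'' : B → Finset P := fun b => if b ∈ G ∧ v ∈ g b then (g b \ C).erase v else g' b with hg''
  have hbig : ∀ b, b ∈ G → a / 2 ≤ (#((g b \ C).erase v) : ℝ) := by
    intro b hb
    have h1 := hGC b hb
    have h2 : #(g b \ C) ≤ #((g b \ C).erase v) + 1 :=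
      Nat.sub_le_iff_le_add.1 pred_card_le_card_erase
    have h3 : (#(g b \ C) : ℝ) ≤ #((g b \ C).erase v) + 1 := by exact_mod_cast h2
    linarith
  have hne : ∀ b, b ∈ G → ((g b \ C).erase v).Nonempty := by
    intro b hb
    have := hbig b hb
    rw [← Finset.card_pos]
    have h : (0 : ℝ) < #((g b \ C).erase v) := by linarith
    exact_mod_cast h
  refine ⟨g'', ⟨?_, ?_, ?_, ?_, ?_⟩, ?_⟩
  · intro b
    by_cases h : b ∈ G ∧ v ∈ g b
    · simp only [hg'', h, and_self, if_true]
      exact ((erase_subset _ _).trans sdiff_subset).trans (hg.subset b)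
    · simp only [hg'', h, if_false]
      exact hg'.subset b
  · intro b
    by_cases h : b ∈ G ∧ v ∈ g b
    · intro _
      have hvb : v ∈ inc b := (mem_inter.1 (hg.subset b h.2)).2
      have := hg.le_card_inter b ⟨v, h.2⟩
      rw [insert_inter_of_mem hvb, card_insert_of_notMem (by simp [hvT])]
      omega
    · simp only [hg'', h, if_false]
      intro hb
      exact (hg'.le_card_inter b hb).trans
        (card_le_card (inter_subset_inter_right (subset_insert _ _)))
  · intro b
    by_cases h : b ∈ G ∧ v ∈ g b
    · simp only [hg'', h, and_self, if_true]
      exact fun _ => hbig b h.1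
    · simp only [hg'', h, if_false]
      exact hg'.le_card b
  · intro b
    by_cases h : b ∈ G ∧ v ∈ g b
    · simp only [hg'', h, and_self, if_true]
      refine le_trans ?_ (hg.card_le b)
      exact_mod_cast card_le_card ((erase_subset _ _).trans sdiff_subset)
    · simp only [hg'', h, if_false]
      exact hg'.card_le b
  · intro u
    by_cases hu : u ∈ X ∧ u ∉ C ∧ u ≠ v
    · obtain ⟨huX, huC, huv⟩ := hu
      have hsub : (univ.filter fun b => u ∈ g'' b) ⊆
          (univ.filter fun b => u ∈ g' b) ∪ (univ.filter fun b => u ∈ inc b ∧ v ∈ inc b) := by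
        intro b hb
        simp only [mem_filter, mem_univ, true_and, mem_union] at hb ⊢
        by_cases h : b ∈ G ∧ v ∈ g b
        · simp only [hg'', h, and_self, if_true, mem_erase, mem_sdiff] at hb
          exact Or.inr ⟨(mem_inter.1 (hg.subset b hb.2.1)).2, (mem_inter.1 (hg.subset b h.2)).2⟩
        · simp only [hg'', h, if_false] at hb
          exact Or.inl hb
      have h1 : (#{b | u ∈ g'' b} : ℝ) ≤ #{b | u ∈ g' b} + #{b | u ∈ inc b ∧ v ∈ inc b} := by
        exact_mod_cast (card_le_card hsub).trans (card_union_le _ _)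
      linarith [hC u huX huC, D.codegree u v huv]
    · have hsub : (univ.filter fun b => u ∈ g'' b) ⊆ (univ.filter fun b => u ∈ g' b) := by
        intro b hb
        simp only [mem_filter, mem_univ, true_and] at hb ⊢
        by_cases h : b ∈ G ∧ v ∈ g b
        · simp only [hg'', h, and_self, if_true, mem_erase, mem_sdiff] at hb
          exact absurd ⟨(mem_inter.1 (hg.subset b hb.2.1)).1, hb.2.2, hb.1⟩ hu
        · simp only [hg'', h, if_false] at hb
          exact hb
      refine le_trans ?_ (hg'.degree_le u)
      exact_mod_cast card_le_card hsub
  · rw [← card_union_of_disjoint]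
    · congr 1
      ext b
      simp only [mem_filter, mem_univ, true_and, mem_union]
      by_cases h : b ∈ G ∧ v ∈ g b
      · simp [hg'', h, hne b h.1]
      · simp [hg'', h]
    · rw [Finset.disjoint_left]
      intro b hb hb'
      simp only [mem_filter, mem_univ, true_and] at hb hb'
      simp [hG' b hb'.1] at hb

open Classical in
theorem LiveFamily.card_extensions {M lam : ℝ} (D : PairwiseDesign inc M lam)
    {X T : Finset P} {i : ℕ} {a U d d' w κ s : ℝ} {g g' : B → Finset P}
    (hg : LiveFamily inc X T i a U d g) (hg' : LiveFamily inc X T (i + 1) (a / 2) U d' g')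
    (ha : 4 ≤ a) (hU : 0 ≤ U) (hd : 0 ≤ d) (hd' : 0 < d') (hlam : 2 * lam ≤ d')
    (hw : w ≤ #{b | (g b).Nonempty}) (hκ : (#{b | (g' b).Nonempty} : ℝ) ≤ κ)
    (hκw : κ ≤ w / 4) (hcap : 32 * U * κ * d ≤ w * a * d') (hs0 : 0 ≤ s)
    (hs : #X * s ≤ a * w / 4) :
    a * w / 4 ≤ d * (#{v ∈ X | v ∉ T ∧ ∃ g'', LiveFamily inc X (insert v T) (i + 1) (a / 2) U d' g''
      ∧ (#{b | (g' b).Nonempty} : ℝ) + s ≤ #{b | (g'' b).Nonempty}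
      ∧ (#{b | (g'' b).Nonempty} : ℝ) ≤ #{b | (g' b).Nonempty} + d} + #T) := by
  set C : Finset P := {u ∈ X | d' - lam < #{b | u ∈ g' b}} with hCdef
  set G0 : Finset B := {b | (g b).Nonempty} with hG0
  set G1 : Finset B := {b | (g' b).Nonempty} with hG1
  set L : Finset B := {b ∈ G0 | (#(g b \ C) : ℝ) < 3 * a / 4} with hL
  set G : Finset B := (G0 \ G1) \ L with hG
  have hκ0 : 0 ≤ κ := le_trans (by positivity) hκ
  have hCcard : (#C : ℝ) * (d' / 2) ≤ U * κ := by
    calc (#C : ℝ) * (d' / 2) = ∑ u ∈ C, d' / 2 := by simp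
      _ ≤ ∑ u ∈ C, (#{b ∈ G1 | u ∈ g' b} : ℝ) := by
          refine sum_le_sum fun u hu => ?_
          have h1 := (mem_filter.1 hu).2
          have h2 : (univ.filter fun b => u ∈ g' b) = G1.filter fun b => u ∈ g' b := by
            ext b
            simp only [mem_filter, mem_univ, true_and, hG1]
            exact ⟨fun h => ⟨⟨u, h⟩, h⟩, fun h => h.2⟩
          rw [h2] at h1
          linarith
      _ = ∑ b ∈ G1, (#(C ∩ g' b) : ℝ) := sum_degree_eq_sum_card _ _ _
      _ ≤ ∑ b ∈ G1, U := by
          refine sum_le_sum fun b _ => le_trans ?_ (hg'.card_le b)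
          exact_mod_cast card_le_card inter_subset_right
      _ = U * #G1 := by simp [mul_comm]
      _ ≤ U * κ := by gcongr
  have hLcard : (#L : ℝ) * (a / 4) ≤ #C * d := by
    calc (#L : ℝ) * (a / 4) = ∑ b ∈ L, a / 4 := by simp
      _ ≤ ∑ b ∈ L, (#(C ∩ g b) : ℝ) := by
          refine sum_le_sum fun b hb => ?_
          have h1 := (mem_filter.1 hb).2
          have h2 := hg.le_card b (mem_filter.1 (mem_filter.1 hb).1).2
          have h3 : (#(g b \ C) : ℝ) + #(C ∩ g b) = #(g b) := by
            rw [inter_comm]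
            exact_mod_cast card_sdiff_add_card_inter (g b) C
          linarith
      _ = ∑ u ∈ C, (#{b ∈ L | u ∈ g b} : ℝ) := (sum_degree_eq_sum_card _ _ _).symm
      _ ≤ ∑ u ∈ C, d := by
          refine sum_le_sum fun u _ => le_trans ?_ (hg.degree_le u)
          exact_mod_cast card_le_card (filter_subset_filter _ (subset_univ _))
      _ = #C * d := by simp
  have hLw : (#L : ℝ) ≤ w / 4 := by
    have h1 : (#L : ℝ) * (a / 4) * (d' / 2) ≤ U * κ * d := by
      calc (#L : ℝ) * (a / 4) * (d' / 2) ≤ #C * d * (d' / 2) := by gcongr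
        _ = #C * (d' / 2) * d := by ring
        _ ≤ U * κ * d := by gcongr
    have h2 : (#L : ℝ) * (a * d') ≤ w / 4 * (a * d') := by linarith
    exact le_of_mul_le_mul_right h2 (by positivity)
  have hGcard : w / 2 ≤ #G := by
    have h1 : #G0 ≤ #G + #G1 + #L := by
      have h2 : G0 ⊆ G ∪ G1 ∪ L := by
        intro b hb
        simp only [hG, mem_union, mem_sdiff]
        tauto
      exact (card_le_card h2).trans ((card_union_le _ _).trans
        (Nat.add_le_add_right (card_union_le _ _) _))
    have h3 : (#G0 : ℝ) ≤ #G + #G1 + #L := by exact_mod_cast h1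
    linarith
  have hinc : a * w / 2 ≤ ∑ v ∈ X, (#{b ∈ G | v ∈ g b} : ℝ) := by
    rw [sum_degree_eq_sum_card]
    calc a * w / 2 = w / 2 * a := by ring
      _ ≤ #G * a := by gcongr
      _ = ∑ b ∈ G, a := by simp
      _ ≤ _ := by
          refine sum_le_sum fun b hb => ?_
          have h1 : b ∈ G0 := (mem_sdiff.1 (mem_sdiff.1 hb).1).1
          rw [inter_eq_right.2 ((hg.subset b).trans inter_subset_left)]
          exact hg.le_card b (mem_filter.1 h1).2
  have hGd : ∀ v, (#{b ∈ G | v ∈ g b} : ℝ) ≤ d := fun v => by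
    refine le_trans ?_ (hg.degree_le v)
    exact_mod_cast card_le_card (filter_subset_filter _ (subset_univ _))
  set E : Finset P := {v ∈ X | v ∉ T ∧ ∃ g'', LiveFamily inc X (insert v T) (i + 1) (a / 2) U d' g''
      ∧ (#G1 : ℝ) + s ≤ #{b | (g'' b).Nonempty}
      ∧ (#{b | (g'' b).Nonempty} : ℝ) ≤ #G1 + d} with hE
  have hhigh : X.filter (fun v => s ≤ (#{b ∈ G | v ∈ g b} : ℝ)) ⊆ E ∪ T := by
    intro v hv
    obtain ⟨hvX, hvs⟩ := mem_filter.1 hv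
    by_cases hvT : v ∈ T
    · exact mem_union_right _ hvT
    refine mem_union_left _ (mem_filter.2 ⟨hvX, hvT, ?_⟩)
    obtain ⟨g'', h1, h2⟩ := LiveFamily.insert_vertex D hg hg' ha (C := C) (G := G) (v := v)
      (fun u hu huC => by
        by_contra h
        exact huC (mem_filter.2 ⟨hu, not_le.1 h⟩))
      (fun b hb => by
        have : b ∉ G1 := (mem_sdiff.1 (mem_sdiff.1 hb).1).2
        simpa [hG1] using this)
      (fun b hb => by
        by_contra h
        exact (mem_sdiff.1 hb).2 (mem_filter.2
          ⟨(mem_sdiff.1 (mem_sdiff.1 hb).1).1, not_le.1 h⟩)) hvT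
    have h3 : (#{b | (g'' b).Nonempty} : ℝ) = #G1 + #{b ∈ G | v ∈ g b} := by exact_mod_cast h2
    refine ⟨g'', h1, ?_, ?_⟩ <;> linarith [hGd v]
  have hsplit : ∑ v ∈ X, (#{b ∈ G | v ∈ g b} : ℝ) ≤
      #(X.filter (fun v => s ≤ (#{b ∈ G | v ∈ g b} : ℝ))) * d + #X * s := by
    rw [← sum_filter_add_sum_filter_not X (fun v => s ≤ (#{b ∈ G | v ∈ g b} : ℝ))]
    refine add_le_add ?_ ?_
    · rw [← nsmul_eq_mul]
      exact sum_le_card_nsmul _ _ _ fun v _ => hGd v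
    · calc _ ≤ (#(X.filter fun v => ¬ s ≤ (#{b ∈ G | v ∈ g b} : ℝ)) : ℝ) * s := by
            rw [← nsmul_eq_mul]
            exact sum_le_card_nsmul _ _ _ fun v hv => (not_le.1 (mem_filter.1 hv).2).le
        _ ≤ #X * s := by
            gcongr
            exact filter_subset _ _
  have hcard : (#(X.filter (fun v => s ≤ (#{b ∈ G | v ∈ g b} : ℝ))) : ℝ) ≤ #E + #T := by
    exact_mod_cast (card_le_card hhigh).trans (card_union_le _ _)
  have := mul_le_mul_of_nonneg_right hcard hd
  linarith

theorem PairwiseDesign.sum_card_inter {M lam : ℝ} (D : PairwiseDesign inc M lam) (X : Finset P) :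
    ∑ b, (#(X ∩ inc b) : ℝ) = #X * (lam * M) := by
  rw [← sum_degree_eq_sum_card]
  simp [D.degree]

theorem PairwiseDesign.sum_card_inter_sq {M lam : ℝ} (hlam : 0 ≤ lam)
    (D : PairwiseDesign inc M lam) (X : Finset P) :
    ∑ b, (#(X ∩ inc b) : ℝ) ^ 2 ≤ #X * (lam * M) + #X ^ 2 * lam := by
  have h1 : ∀ b, (#(X ∩ inc b) : ℝ) ^ 2 = ∑ u ∈ X, ∑ v ∈ X,
      if u ∈ inc b ∧ v ∈ inc b then (1 : ℝ) else 0 := by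
    intro b
    have : (#(X ∩ inc b) : ℝ) = ∑ u ∈ X, if u ∈ inc b then (1 : ℝ) else 0 := by
      rw [sum_boole, filter_mem_eq_inter]
    rw [this, sq, sum_mul_sum]
    refine sum_congr rfl fun u _ => sum_congr rfl fun v _ => ?_
    by_cases hu : u ∈ inc b <;> by_cases hv : v ∈ inc b <;> simp [hu, hv]
  simp_rw [h1]
  rw [sum_comm]
  simp_rw [sum_comm (s := (univ : Finset B)) (t := X)]
  calc _ ≤ ∑ u ∈ X, ∑ v ∈ X, ((if u = v then lam * M else 0) + lam) := by
        refine sum_le_sum fun u _ => sum_le_sum fun v _ => ?_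
        rw [sum_boole]
        by_cases huv : u = v
        · subst huv
          simp only [and_self, if_true]
          linarith [D.degree u]
        · simp only [huv, if_false]
          linarith [D.codegree u v huv]
    _ = _ := by
        simp [sum_add_distrib]
        ring

open Classical in
theorem PairwiseDesign.half_le_card_typical {M lam A : ℝ} (hM : 0 < M) (hlam : 0 < lam)
    (D : PairwiseDesign inc M lam) (X : Finset P) (hA : (#X : ℝ) = A * M) (hA8 : 8 ≤ A) :
    lam * M ^ 2 / 2 ≤ #{b | A / 2 ≤ (#(X ∩ inc b) : ℝ) ∧ (#(X ∩ inc b) : ℝ) ≤ 2 * A} := by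
  set Gd : Finset B := {b | A / 2 ≤ (#(X ∩ inc b) : ℝ) ∧ (#(X ∩ inc b) : ℝ) ≤ 2 * A} with hGd
  have hvar : ∑ b, ((#(X ∩ inc b) : ℝ) - A) ^ 2 ≤ A * (lam * M ^ 2) := by
    have : ∑ b, ((#(X ∩ inc b) : ℝ) - A) ^ 2 =
        ∑ b, (#(X ∩ inc b) : ℝ) ^ 2 - 2 * A * ∑ b, (#(X ∩ inc b) : ℝ) +
          Fintype.card B * A ^ 2 := by
      simp only [sub_sq, sum_add_distrib, sum_sub_distrib, mul_sum, sum_const, card_univ,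
        nsmul_eq_mul]
      congr 2
      exact sum_congr rfl fun b _ => by ring
    rw [this, D.sum_card_inter, D.card_blocks]
    have := D.sum_card_inter_sq hlam.le X
    rw [hA] at this ⊢
    nlinarith
  have hbad : (#(univ.filter fun b => b ∉ Gd) : ℝ) * (A ^ 2 / 4) ≤ A * (lam * M ^ 2) := by
    calc _ = ∑ b ∈ univ.filter (fun b => b ∉ Gd), A ^ 2 / 4 := by simp
      _ ≤ ∑ b ∈ univ.filter (fun b => b ∉ Gd), ((#(X ∩ inc b) : ℝ) - A) ^ 2 := by
          refine sum_le_sum fun b hb => ?_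
          simp only [hGd, mem_filter, mem_univ, true_and, not_and_or, not_le] at hb
          rcases hb with hb | hb <;> nlinarith
      _ ≤ ∑ b, ((#(X ∩ inc b) : ℝ) - A) ^ 2 :=
          sum_le_sum_of_subset_of_nonneg (subset_univ _) fun _ _ _ => sq_nonneg _
      _ ≤ _ := hvar
  have htot : (#Gd : ℝ) + #(univ.filter fun b => b ∉ Gd) = lam * M ^ 2 := by
    rw [← D.card_blocks, ← card_univ (α := B)]
    have h1 := card_filter_add_card_filter_not (s := (univ : Finset B)) (fun b => b ∈ Gd)
    have h2 : (univ.filter fun b => b ∈ Gd) = Gd := by simp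
    rw [h2] at h1
    exact_mod_cast h1
  have hN : 0 < lam * M ^ 2 := by positivity
  have hb2 : (#(univ.filter fun b => b ∉ Gd) : ℝ) ≤ lam * M ^ 2 / 2 := by
    have h1 : (#(univ.filter fun b => b ∉ Gd) : ℝ) * (A / 4) ≤ lam * M ^ 2 := by
      have : (#(univ.filter fun b => b ∉ Gd) : ℝ) * (A / 4) * A ≤ lam * M ^ 2 * A := by linarith
      exact le_of_mul_le_mul_right this (by linarith)
    nlinarith [(Nat.cast_nonneg (#(univ.filter fun b => b ∉ Gd)) : (0 : ℝ) ≤ _)]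
  linarith


/-- Upper bound on the normalised degrees after `i` rounds of selection. -/
def degreeBound (K : ℝ) : ℕ → ℝ
  | 0 => 1
  | i + 1 => K ^ (i + 2) * degreeBound K i ^ 2

theorem one_le_degreeBound {K : ℝ} (hK : 1 ≤ K) : ∀ i, 1 ≤ degreeBound K i
  | 0 => le_rfl
  | i + 1 => by
      have h1 := one_le_degreeBound hK i
      have h2 : 1 ≤ K ^ (i + 2) := one_le_pow₀ hK
      have h3 : 1 ≤ degreeBound K i ^ 2 := one_le_pow₀ h1
      simp only [degreeBound]
      nlinarith

/-- `T` has been selected from `X` in `i` full rounds of `t` points followed by `j` further points,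
each round keeping many blocks with spread-out live points. -/
def Reachable (inc : B → Finset P) (r t : ℕ) (K M lam A : ℝ) (X T : Finset P) : Prop :=
  ∃ i j : ℕ, i ≤ r ∧ j < t ∧ #T = i * t + j ∧ ∃ g g' : B → Finset P,
    LiveFamily inc X T i (A / 2 ^ (i + 1)) (2 * A) (degreeBound K i * (t / M) ^ i * lam * M) g ∧
    LiveFamily inc X T (i + 1) (A / 2 ^ (i + 1) / 2) (2 * A)
      (degreeBound K (i + 1) * (t / M) ^ (i + 1) * lam * M) g' ∧
    (1 / K) ^ (i + 1) * (t / M) ^ i * lam * M ^ 2 ≤ #{b | (g b).Nonempty} ∧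
    j * ((1 / K) ^ (i + 2) * (t / M) ^ i * lam * M) ≤ #{b | (g' b).Nonempty} ∧
    (#{b | (g' b).Nonempty} : ℝ) ≤ j * (degreeBound K i * (t / M) ^ i * lam * M)

theorem reachable_empty {r t : ℕ} {K M lam A : ℝ} (hM : 0 < M) (hlam : 0 < lam) (hK : 2 ≤ K)
    (ht : 0 < t) (D : PairwiseDesign inc M lam) {X : Finset P} (hX : (#X : ℝ) = A * M)
    (hA : 8 ≤ A) : Reachable inc r t K M lam A X ∅ := by
  classical
  have hβ := one_le_degreeBound (show 1 ≤ K by linarith) 1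
  have hK0 : 0 < K := by linarith
  have hgood := D.half_le_card_typical hM hlam X hX hA
  refine ⟨0, 0, Nat.zero_le _, ht, by simp,
    fun b => if A / 2 ≤ (#(X ∩ inc b) : ℝ) ∧ (#(X ∩ inc b) : ℝ) ≤ 2 * A then X ∩ inc b else ∅,
    fun _ => ∅, ⟨?_, ?_, ?_, ?_, ?_⟩, LiveFamily.empty _ _ _ _ (by linarith) (by positivity),
    ?_, by simp, by simp⟩
  · intro b
    split_ifs <;> simp
  · simp
  · intro b
    split_ifs with h
    · intro _
      simpa using h.1
    · simp
  · intro b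
    split_ifs with h
    · exact h.2
    · simp only [card_empty, Nat.cast_zero]
      linarith
  · intro u
    simp only [degreeBound, pow_zero, mul_one, one_mul]
    rw [← D.degree u]
    have : (univ.filter fun b => u ∈ if A / 2 ≤ (#(X ∩ inc b) : ℝ) ∧ (#(X ∩ inc b) : ℝ) ≤ 2 * A
        then X ∩ inc b else ∅) ⊆ univ.filter fun b => u ∈ inc b := by
      intro b
      simp only [mem_filter, mem_univ, true_and]
      split_ifs
      · exact fun h => (mem_inter.1 h).2
      · simp
    exact_mod_cast card_le_card this
  · have h1 : (univ.filter fun b => A / 2 ≤ (#(X ∩ inc b) : ℝ) ∧ (#(X ∩ inc b) : ℝ) ≤ 2 * A) ⊆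
        univ.filter fun b => (if A / 2 ≤ (#(X ∩ inc b) : ℝ) ∧ (#(X ∩ inc b) : ℝ) ≤ 2 * A
        then X ∩ inc b else ∅).Nonempty := by
      intro b hb
      have h := (mem_filter.1 hb).2
      simp only [mem_filter, mem_univ, true_and, h, and_self, if_true]
      rw [← card_pos]
      have : (0 : ℝ) < #(X ∩ inc b) := by linarith [h.1]
      exact_mod_cast this
    have h2 : (#(univ.filter fun b => A / 2 ≤ (#(X ∩ inc b) : ℝ) ∧ (#(X ∩ inc b) : ℝ) ≤ 2 * A) : ℝ)
        ≤ #(univ.filter fun b => (if A / 2 ≤ (#(X ∩ inc b) : ℝ) ∧ (#(X ∩ inc b) : ℝ) ≤ 2 * A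
        then X ∩ inc b else ∅).Nonempty) := by exact_mod_cast card_le_card h1
    refine le_trans ?_ (hgood.trans h2)
    have h3 : 1 / K ≤ 1 / 2 := one_div_le_one_div_of_le (by norm_num) hK
    have h4 : 0 < lam * M ^ 2 := by positivity
    simp only [zero_add, pow_one, pow_zero, mul_one]
    nlinarith

set_option maxHeartbeats 1000000 in
open Classical in
theorem Reachable.card_extensions {r t : ℕ} {K M lam A c : ℝ} (hM : 0 < M) (hlam : 0 < lam)
    (hK : K = 2 ^ (r + 8)) (ht : 0 < t) (D : PairwiseDesign inc M lam) {X : Finset P}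
    (hX : (#X : ℝ) = A * M) (hA : 2 ^ (r + 4) ≤ A) (hc : 0 < c)
    (hcK : ∀ i < r, 2 * c * degreeBound K i ≤ (1 / K) ^ (i + 2))
    (htc : (r + 1) * t ≤ c * M) (htM : 2 ≤ ((t : ℝ) / M) ^ r * M) {T : Finset P}
    (hT : Reachable inc r t K M lam A X T) (hev : ∀ b, #(T ∩ inc b) < r) :
    c * #X ≤ #{v ∈ X | v ∉ T ∧ Reachable inc r t K M lam A X (insert v T)} ∧ #T ≤ r * t := by
  obtain ⟨i, j, hir, hjt, hTcard, g, g', hg, hg', hw, hlo, hhi⟩ := hT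
  have hK1 : 1 ≤ K := by rw [hK]; exact one_le_pow₀ (by norm_num)
  have hK0 : 0 < K := by linarith
  have htpos : (0 : ℝ) < t := by exact_mod_cast ht
  set τ : ℝ := t / M with hτ
  have hτ0 : 0 < τ := by positivity
  have htτ : (t : ℝ) = τ * M := by rw [hτ]; field_simp
  have hi : i < r := by
    refine lt_of_le_of_ne hir fun hEq => ?_
    have : (0 : ℝ) < #{b | (g b).Nonempty} := lt_of_lt_of_le (by positivity) hw
    have h2 : 0 < #{b | (g b).Nonempty} := by exact_mod_cast this
    obtain ⟨b, hb⟩ := card_pos.1 h2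
    have := hg.le_card_inter b (mem_filter.1 hb).2
    have := hev b
    omega
  have hTr : #T ≤ r * t := by
    have := Nat.mul_le_mul_right t (Nat.succ_le_of_lt hi)
    rw [Nat.succ_mul] at this
    omega
  refine ⟨?_, hTr⟩
  have hβ := one_le_degreeBound hK1 i
  have hβ' := one_le_degreeBound hK1 (i + 1)
  have hβs : degreeBound K (i + 1) = K ^ (i + 2) * degreeBound K i ^ 2 := rfl
  set β := degreeBound K i with hβdef
  set β' := degreeBound K (i + 1) with hβ'def
  have hpow : (2 : ℝ) ^ (i + 8) ≤ K := by
    rw [hK]; exact pow_le_pow_right₀ (by norm_num) (by omega)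
  have hpow0 : (0 : ℝ) < 2 ^ (i + 1) := by positivity
  have hpow8 : (2 : ℝ) ^ (i + 8) = 128 * 2 ^ (i + 1) := by ring
  have hA1 : 1 ≤ A := le_trans (one_le_pow₀ (by norm_num)) hA
  have hA0 : 0 < A := by linarith
  have hα : (1 / K) ^ (i + 2) * K = (1 / K) ^ (i + 1) := by
    rw [pow_succ]; field_simp
  set α' := (1 / K) ^ (i + 2) with hα'def
  have hα'0 : 0 < α' := by positivity
  have hαβ' : α' * β' = β ^ 2 := by
    rw [hα'def, hβs, one_div, inv_pow]; field_simp
  rw [← hα] at hw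
  have hca := hcK i hi
  have hrt1 : (1 : ℝ) ≤ r + 1 := by linarith [(Nat.cast_nonneg r : (0 : ℝ) ≤ r)]
  have hτc : (r + 1) * τ ≤ c := by
    rw [htτ] at htc
    have : ((r : ℝ) + 1) * τ * M ≤ c * M := by linarith
    exact le_of_mul_le_mul_right this hM
  have hτc' : τ ≤ c := by nlinarith
  have hα'1 : α' ≤ 1 := by
    rw [hα'def, one_div]; exact pow_le_one₀ (by positivity) (inv_le_one_of_one_le₀ hK1)
  have hτ1 : τ ≤ 1 := by nlinarith
  have hK128 : 128 ≤ K := by nlinarith [one_le_pow₀ (n := i + 1) (show (1 : ℝ) ≤ 2 by norm_num)]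
  set S := τ ^ i * lam * M with hS
  have hS0 : 0 < S := by positivity
  have key := LiveFamily.card_extensions (a := A / 2 ^ (i + 1)) (κ := t * (β * S))
    (s := α' * S) (w := α' * K * (S * M)) (d := β * τ ^ i * lam * M)
    (d' := β' * τ ^ (i + 1) * lam * M) D hg hg' ?_ (by linarith) (by positivity) (by positivity)
    ?_ ?_ ?_ ?_ ?_ (by positivity) ?_
  · set E : Finset P := {v ∈ X | v ∉ T ∧ Reachable inc r t K M lam A X (insert v T)} with hE
    have hsub : (X.filter fun v => v ∉ T ∧ ∃ g'', LiveFamily inc X (insert v T) (i + 1)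
        (A / 2 ^ (i + 1) / 2) (2 * A) (β' * τ ^ (i + 1) * lam * M) g''
        ∧ (#{b | (g' b).Nonempty} : ℝ) + α' * S ≤ #{b | (g'' b).Nonempty}
        ∧ (#{b | (g'' b).Nonempty} : ℝ) ≤ #{b | (g' b).Nonempty} + β * τ ^ i * lam * M) ⊆ E := by
      intro v hv
      obtain ⟨hvX, hvT, g'', hg'', h1, h2⟩ := mem_filter.1 hv
      refine mem_filter.2 ⟨hvX, hvT, ?_⟩
      have hcard : #(insert v T) = #T + 1 := card_insert_of_notMem hvT
      by_cases hj : j + 1 < t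
      · refine ⟨i, j + 1, hir, hj, by omega, g, g'',
          ⟨hg.subset, fun b hb => (hg.le_card_inter b hb).trans
            (card_le_card (inter_subset_inter_right (subset_insert _ _))), hg.le_card, hg.card_le,
            hg.degree_le⟩, hg'', by rwa [← hα], ?_, ?_⟩
        · push_cast
          rw [← hτ, ← hα'def]
          rw [hS] at h1
          linarith
        · push_cast
          rw [← hτ, ← hβdef]
          linarith
      · have hj' : j + 1 = t := by omega
        refine ⟨i + 1, 0, hi, ht, by rw [hcard, hTcard, ← hj']; ring, g'', fun _ => ∅,
          ?_, LiveFamily.empty _ _ _ _ (by linarith) ?_, ?_, by simp, by simp⟩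
        · have : A / 2 ^ (i + 1 + 1) = A / 2 ^ (i + 1) / 2 := by
            rw [pow_succ (2 : ℝ) (i + 1)]; field_simp
          rw [this]
          exact hg''
        · have := one_le_degreeBound hK1 (i + 1 + 1)
          positivity
        · refine le_trans (le_of_eq ?_) ((add_le_add_left hlo (α' * S)).trans h1)
          have hjt' : (j : ℝ) = τ * M - 1 := by
            rw [← htτ, ← hj']; push_cast; ring
          rw [← hτ, ← hα'def, hS, hjt']
          ring
    have hEcard := card_le_card hsub
    have h1 : A / 2 ^ (i + 1) * (α' * K * (S * M)) / 4 ≤ β * S * (#E + #T) := by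
      have hEcard' := add_le_add_left (Nat.cast_le (α := ℝ).2 hEcard) (#T : ℝ)
      refine key.trans ((mul_le_mul_of_nonneg_left hEcard' (by positivity)).trans (le_of_eq ?_))
      rw [hS]
      ring
    have h2 : α' * #X * S ≤ A / 2 ^ (i + 1) * (α' * K * (S * M)) / 4 := by
      rw [hX, div_mul_eq_mul_div, div_div, le_div_iff₀ (by positivity)]
      have : (2 : ℝ) ^ (i + 1) * 4 ≤ K := by linarith
      calc α' * (A * M) * S * (2 ^ (i + 1) * 4) ≤ α' * (A * M) * S * K := by gcongr
        _ = _ := by ring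
    have h3 : α' * #X ≤ β * (#E + #T) := by
      refine le_of_mul_le_mul_right ?_ hS0
      linarith
    have h4 : 2 * c * #X ≤ #E + #T := by
      have h5 : 2 * c * β * #X ≤ α' * #X := mul_le_mul_of_nonneg_right hca (Nat.cast_nonneg _)
      have h6 : β * (2 * c * #X) ≤ β * (#E + #T) := by linarith only [h3, h5]
      exact le_of_mul_le_mul_left h6 (by linarith)
    have h7 : (#T : ℝ) ≤ c * #X := by
      have h8 : (#T : ℝ) ≤ r * t := by exact_mod_cast hTr
      have h9 : c * M ≤ c * #X := by
        rw [hX]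
        exact mul_le_mul_of_nonneg_left (le_mul_of_one_le_left hM.le hA1) hc.le
      have h10 : (r : ℝ) * t ≤ (r + 1) * t := by
        exact mul_le_mul_of_nonneg_right (le_add_of_nonneg_right zero_le_one) htpos.le
      linarith only [h8, h9, h10, htc]
    linarith only [h4, h7]
  · rw [le_div_iff₀ hpow0]
    refine le_trans ?_ hA
    rw [show (4 : ℝ) * 2 ^ (i + 1) = 2 ^ (i + 3) by ring]
    exact pow_le_pow_right₀ (by norm_num) (by omega)
  · have h1 : τ ^ r ≤ τ ^ (i + 1) := pow_le_pow_of_le_one hτ0.le hτ1 hi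
    have h2 : 2 ≤ τ ^ (i + 1) * M := htM.trans (by gcongr)
    have h3 : 2 ≤ β' * (τ ^ (i + 1) * M) := by nlinarith
    nlinarith
  · refine le_trans (le_of_eq ?_) hw
    rw [hS]; ring
  · refine hhi.trans ?_
    rw [show β * τ ^ i * lam * M = β * S by rw [hS]; ring]
    gcongr
  · rw [htτ]
    have h1 : τ * β ≤ α' := by nlinarith
    have h2 : α' ≤ α' * K / 4 := by nlinarith
    calc τ * M * (β * S) = τ * β * (S * M) := by ring
      _ ≤ α' * K / 4 * (S * M) := by gcongr; linarith
      _ = _ := by ring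
  · rw [htτ]
    have h1 : 32 * (2 * A) * (τ * M * (β * S)) * (β * τ ^ i * lam * M) =
        64 * A * τ * M * S * S * β ^ 2 := by rw [hS]; ring
    have h2 : α' * K * (S * M) * (A / 2 ^ (i + 1)) * (β' * τ ^ (i + 1) * lam * M) =
        (α' * β') * A * τ * M * S * S * (K / 2 ^ (i + 1)) := by rw [hS]; ring
    rw [h1, h2, hαβ']
    have h3 : 64 ≤ K / 2 ^ (i + 1) := by rw [le_div_iff₀ hpow0]; linarith
    calc 64 * A * τ * M * S * S * β ^ 2 = β ^ 2 * A * τ * M * S * S * 64 := by ring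
      _ ≤ _ := by gcongr
  · rw [hX]
    have h3 : 4 ≤ K / 2 ^ (i + 1) := by rw [le_div_iff₀ hpow0]; linarith
    calc A * M * (α' * S) = α' * A * S * M * 4 / 4 := by ring
      _ ≤ α' * A * S * M * (K / 2 ^ (i + 1)) / 4 := by gcongr
      _ = _ := by ring

open Classical in
theorem exists_container {r t : ℕ} {K M lam A c : ℝ} (hM : 0 < M) (hlam : 0 < lam)
    (hK : K = 2 ^ (r + 8)) (ht : 0 < t) (D : PairwiseDesign inc M lam) {X : Finset P}
    (hX : (#X : ℝ) = A * M) (hA : 2 ^ (r + 4) ≤ A) (hc : 0 < c)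
    (hcK : ∀ i < r, 2 * c * degreeBound K i ≤ (1 / K) ^ (i + 2))
    (htc : (r + 1) * t ≤ c * M) (htM : 2 ≤ ((t : ℝ) / M) ^ r * M) :
    ∃ F : Finset P → Finset P, ∀ S ⊆ X, (∀ b, #(S ∩ inc b) < r) →
      ∃ T ⊆ S, #T ≤ r * t ∧ S ⊆ F T ∧ F T ⊆ X ∧ (#(F T) : ℝ) ≤ (1 - c) * #X := by
  refine ⟨fun T => X \ {v ∈ X | v ∉ T ∧ Reachable inc r t K M lam A X (insert v T)},
    fun S hSX hS => ?_⟩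
  have h2K : 2 ≤ K := by
    rw [hK]; exact le_self_pow₀ (by norm_num) (by omega)
  have h8A : 8 ≤ A := by
    refine le_trans ?_ hA
    rw [show (8 : ℝ) = 2 ^ 3 by norm_num]
    exact pow_le_pow_right₀ (by norm_num) (by omega)
  obtain ⟨T, hTmem, hTmax⟩ := exists_max_image
    (S.powerset.filter fun T => Reachable inc r t K M lam A X T) card
    ⟨∅, mem_filter.2 ⟨empty_mem_powerset _, reachable_empty hM hlam h2K ht D hX h8A⟩⟩
  obtain ⟨hTS, hT⟩ := mem_filter.1 hTmem
  rw [mem_powerset] at hTS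
  obtain ⟨h1, h2⟩ := hT.card_extensions hM hlam hK ht D hX hA hc hcK htc htM
    (fun b => (card_le_card (inter_subset_inter_right hTS)).trans_lt (hS b))
  refine ⟨T, hTS, h2, ?_, sdiff_subset, ?_⟩
  · intro v hv
    refine mem_sdiff.2 ⟨hSX hv, fun hv' => ?_⟩
    obtain ⟨-, hvT, hvR⟩ := mem_filter.1 hv'
    have := hTmax (insert v T) (mem_filter.2 ⟨mem_powerset.2 (insert_subset hv hTS), hvR⟩)
    rw [card_insert_of_notMem hvT] at this
    omega
  · have h3 := card_sdiff_add_card_eq_card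
      (filter_subset (fun v => v ∉ T ∧ Reachable inc r t K M lam A X (insert v T)) X)
    have h4 : (#(X \ X.filter fun v => v ∉ T ∧ Reachable inc r t K M lam A X (insert v T)) : ℝ) +
      #(X.filter fun v => v ∉ T ∧ Reachable inc r t K M lam A X (insert v T)) = #X := by
      exact_mod_cast h3
    linarith


omit [Fintype B] in
theorem card_filter_card_le (X : Finset P) (Z : ℕ) :
    #(X.powerset.filter fun T => #T ≤ Z) ≤ (#X + 1) ^ Z := by
  induction Z with
  | zero =>
    refine card_le_one.2 fun a ha b hb => ?_
    have h1 := (mem_filter.1 ha).2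
    have h2 := (mem_filter.1 hb).2
    rw [card_eq_zero.1 (Nat.le_zero.1 h1), card_eq_zero.1 (Nat.le_zero.1 h2)]
  | succ Z ih =>
    set F := X.powerset.filter fun T => #T ≤ Z with hF
    have hsub : (X.powerset.filter fun T => #T ≤ Z + 1) ⊆
        (X ×ˢ F).image (fun p => insert p.1 p.2) ∪ F := by
      intro T hT
      obtain ⟨hTX, hTc⟩ := mem_filter.1 hT
      rw [mem_powerset] at hTX
      rcases T.eq_empty_or_nonempty with rfl | ⟨v, hv⟩
      · exact mem_union_right _ (mem_filter.2 ⟨by simp, by simp⟩)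
      · refine mem_union_left _ (mem_image.2 ⟨(v, T.erase v), ?_, insert_erase hv⟩)
        refine mem_product.2 ⟨hTX hv, mem_filter.2 ⟨mem_powerset.2 ((erase_subset _ _).trans hTX), ?_⟩⟩
        rw [card_erase_of_mem hv]
        omega
    calc _ ≤ #X * #F + #F := (card_le_card hsub).trans ((card_union_le _ _).trans
          (Nat.add_le_add_right (card_image_le.trans (card_product _ _).le) _))
      _ = (#X + 1) * #F := by ring
      _ ≤ (#X + 1) * (#X + 1) ^ Z := Nat.mul_le_mul_left _ ih
      _ = _ := by ring

open Classical in
theorem card_evasive_le_of_pow_mul_card_le {r t : ℕ} {K M lam c R : ℝ} (hM : 0 < M)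
    (hlam : 0 < lam) (hK : K = 2 ^ (r + 8)) (ht : 0 < t) (D : PairwiseDesign inc M lam)
    (hc : 0 < c) (hc1 : c ≤ 1) (hcK : ∀ i < r, 2 * c * degreeBound K i ≤ (1 / K) ^ (i + 2))
    (htc : (r + 1) * t ≤ c * M) (htM : 2 ≤ ((t : ℝ) / M) ^ r * M) (hR1 : 1 ≤ R) (l : ℕ) :
    ∀ X : Finset P, (#X : ℝ) + 1 ≤ R → (1 - c) ^ l * #X ≤ 2 ^ (r + 4) * M →
      (#(X.powerset.filter fun S => ∀ b, #(S ∩ inc b) < r) : ℝ) ≤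
        (R ^ (r * t)) ^ l * (2 : ℝ) ^ ((2 : ℝ) ^ (r + 4) * M) := by
  induction l with
  | zero =>
    intro X _ hX
    rw [pow_zero, one_mul] at hX ⊢
    calc (#(X.powerset.filter fun S => ∀ b, #(S ∩ inc b) < r) : ℝ) ≤ (2 : ℝ) ^ (#X) := by
          exact_mod_cast (card_filter_le _ _).trans (card_powerset X).le
      _ = (2 : ℝ) ^ (#X : ℝ) := (Real.rpow_natCast _ _).symm
      _ ≤ _ := Real.rpow_le_rpow_of_exponent_le (by norm_num) hX
  | succ l ih =>
    intro X hXR hX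
    have hRt : 1 ≤ R ^ (r * t) := one_le_pow₀ hR1
    by_cases hsmall : (1 - c) ^ l * #X ≤ 2 ^ (r + 4) * M
    · refine (ih X hXR hsmall).trans ?_
      gcongr ?_ * _
      exact pow_le_pow_right₀ hRt (Nat.le_succ l)
    have hXbig : 2 ^ (r + 4) ≤ #X / M := by
      rw [le_div_iff₀ hM]
      refine (not_le.1 hsmall).le.trans (mul_le_of_le_one_left (Nat.cast_nonneg _) ?_)
      exact pow_le_one₀ (by linarith) (by linarith)
    obtain ⟨F, hF⟩ := exists_container hM hlam hK ht D (X := X) (A := #X / M)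
      (by field_simp) hXbig hc hcK htc htM
    set W := (X.powerset.filter fun T => #T ≤ r * t).filter
      fun T => F T ⊆ X ∧ (#(F T) : ℝ) ≤ (1 - c) * #X with hW
    have hsub : (X.powerset.filter fun S => ∀ b, #(S ∩ inc b) < r) ⊆
        W.biUnion fun T => (F T).powerset.filter fun S => ∀ b, #(S ∩ inc b) < r := by
      intro S hS
      obtain ⟨hSX, hSe⟩ := mem_filter.1 hS
      rw [mem_powerset] at hSX
      obtain ⟨T, hTS, hT, hSF, hFX, hFc⟩ := hF S hSX hSe
      exact mem_biUnion.2 ⟨T, mem_filter.2 ⟨mem_filter.2 ⟨mem_powerset.2 (hTS.trans hSX), hT⟩,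
        hFX, hFc⟩, mem_filter.2 ⟨mem_powerset.2 hSF, hSe⟩⟩
    have hWc : (#W : ℝ) ≤ R ^ (r * t) := by
      have h1 : #W ≤ (#X + 1) ^ (r * t) := (card_filter_le _ _).trans (card_filter_card_le X _)
      calc (#W : ℝ) ≤ ((#X : ℝ) + 1) ^ (r * t) := by exact_mod_cast h1
        _ ≤ _ := by gcongr
    calc (#(X.powerset.filter fun S => ∀ b, #(S ∩ inc b) < r) : ℝ)
        ≤ ∑ T ∈ W, (#((F T).powerset.filter fun S => ∀ b, #(S ∩ inc b) < r) : ℝ) := by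
          exact_mod_cast (card_le_card hsub).trans card_biUnion_le
      _ ≤ ∑ T ∈ W, (R ^ (r * t)) ^ l * (2 : ℝ) ^ ((2 : ℝ) ^ (r + 4) * M) := by
          refine sum_le_sum fun T hT => ih (F T) ?_ ?_
          · have h1 : (#(F T) : ℝ) ≤ #X := by
              exact_mod_cast card_le_card (mem_filter.1 hT).2.1
            linarith
          · refine le_trans ?_ hX
            rw [pow_succ, mul_assoc]
            exact mul_le_mul_of_nonneg_left (mem_filter.1 hT).2.2 (pow_nonneg (by linarith) _)
      _ = #W * ((R ^ (r * t)) ^ l * (2 : ℝ) ^ ((2 : ℝ) ^ (r + 4) * M)) := by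
          rw [sum_const, nsmul_eq_mul]
      _ ≤ R ^ (r * t) * ((R ^ (r * t)) ^ l * (2 : ℝ) ^ ((2 : ℝ) ^ (r + 4) * M)) := by gcongr
      _ = _ := by ring

end

theorem exists_pos_mul_le (f g : ℕ → ℝ) (hf : ∀ i, 0 < f i) (hg : ∀ i, 0 < g i) (r : ℕ) :
    ∃ c : ℝ, 0 < c ∧ c ≤ 1 ∧ ∀ i < r, c * f i ≤ g i := by
  induction r with
  | zero => exact ⟨1, one_pos, le_rfl, by simp⟩
  | succ r ih =>
    obtain ⟨c, hc, hc1, h⟩ := ih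
    refine ⟨min c (g r / f r), lt_min hc (div_pos (hg r) (hf r)), (min_le_left _ _).trans hc1,
      fun i hi => ?_⟩
    rcases Nat.lt_succ_iff_lt_or_eq.1 hi with hi | rfl
    · exact (mul_le_mul_of_nonneg_right (min_le_left _ _) (hf i).le).trans (h i hi)
    · exact (mul_le_mul_of_nonneg_right (min_le_right _ _) (hf i).le).trans
        (div_mul_cancel₀ _ (hf i).ne').le

open Classical in
theorem exists_card_evasive_le (r e : ℕ) : ∃ C : ℝ, 0 < C ∧
    ∀ (P B : Type) [Fintype P] [Fintype B] (inc : B → Finset P) (M lam : ℝ),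
      1 ≤ M → 0 < lam → PairwiseDesign inc M lam → (Fintype.card P : ℝ) ≤ M ^ e →
      (#{S : Finset P | ∀ b, #(S ∩ inc b) < r} : ℝ) ≤ (2 : ℝ) ^ (C * M) := by
  set K : ℝ := 2 ^ (r + 8) with hK
  have hK1 : 1 ≤ K := one_le_pow₀ (by norm_num)
  obtain ⟨c, hc, hc1, hcK⟩ := exists_pos_mul_le (fun i => 2 * degreeBound K i)
    (fun i => (1 / K) ^ (i + 2)) (fun i => by linarith [one_le_degreeBound hK1 i])
    (fun i => by positivity) r
  set δ : ℝ := 1 / (r + 1) with hδ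
  have hδ0 : 0 < δ := by positivity
  have hrδ : (r + 1) * δ = 1 := by rw [hδ]; field_simp
  set Q : ℝ := max 2 (2 * (r + 1) / c) with hQ
  have hQ2 : 2 ≤ Q := le_max_left _ _
  set C₁ : ℝ := 2 * (e + 1) * r * (e / c + 2) * (2 / δ) ^ 2 / Real.log 2 with hC₁
  have hlog2 : 0 < Real.log 2 := Real.log_pos (by norm_num)
  have hC₁0 : 0 ≤ C₁ := by positivity
  refine ⟨2 ^ (r + 4) + C₁ + (Q ^ (r + 1)) ^ e, by positivity, ?_⟩
  intro P B _ _ inc M lam hM hlam D hP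
  have hM0 : 0 < M := by linarith
  have hfilter : (univ.filter fun S : Finset P => ∀ b, #(S ∩ inc b) < r) =
      (univ : Finset P).powerset.filter fun S => ∀ b, #(S ∩ inc b) < r := by simp
  by_cases hMQ : M ^ δ < Q
  · have h1 : M ≤ Q ^ (r + 1) := by
      have h2 : M = (M ^ δ) ^ (r + 1) := by
        rw [← Real.rpow_natCast, ← Real.rpow_mul hM0.le]
        push_cast
        rw [mul_comm, hrδ, Real.rpow_one]
      rw [h2]
      gcongr
    have h3 : (Fintype.card P : ℝ) ≤ (2 ^ (r + 4) + C₁ + (Q ^ (r + 1)) ^ e) * M := by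
      have h4 : M ^ e ≤ (Q ^ (r + 1)) ^ e := by gcongr
      have h5 : 0 ≤ (2 : ℝ) ^ (r + 4) := by positivity
      have h6 : 0 ≤ (Q ^ (r + 1)) ^ e := by positivity
      nlinarith
    calc _ ≤ (2 : ℝ) ^ (Fintype.card P) := by
          exact_mod_cast (card_filter_le _ _).trans (by simp)
      _ = (2 : ℝ) ^ (Fintype.card P : ℝ) := (Real.rpow_natCast _ _).symm
      _ ≤ _ := Real.rpow_le_rpow_of_exponent_le (by norm_num) h3
  push Not at hMQ
  have hδ1 : δ ≤ 1 := by
    have : (0 : ℝ) ≤ r * δ := by positivity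
    linarith
  have hMδ : 2 ≤ M ^ δ := hQ2.trans hMQ
  have hM2 : 2 ≤ M := hMδ.trans ((Real.rpow_le_rpow_of_exponent_le hM hδ1).trans (by simp))
  have hsplit : M ^ (1 - δ) * M ^ δ = M := by
    rw [← Real.rpow_add hM0]; simp
  have h1δ : 1 ≤ M ^ (1 - δ) := Real.one_le_rpow hM (by linarith)
  set t : ℕ := ⌈M ^ (1 - δ)⌉₊ with ht
  have htlo : M ^ (1 - δ) ≤ t := Nat.le_ceil _
  have hthi : (t : ℝ) ≤ 2 * M ^ (1 - δ) := by
    have := (Nat.ceil_lt_add_one (show 0 ≤ M ^ (1 - δ) by linarith)).le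
    linarith
  have ht0 : 0 < t := by
    have : (0 : ℝ) < t := by linarith
    exact_mod_cast this
  have htc : ((r : ℝ) + 1) * t ≤ c * M := by
    have h1 : 2 * ((r : ℝ) + 1) ≤ c * M ^ δ := by
      have := (le_max_right _ _).trans hMQ
      rwa [div_le_iff₀ hc, mul_comm (M ^ δ)] at this
    calc ((r : ℝ) + 1) * t ≤ (r + 1) * (2 * M ^ (1 - δ)) := by gcongr
      _ = 2 * (r + 1) * M ^ (1 - δ) := by ring
      _ ≤ c * M ^ δ * M ^ (1 - δ) := by gcongr
      _ = c * (M ^ (1 - δ) * M ^ δ) := by ring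
      _ = c * M := by rw [hsplit]
  have htM : 2 ≤ ((t : ℝ) / M) ^ r * M := by
    have h1 : M ^ (-δ) ≤ t / M := by
      rw [le_div_iff₀ hM0]
      refine le_trans (le_of_eq ?_) htlo
      rw [sub_eq_neg_add, Real.rpow_add hM0, Real.rpow_one]
    calc 2 ≤ M ^ δ := hMδ
      _ = (M ^ (-δ)) ^ r * M := by
          rw [← Real.rpow_natCast, ← Real.rpow_mul hM0.le]
          nth_rewrite 3 [← Real.rpow_one M]
          rw [← Real.rpow_add hM0]
          congr 1
          linarith
      _ ≤ _ := by gcongr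
  have hlogM : 0 < Real.log M := Real.log_pos (by linarith)
  set l : ℕ := ⌈e * Real.log M / c⌉₊ with hl
  have hlle : (l : ℝ) ≤ (e / c + 2) * Real.log M := by
    have h1 := (Nat.ceil_lt_add_one (show 0 ≤ e * Real.log M / c by positivity)).le
    have h2 : Real.log 2 ≤ Real.log M := Real.log_le_log (by norm_num) hM2
    have h3 := Real.log_two_gt_d9
    calc (l : ℝ) ≤ e * Real.log M / c + 1 := h1
      _ ≤ e * Real.log M / c + 2 * Real.log M := by linarith
      _ = _ := by ring
  have hlX : (1 - c) ^ l * #(univ : Finset P) ≤ 2 ^ (r + 4) * M := by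
    have h1 : (1 - c) ^ l ≤ Real.exp (-(e * Real.log M)) := by
      calc (1 - c) ^ l ≤ Real.exp (-c) ^ l := by
            exact pow_le_pow_left₀ (by linarith) (Real.one_sub_le_exp_neg c) l
        _ = Real.exp (l * -c) := (Real.exp_nat_mul _ _).symm
        _ ≤ _ := by
            apply Real.exp_le_exp.2
            have := Nat.le_ceil (e * Real.log M / c)
            rw [div_le_iff₀ hc] at this
            linarith
    have h2 : (#(univ : Finset P) : ℝ) ≤ Real.exp (e * Real.log M) := by
      rw [Real.exp_nat_mul, Real.exp_log hM0]
      exact hP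
    calc (1 - c) ^ l * #(univ : Finset P)
        ≤ Real.exp (-(e * Real.log M)) * Real.exp (e * Real.log M) := by gcongr
      _ = 1 := by rw [← Real.exp_add]; simp
      _ ≤ 2 ^ (r + 4) * M := by
          have : (1 : ℝ) ≤ 2 ^ (r + 4) := one_le_pow₀ (by norm_num)
          nlinarith
  have hR : (#(univ : Finset P) : ℝ) + 1 ≤ M ^ (e + 1) := by
    have h1 : 1 ≤ M ^ e := one_le_pow₀ hM
    have h2 : (#(univ : Finset P) : ℝ) ≤ M ^ e := hP
    rw [pow_succ]
    nlinarith
  have key := card_evasive_le_of_pow_mul_card_le hM0 hlam hK ht0 D hc hc1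
    (fun i hi => by linarith [hcK i hi]) htc htM (one_le_pow₀ hM) l univ hR hlX
  rw [hfilter]
  refine key.trans ?_
  have hexp : ((M ^ (e + 1)) ^ (r * t)) ^ l ≤ (2 : ℝ) ^ (C₁ * M) := by
    rw [← pow_mul, ← pow_mul, Real.rpow_def_of_pos (by norm_num : (0 : ℝ) < 2)]
    nth_rewrite 1 [← Real.exp_log hM0]
    rw [← Real.exp_nat_mul]
    apply Real.exp_le_exp.2
    have h1 : Real.log M ≤ M ^ (δ / 2) * (2 / δ) := by
      have := Real.log_le_rpow_div hM0.le (half_pos hδ0)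
      refine this.trans (le_of_eq ?_)
      field_simp
    have h2 : Real.log M ^ 2 ≤ M ^ δ * (2 / δ) ^ 2 := by
      calc Real.log M ^ 2 ≤ (M ^ (δ / 2) * (2 / δ)) ^ 2 := by gcongr
        _ = _ := by
            rw [mul_pow, ← Real.rpow_natCast (M ^ (δ / 2)), ← Real.rpow_mul hM0.le]
            norm_num
    push_cast
    calc ((e : ℝ) + 1) * (r * t * l) * Real.log M
        ≤ (e + 1) * (r * (2 * M ^ (1 - δ)) * ((e / c + 2) * Real.log M)) * Real.log M := by
          gcongr
      _ = 2 * (e + 1) * r * (e / c + 2) * M ^ (1 - δ) * Real.log M ^ 2 := by ring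
      _ ≤ 2 * (e + 1) * r * (e / c + 2) * M ^ (1 - δ) * (M ^ δ * (2 / δ) ^ 2) := by gcongr
      _ = 2 * (e + 1) * r * (e / c + 2) * (2 / δ) ^ 2 * (M ^ (1 - δ) * M ^ δ) := by ring
      _ = Real.log 2 * (C₁ * M) := by
          rw [hsplit, hC₁]
          field_simp
  calc _ ≤ (2 : ℝ) ^ (C₁ * M) * (2 : ℝ) ^ ((2 : ℝ) ^ (r + 4) * M) := by gcongr
    _ = (2 : ℝ) ^ (C₁ * M + (2 : ℝ) ^ (r + 4) * M) := (Real.rpow_add (by norm_num) _ _).symm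
    _ ≤ _ := by
        refine Real.rpow_le_rpow_of_exponent_le (by norm_num) ?_
        have : 0 ≤ (Q ^ (r + 1)) ^ e * M := by positivity
        linarith


section
variable {F : Type*} [Field F] {k m : ℕ} {V : Type*} [AddCommGroup V] [Module F V]

/-- The affine subspace of `V ≃ F ^ k × F ^ m` that is the graph of `x ↦ L x + y`. -/
def graphFlat (φ : V ≃ₗ[F] (Fin k → F) × (Fin m → F)) (L : (Fin k → F) →ₗ[F] (Fin m → F))
    (y : Fin m → F) : AffineSubspace F V :=
  AffineSubspace.mk' (φ.symm (0, y)) (L.graph.map (φ.symm : _ →ₗ[F] V))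

theorem mem_graphFlat (φ : V ≃ₗ[F] (Fin k → F) × (Fin m → F))
    (L : (Fin k → F) →ₗ[F] (Fin m → F)) (y : Fin m → F) (p : V) :
    p ∈ graphFlat φ L y ↔ (φ p).2 - L (φ p).1 = y := by
  rw [graphFlat, AffineSubspace.mem_mk', vsub_eq_sub, Submodule.mem_map]
  constructor
  · rintro ⟨z, hz, hzp⟩
    have h : φ p = z + (0, y) := by
      have := congrArg φ hzp
      simp at this
      rw [this]
      simp
    rw [LinearMap.mem_graph_iff] at hz
    simp [h, hz]
  · intro h
    refine ⟨φ p - (0, y), ?_, by simp⟩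
    rw [LinearMap.mem_graph_iff]
    simp [← h]

theorem finrank_direction_graphFlat (φ : V ≃ₗ[F] (Fin k → F) × (Fin m → F))
    (L : (Fin k → F) →ₗ[F] (Fin m → F)) (y : Fin m → F) :
    Module.finrank F (graphFlat φ L y).direction = k := by
  rw [graphFlat, AffineSubspace.direction_mk', LinearEquiv.finrank_map_eq,
    LinearMap.graph_eq_range_prod, LinearMap.finrank_range_of_inj, Module.finrank_fin_fun]
  intro a b h
  exact congrArg Prod.fst h

open Classical in
theorem pairwiseDesign_graphFlat [Fintype F] [Fintype V]
    [Fintype ((Fin k → F) →ₗ[F] (Fin m → F))] (φ : V ≃ₗ[F] (Fin k → F) × (Fin m → F)) :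
    PairwiseDesign
      (fun b : ((Fin k → F) →ₗ[F] (Fin m → F)) × (Fin m → F) =>
        ({p | p ∈ graphFlat φ b.1 b.2} : Finset V))
      ((Fintype.card F : ℝ) ^ m)
      (Fintype.card ((Fin k → F) →ₗ[F] (Fin m → F)) / (Fintype.card F : ℝ) ^ m) := by
  have hq : (0 : ℝ) < (Fintype.card F : ℝ) ^ m := by
    have : 0 < Fintype.card F := Fintype.card_pos
    positivity
  refine ⟨?_, fun p => ?_, fun p p' hpp => ?_⟩
  · rw [Fintype.card_prod, Fintype.card_fun, Fintype.card_fin]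
    push_cast
    field_simp
  · rw [div_mul_cancel₀ _ hq.ne', ← card_univ]
    norm_cast
    refine card_bij' (fun b _ => b.1) (fun L _ => (L, (φ p).2 - L (φ p).1)) ?_ ?_ ?_ ?_
    · simp
    · simp [mem_graphFlat]
    · rintro ⟨L, y⟩ h
      simp only [mem_filter, mem_univ, true_and, mem_graphFlat] at h
      simp [h]
    · simp
  · rw [le_div_iff₀ hq]
    by_cases hx : (φ p).1 = (φ p').1
    · have : (univ.filter fun b : ((Fin k → F) →ₗ[F] (Fin m → F)) × (Fin m → F) =>
          p ∈ ({p | p ∈ graphFlat φ b.1 b.2} : Finset V) ∧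
          p' ∈ ({p | p ∈ graphFlat φ b.1 b.2} : Finset V)) = ∅ := by
        refine filter_eq_empty_iff.2 fun b _ h => hpp ?_
        simp only [mem_filter, mem_univ, true_and, mem_graphFlat] at h
        apply φ.injective
        refine Prod.ext hx ?_
        have := h.1.trans h.2.symm
        rw [hx] at this
        exact sub_left_injective this
      rw [this]
      simp
    · obtain ⟨ψ, hψ⟩ := Module.Projective.exists_dual_eq_one F (sub_ne_zero.2 hx)
      have hcard : Fintype.card F ^ m = #(univ : Finset (Fin m → F)) := by simp
      rw [← Nat.cast_pow, ← Nat.cast_mul, Nat.cast_le, hcard, ← card_product, ← card_univ]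
      refine card_le_card_of_injOn (fun bu => bu.1.1 + ψ.smulRight bu.2) (by simp) ?_
      rintro ⟨⟨L, y⟩, u⟩ h ⟨⟨L', y'⟩, u'⟩ h' heq
      simp only [coe_product, Set.mem_prod, mem_coe, mem_filter, mem_univ, true_and, and_true,
        mem_graphFlat] at h h'
      have hz : L ((φ p).1 - (φ p').1) = L' ((φ p).1 - (φ p').1) := by
        rw [map_sub, map_sub, sub_eq_sub_iff_add_eq_add, ← sub_eq_zero]
        have h1 := h.1.trans h.2.symm
        have h2 := h'.1.trans h'.2.symm
        have h3 := congrArg₂ (· - ·) h2 h1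
        rw [← sub_eq_zero] at h3
        rw [← h3]
        abel
      have hu : u = u' := by
        have h1 := LinearMap.congr_fun heq ((φ p).1 - (φ p').1)
        simpa [-map_sub, hz, hψ] using h1
      subst hu
      have hL : L = L' := add_right_cancel heq
      subst hL
      rw [← h.1, ← h'.1]

end

/-- For all integers `n > k ≥ 1` and `r > k` there exists a constant `C > 0`
such that for every prime power `q` (i.e. every finite field `F` of cardinality `q`), the
number of `(k, r)`-evasive subsets of `F^n` is at most `2 ^ (C · q^(n-k))`. Here a set
`S ⊆ F^n` is `(k, r)`-evasive if `|S ∩ W| < r` for every `k`-dimensional affine subspace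
`W` of `F^n`. -/
theorem statement3 (n k r : ℕ) (hk : 1 ≤ k) (hkn : k < n) (hr : k < r) :
    ∃ C : ℝ, 0 < C ∧
      ∀ q : ℕ, IsPrimePow q →
        ∀ (F : Type) [Field F] [Fintype F], Fintype.card F = q →
          (({S : Set (Fin n → F) |
              ∀ W : AffineSubspace F (Fin n → F),
                Module.finrank F W.direction = k →
                  (S ∩ (W : Set (Fin n → F))).ncard < r}.ncard : ℝ)) ≤
            2 ^ (C * (q : ℝ) ^ (n - k)) := by
  classical
  obtain ⟨C, hC, hcount⟩ := exists_card_evasive_le r n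
  refine ⟨C, hC, fun q _ F _ _ hF => ?_⟩
  have hq : 1 < q := hF ▸ Fintype.one_lt_card
  have hq1 : (1 : ℝ) ≤ q := by exact_mod_cast hq.le
  let φ : (Fin n → F) ≃ₗ[F] (Fin k → F) × (Fin (n - k) → F) :=
    LinearEquiv.ofFinrankEq _ _ (by simp; omega)
  have : Finite ((Fin k → F) →ₗ[F] (Fin (n - k) → F)) :=
    Finite.of_injective _ DFunLike.coe_injective
  let _ : Fintype ((Fin k → F) →ₗ[F] (Fin (n - k) → F)) := Fintype.ofFinite _
  have D := pairwiseDesign_graphFlat φ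
  rw [hF] at D
  have hle := hcount _ _ _ _ _ (one_le_pow₀ hq1)
    (div_pos (by exact_mod_cast Fintype.card_pos) (by positivity)) D (by
      rw [Fintype.card_fun, Fintype.card_fin, hF, ← pow_mul]
      push_cast
      exact pow_le_pow_right₀ hq1 (Nat.le_mul_of_pos_left n (by omega)))
  refine le_trans ?_ hle
  rw [Nat.cast_le, ← Set.ncard_coe_finset]
  refine Set.ncard_le_ncard_of_injOn (fun S => S.toFinset) (fun S hS => ?_)
    (fun S _ S' _ h => Set.toFinset_inj.1 h) (Set.toFinite _)
  simp only [coe_filter, mem_univ, true_and, Set.mem_ofPred_eq]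
  intro b
  have h := hS (graphFlat φ b.1 b.2) (finrank_direction_graphFlat φ b.1 b.2)
  rw [← Set.ncard_coe_finset]
  convert h using 2
  ext p
  simp
end
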